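/- arXiv:0707.2873 — 3 statements merged into one kernel-verified Lean document; each statement's English description precedes it below -/
import Mathlib

section
/- Let W be a finite vector space over a prime field, let G be a group with W ≤ G ≤ AGL(W) (G contains all translations of W), and let p ≥ 3 be a prime not dividing the order of G. Then there exists a G-regular partition of W into at most p parts. -/
open Pi (single single_apply)

/-- A coloring is rigid if no nontrivial affine automorphism preserves it. -/
def IsAffineRigid (k : Type*) {W α : Type*} [Ring k] [AddCommGroup W] [Module k W]
    (f : W → α) : Prop :=
  ∀ g : W ≃ᵃ[k] W, (∀ w, f (g w) = f w) → g = 1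

theorem exists_isAffineRigid_of_linearEquiv {k W W' α : Type*} [Ring k] [AddCommGroup W]
    [Module k W] [AddCommGroup W'] [Module k W'] (e : W ≃ₗ[k] W')
    (h : ∃ f : W' → α, IsAffineRigid k f) : ∃ f : W → α, IsAffineRigid k f := by
  obtain ⟨f, hf⟩ := h
  refine ⟨fun w => f (e w), fun g hg => ?_⟩
  have h1 := hf ((e.symm.toAffineEquiv.trans g).trans e.toAffineEquiv) (fun w => by
    simpa using hg (e.symm w))
  ext w
  have h2 := congrArg (fun t : W' ≃ᵃ[k] W' => t (e w)) h1
  simpa using h2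

theorem affineEquiv_map_add {k W : Type*} [Ring k] [AddCommGroup W] [Module k W]
    (g : W ≃ᵃ[k] W) (x y : W) : g (x + y) = g x + g y - g 0 := by
  have h1 := g.map_vadd y x
  have h2 := g.map_vadd 0 x
  simp only [vadd_eq_add, add_zero] at h1 h2
  rw [h1, h2]
  abel

theorem affineEquiv_linear_apply {k W : Type*} [Ring k] [AddCommGroup W] [Module k W]
    {g : W ≃ᵃ[k] W} (h0 : g 0 = 0) (w : W) : g.linear w = g w := by
  simpa [h0] using (g.map_vadd 0 w).symm

theorem affineEquiv_eq_one {k W : Type*} [Ring k] [AddCommGroup W] [Module k W]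
    {g : W ≃ᵃ[k] W} (h0 : g 0 = 0) (h : (g.linear : W →ₗ[k] W) = LinearMap.id) : g = 1 := by
  ext w
  rw [← affineEquiv_linear_apply h0]
  exact congrArg (fun t : W →ₗ[k] W => t w) h

section Pi

variable {ι R : Type*} [DecidableEq ι] [Ring R] [Nontrivial R]

theorem single_one_injective {i j : ι} (h : (single i 1 : ι → R) = single j 1) : i = j := by
  have := congrFun h i
  by_contra hij
  simp [hij] at this

theorem single_ne_add_single {i l m : ι} (hlm : l ≠ m) :
    (single l 1 + single m 1 : ι → R) ≠ single i 1 := by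
  intro h
  have hl := congrFun h l
  have hm := congrFun h m
  simp only [Pi.add_apply, single_apply, hlm, hlm.symm, if_true, if_false] at hl hm
  grind [one_ne_zero (α := R)]

theorem add_single_ne_zero {l m : ι} (hlm : l ≠ m) :
    (single l 1 + single m 1 : ι → R) ≠ 0 := by
  intro h
  have hl := congrFun h l
  simp [hlm] at hl

theorem add_single_eq {i j l m : ι} (hij : i ≠ j)
    (h : (single i 1 + single j 1 : ι → R) = single l 1 + single m 1) :
    (i = l ∧ j = m) ∨ (i = m ∧ j = l) := by
  have hi := congrFun h i
  have hj := congrFun h j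
  simp only [Pi.add_apply, single_apply, hij, hij.symm, if_true, if_false] at hi hj
  grind [one_ne_zero (α := R)]

/-- An injective self-map of a path that fixes the first vertex and preserves adjacency is the
identity. -/
theorem path_rigid {n : ℕ} (s : Fin n → Fin n) (hs : Function.Injective s)
    (hfirst : ∀ i : Fin n, i.val = 0 → s i = i)
    (hedge : ∀ i j : Fin n, j.val = i.val + 1 →
      (s j).val = (s i).val + 1 ∨ (s i).val = (s j).val + 1) (i : Fin n) : s i = i := by
  obtain ⟨i, hi⟩ := i
  induction i using Nat.strong_induction_on with
  | _ i ih =>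
    rcases i with _ | i
    · exact hfirst _ rfl
    have hprev := ih i (by omega) (by omega)
    rcases hedge ⟨i, by omega⟩ ⟨i + 1, hi⟩ rfl with h | h <;> rw [hprev] at h
    · exact Fin.ext h
    · have hfix := hs (ih _ (by simp only at h; omega) (s ⟨i + 1, hi⟩).2)
      have := congrArg Fin.val hfix
      simp only at this h
      omega

end Pi

section FiveColors

variable {R : Type*} [Ring R] [Nontrivial R]

open Classical in
/-- The origin, the first basis vector, the other basis vectors and the sums of consecutive basis
vectors receive four different colors. -/
noncomputable def pathColoring (n : ℕ) (w : Fin n → R) : Fin 5 :=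
  if w = 0 then 3
  else if ∃ i : Fin n, i.val = 0 ∧ w = single i 1 then 4
  else if ∃ i : Fin n, w = single i 1 then 1
  else if ∃ i j : Fin n, j.val = i.val + 1 ∧ w = single i 1 + single j 1 then 2
  else 0

theorem isAffineRigid_pathColoring (n : ℕ) :
    IsAffineRigid R (pathColoring n : (Fin n → R) → Fin 5) := by
  intro g hg
  have h0 : g 0 = 0 := by
    have := hg 0
    unfold pathColoring at this
    split_ifs at this <;> simp_all
  have hadd (x y) : g (x + y) = g x + g y := by rw [affineEquiv_map_add, h0, sub_zero]
  have hs (i : Fin n) : (single i 1 : Fin n → R) ≠ 0 := by simp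
  have hfirst (i : Fin n) (hi : i.val = 0) : g (single i 1) = single i 1 := by
    have h := hg (single i 1)
    have hc : pathColoring n (single i 1 : Fin n → R) = 4 := by
      unfold pathColoring
      rw [if_neg (hs i), if_pos ⟨i, hi, rfl⟩]
    rw [hc] at h
    have : ∃ j : Fin n, j.val = 0 ∧ g (single i 1) = single j 1 := by
      unfold pathColoring at h
      split_ifs at h <;> simp_all
    obtain ⟨j, hj, h⟩ := this
    rw [h, show j = i from Fin.ext (hj.trans hi.symm)]
  have hvert (i : Fin n) : ∃ j, g (single i 1) = single j 1 := by
    by_cases hi : i.val = 0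
    · exact ⟨i, hfirst i hi⟩
    have h := hg (single i 1)
    have hc : pathColoring n (single i 1 : Fin n → R) = 1 := by
      unfold pathColoring
      rw [if_neg (hs i), if_neg, if_pos ⟨i, rfl⟩]
      rintro ⟨j, hj, h⟩
      exact hi (single_one_injective h ▸ hj)
    rw [hc] at h
    unfold pathColoring at h
    split_ifs at h <;> simp_all
  choose s hs using hvert
  have hsinj : Function.Injective s := fun i j h =>
    single_one_injective (g.injective (by rw [hs, hs, h]))
  have hedge (i j : Fin n) (hij : j.val = i.val + 1) :
      (s j).val = (s i).val + 1 ∨ (s i).val = (s j).val + 1 := by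
    have hne : i ≠ j := by rintro rfl; omega
    have h := hg (single i 1 + single j 1)
    have hc : pathColoring n (single i 1 + single j 1 : Fin n → R) = 2 := by
      unfold pathColoring
      rw [if_neg (add_single_ne_zero hne), if_neg, if_neg, if_pos ⟨i, j, hij, rfl⟩]
      · rintro ⟨l, h⟩; exact single_ne_add_single hne h
      · rintro ⟨l, -, h⟩; exact single_ne_add_single hne h
    rw [hc, hadd, hs, hs] at h
    have : ∃ l m : Fin n, m.val = l.val + 1 ∧
        (single (s i) 1 + single (s j) 1 : Fin n → R) = single l 1 + single m 1 := by
      unfold pathColoring at h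
      split_ifs at h <;> simp_all
    obtain ⟨l, m, hlm, h⟩ := this
    rcases add_single_eq (hsinj.ne hne) h with ⟨h1, h2⟩ | ⟨h1, h2⟩ <;> rw [h1, h2] <;> simp [hlm]
  have hfix := path_rigid s hsinj
    (fun i hi => single_one_injective ((hs i).symm.trans (hfirst i hi))) hedge
  refine affineEquiv_eq_one h0 (LinearMap.pi_ext' fun i => LinearMap.ext_ring ?_)
  simp [affineEquiv_linear_apply h0, hs, hfix]

end FiveColors

section Directed

variable {K W : Type*} [Field K] [AddCommGroup W] [Module K W]

theorem two_mul_single_sub_ne_single {ι : Type*} [DecidableEq ι] (h2 : (2 : K) ≠ 0)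
    {i j l : ι} (hij : i ≠ j) : ((2 : K) • single i 1 - single j 1 : ι → K) ≠ single l 1 := by
  intro h
  have hi := congrFun h i
  simp only [Pi.sub_apply, Pi.smul_apply, single_apply, hij, if_true, if_false, smul_eq_mul,
    mul_one, sub_zero] at hi
  split_ifs at hi
  · exact one_ne_zero (by linear_combination hi : (1 : K) = 0)
  · exact h2 hi

theorem two_mul_single_sub_eq {ι : Type*} [DecidableEq ι] (h2 : (2 : K) ≠ 0) (h3 : (3 : K) ≠ 0)
    {i j l m : ι} (hij : i ≠ j) (h : ((2 : K) • single i 1 - single j 1 : ι → K) =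
      (2 : K) • single l 1 - single m 1) : i = l ∧ j = m := by
  have hi : i = l := by
    have hi := congrFun h i
    by_contra hne
    simp only [Pi.sub_apply, Pi.smul_apply, single_apply, hij, hne, if_true, if_false, smul_eq_mul,
      mul_one, mul_zero, sub_zero, zero_sub] at hi
    split_ifs at hi
    · exact h3 (by linear_combination hi)
    · exact h2 (by linear_combination hi)
  subst hi
  exact ⟨rfl, single_one_injective (sub_right_injective h)⟩

/-- A self-map of `Fin n` sending consecutive elements to consecutive elements is the identity. -/
theorem eq_of_map_succ {n : ℕ} (s : Fin n → Fin n)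
    (hs : ∀ i j : Fin n, j.val = i.val + 1 → (s j).val = (s i).val + 1) (i : Fin n) : s i = i := by
  have key : ∀ k (hk : k < n), (s ⟨k, hk⟩).val = (s ⟨0, by omega⟩).val + k := by
    intro k
    induction k with
    | zero => intro; rfl
    | succ k ih =>
      intro hk
      rw [hs ⟨k, by omega⟩ ⟨k + 1, hk⟩ rfl, ih (by omega)]
      omega
  have h1 := key (n - 1) (by have := i.2; omega)
  have h2 := (s ⟨n - 1, by have := i.2; omega⟩).2
  have h3 := key i.val i.2
  ext
  simp only [Fin.eta] at h3
  omega

open Classical in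
/-- The points of an affine basis and the points `2 b i - b (i + 1)` get two different colors. -/
noncomputable def frameColoring {n : ℕ} (b : AffineBasis (Fin n) K W) (w : W) : Fin 3 :=
  if ∃ i, w = b i then 1
  else if ∃ i j : Fin n, j.val = i.val + 1 ∧ w = AffineMap.lineMap (b j) (b i) (2 : K) then 2
  else 0

theorem coords_lineMap {n : ℕ} (b : AffineBasis (Fin n) K W) (i j : Fin n) :
    b.coords (AffineMap.lineMap (b j) (b i) (2 : K)) =
      ((2 : K) • single i 1 - single j 1 : Fin n → K) := by
  ext l
  rw [AffineBasis.coords_apply, AffineMap.apply_lineMap, AffineMap.lineMap_apply]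
  simp only [b.coord_apply, single_apply, Pi.sub_apply, Pi.smul_apply, vsub_eq_sub, smul_eq_mul,
    vadd_eq_add]
  ring

theorem coords_point {n : ℕ} (b : AffineBasis (Fin n) K W) (i : Fin n) :
    b.coords (b i) = (single i 1 : Fin n → K) := by
  ext l
  rw [AffineBasis.coords_apply, b.coord_apply, single_apply]

theorem isAffineRigid_frameColoring (h2 : (2 : K) ≠ 0) (h3 : (3 : K) ≠ 0) {n : ℕ}
    (b : AffineBasis (Fin n) K W) : IsAffineRigid K (frameColoring b) := by
  intro g hg
  have hvert (i : Fin n) : ∃ j, g (b i) = b j := by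
    have h := hg (b i)
    have hc : frameColoring b (b i) = 1 := if_pos ⟨i, rfl⟩
    rw [hc] at h
    unfold frameColoring at h
    split_ifs at h <;> simp_all
  choose s hs using hvert
  have hsinj : Function.Injective s := fun i j h =>
    b.ind.injective (g.injective (by rw [hs, hs, h]))
  have hsucc (i j : Fin n) (hij : j.val = i.val + 1) : (s j).val = (s i).val + 1 := by
    have hne : i ≠ j := by rintro rfl; omega
    have h := hg (AffineMap.lineMap (b j) (b i) (2 : K))
    have hc : frameColoring b (AffineMap.lineMap (b j) (b i) (2 : K)) = 2 := by
      unfold frameColoring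
      rw [if_neg, if_pos ⟨i, j, hij, rfl⟩]
      rintro ⟨l, h⟩
      have := congrArg b.coords h
      rw [coords_lineMap, coords_point] at this
      exact two_mul_single_sub_ne_single h2 hne this
    rw [hc, AffineEquiv.apply_lineMap, hs, hs] at h
    have : ∃ l m : Fin n, m.val = l.val + 1 ∧ AffineMap.lineMap (b (s j)) (b (s i)) (2 : K) =
        AffineMap.lineMap (b m) (b l) (2 : K) := by
      unfold frameColoring at h
      split_ifs at h <;> simp_all
    obtain ⟨l, m, hlm, h⟩ := this
    have := congrArg b.coords h
    rw [coords_lineMap, coords_lineMap] at this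
    obtain ⟨rfl, rfl⟩ := two_mul_single_sub_eq h2 h3 (hsinj.ne hne) this
    exact hlm
  have hfix (i : Fin n) : g (b i) = b i := by rw [hs, eq_of_map_succ s hsucc]
  have hspan : Set.EqOn g.toAffineMap (AffineMap.id K W) (affineSpan K (Set.range b)) :=
    AffineMap.eqOn_affineSpan (by rintro _ ⟨i, rfl⟩; exact hfix i)
  ext w
  exact hspan (by rw [b.tot]; exact AffineSubspace.mem_top K W w)

end Directed

section PlaneColoring

open Classical in
/-- A three-coloring of a binary space of dimension `k + 2`: a plane together with `k` further
independent vectors, a path on these vectors whose first end has two pendant vertices and whose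
last end has one, and everything else. -/
noncomputable def planeColoring (k : ℕ) (w : (ZMod 2 × ZMod 2) × (Fin k → ZMod 2)) : Fin 3 :=
  if w.2 = 0 ∨ (w.1 = 0 ∧ ∃ i, w.2 = single i 1) then 1
  else if (w.1 = 0 ∧ ∃ i j : Fin k, j.val = i.val + 1 ∧ w.2 = single i 1 + single j 1) ∨
    (∃ i : Fin k, i.val = 0 ∧ (w.1 = (1, 0) ∨ w.1 = (0, 1)) ∧ w.2 = single i 1) ∨
    (∃ i : Fin k, i.val + 1 = k ∧ w.1 = (1, 0) ∧ w.2 = single i 1) then 2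
  else 0

theorem planeColoring_eq_one_iff {k : ℕ} {w : (ZMod 2 × ZMod 2) × (Fin k → ZMod 2)} :
    planeColoring k w = 1 ↔ w.2 = 0 ∨ (w.1 = 0 ∧ ∃ i, w.2 = single i 1) := by
  unfold planeColoring
  split_ifs with h1 h2 <;> simp [h1]

theorem planeColoring_eq_two_iff {k : ℕ} {w : (ZMod 2 × ZMod 2) × (Fin k → ZMod 2)} :
    planeColoring k w = 2 ↔
      (w.1 = 0 ∧ ∃ i j : Fin k, j.val = i.val + 1 ∧ w.2 = single i 1 + single j 1) ∨
      (∃ i : Fin k, i.val = 0 ∧ (w.1 = (1, 0) ∨ w.1 = (0, 1)) ∧ w.2 = single i 1) ∨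
      (∃ i : Fin k, i.val + 1 = k ∧ w.1 = (1, 0) ∧ w.2 = single i 1) := by
  unfold planeColoring
  split_ifs with h1 h2
  · refine iff_of_false (by decide) ?_
    rintro (⟨-, i, j, hij, h⟩ | ⟨i, -, h, h'⟩ | ⟨i, -, h, h'⟩)
    · have hne : i ≠ j := by rintro rfl; omega
      rcases h1 with h1 | ⟨-, l, h1⟩
      · exact add_single_ne_zero hne (h.symm.trans h1)
      · exact single_ne_add_single hne (h.symm.trans h1)
    · have hw : w.1 = 0 := h1.elim (fun h1 => by simpa [h1] using congrFun h' i) And.left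
      rw [hw] at h
      revert h; decide
    · have hw : w.1 = 0 := h1.elim (fun h1 => by simpa [h1] using congrFun h' i) And.left
      rw [hw] at h
      revert h; decide
  · simp [h2]
  · exact iff_of_false (by decide) h2

theorem affineEquiv_map_add_add {W : Type*} [AddCommGroup W] [Module (ZMod 2) W]
    (g : W ≃ᵃ[ZMod 2] W) (x y z : W) : g (x + y + z) = g x + g y + g z := by
  calc g (x + y + z) = g x + g y + g z - (g 0 + g 0) := by
        rw [affineEquiv_map_add, affineEquiv_map_add]; abel
    _ = _ := by rw [ZModModule.add_self, sub_zero]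

theorem isAffineRigid_planeColoring {k : ℕ} (hk : 2 ≤ k) :
    IsAffineRigid (ZMod 2) (planeColoring k) := by
  intro g hg
  have hplane (u : ZMod 2 × ZMod 2) : (g (u, 0)).2 = 0 := by
    have hcol (u) : planeColoring k (g (u, 0)) = 1 := by
      rw [hg, planeColoring_eq_one_iff]; simp
    rcases planeColoring_eq_one_iff.1 (hcol u) with h | ⟨h1, i, h2⟩
    · exact h
    exfalso
    have hother (u' : ZMod 2 × ZMod 2) (hu : u' ≠ u) : (g (u', 0)).2 i = 0 := by
      rcases planeColoring_eq_one_iff.1 (hcol u') with h | ⟨h3, j, h4⟩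
      · simp [h]
      · have hij : i ≠ j := by
          rintro rfl
          have := g.injective (Prod.ext (h3.trans h1.symm) (h4.trans h2.symm))
          exact hu (congrArg Prod.fst this)
        simp [h4, hij]
    have hsum : ((u, 0) : (ZMod 2 × ZMod 2) × (Fin k → ZMod 2)) =
        (u + (1, 0), 0) + (u + (0, 1), 0) + (u + (1, 1), 0) := by
      refine Prod.ext ?_ (by simp)
      change u = u + (1, 0) + (u + (0, 1)) + (u + (1, 1))
      clear * -; revert u; decide
    have h := congrArg (fun w => w.2 i) (affineEquiv_map_add_add g (u + (1, 0), 0)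
      (u + (0, 1), 0) (u + (1, 1), 0))
    simp only [← hsum, Prod.snd_add, Pi.add_apply] at h
    rw [h2, hother, hother, hother] at h
    · simp at h
    all_goals clear * -; revert u; decide
  have hUinj : Function.Injective fun u => (g (u, 0)).1 := fun u v h =>
    congrArg Prod.fst (g.injective (Prod.ext h ((hplane u).trans (hplane v).symm)))
  have hvert (i : Fin k) : ∃ j, g (0, single i 1) = (0, single j 1) := by
    have hc : planeColoring k (g (0, single i 1)) = 1 := by
      rw [hg, planeColoring_eq_one_iff]; exact Or.inr ⟨rfl, i, rfl⟩
    rcases planeColoring_eq_one_iff.1 hc with h | ⟨h1, j, h2⟩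
    · exfalso
      obtain ⟨u, hu⟩ := Finite.surjective_of_injective hUinj (g (0, single i 1)).1
      have := g.injective (Prod.ext hu ((hplane u).trans h.symm))
      have := congrFun (congrArg Prod.snd this) i
      simp at this
    · exact ⟨j, Prod.ext h1 h2⟩
  choose s hs using hvert
  have hsinj : Function.Injective s := fun i j h =>
    single_one_injective (congrArg Prod.snd
      (g.injective ((hs i).trans (((hs j).trans (by rw [h])).symm))))
  set t := (g 0).1 with ht
  have h0 : g 0 = (t, 0) := Prod.ext rfl (hplane 0)
  have hedge (i j : Fin k) (hij : j.val = i.val + 1) : t = 0 ∧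
      ((s j).val = (s i).val + 1 ∨ (s i).val = (s j).val + 1) := by
    have hne : s i ≠ s j := hsinj.ne (by rintro rfl; omega)
    have hc : planeColoring k (g (0, single i 1 + single j 1)) = 2 := by
      rw [hg, planeColoring_eq_two_iff]; exact Or.inl ⟨rfl, i, j, hij, rfl⟩
    have hval : g (0, single i 1 + single j 1) = (-t, single (s i) 1 + single (s j) 1) := by
      have := affineEquiv_map_add g (0, single i 1) (0, single j 1)
      simpa [hs, h0] using this
    rw [hval, planeColoring_eq_two_iff] at hc
    rcases hc with ⟨h1, l, m, hlm, h⟩ | ⟨l, -, -, h⟩ | ⟨l, -, -, h⟩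
    · refine ⟨by simpa using h1, ?_⟩
      rcases add_single_eq hne h with ⟨h1, h2⟩ | ⟨h1, h2⟩ <;> rw [h1, h2] <;> simp [hlm]
    · exact absurd h (single_ne_add_single hne)
    · exact absurd h (single_ne_add_single hne)
  have ht0 : t = 0 := (hedge ⟨0, by omega⟩ ⟨1, by omega⟩ rfl).1
  have hg0 : g 0 = 0 := by rw [h0, ht0]; rfl
  have hpend (u : ZMod 2 × ZMod 2) (i : Fin k)
      (h : planeColoring k (u, single i 1) = 2) :
      ((s i).val = 0 ∧ ((g (u, 0)).1 = (1, 0) ∨ (g (u, 0)).1 = (0, 1))) ∨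
        ((s i).val + 1 = k ∧ (g (u, 0)).1 = (1, 0)) := by
    have hval : g (u, single i 1) = ((g (u, 0)).1, single (s i) 1) := by
      have := affineEquiv_map_add g (u, 0) (0, single i 1)
      refine Prod.ext ?_ ?_
      · simpa [hs, hg0] using congrArg Prod.fst this
      · simpa [hs, hg0, hplane] using congrArg Prod.snd this
    rw [← hg, hval, planeColoring_eq_two_iff] at h
    rcases h with ⟨-, l, m, hlm, h⟩ | ⟨l, hl, hu, h⟩ | ⟨l, hl, hu, h⟩
    · exact absurd h.symm (single_ne_add_single (by rintro rfl; omega))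
    · exact Or.inl ⟨single_one_injective h ▸ hl, hu⟩
    · exact Or.inr ⟨single_one_injective h ▸ hl, hu⟩
  have hab : (g ((1, 0), 0)).1 ≠ (g ((0, 1), 0)).1 := hUinj.ne (by decide)
  have hfirst (i : Fin k) (hi : i.val = 0) : s i = i := by
    have h1 := hpend (1, 0) i (planeColoring_eq_two_iff.2 (by
      exact Or.inr (Or.inl ⟨i, hi, Or.inl rfl, rfl⟩)))
    have h2 := hpend (0, 1) i (planeColoring_eq_two_iff.2 (by
      exact Or.inr (Or.inl ⟨i, hi, Or.inr rfl, rfl⟩)))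
    ext
    grind
  have hfix := path_rigid s hsinj hfirst fun i j hij => (hedge i j hij).2
  have ha : (g ((1, 0), 0)).1 = (1, 0) := by
    have h := hpend (1, 0) ⟨k - 1, by omega⟩ (planeColoring_eq_two_iff.2 (by
      exact Or.inr (Or.inr ⟨_, by simp only; omega, rfl, rfl⟩)))
    rw [hfix] at h
    simp only at h
    grind
  have hb : (g ((0, 1), 0)).1 = (0, 1) := by
    have h := hpend (0, 1) ⟨0, by omega⟩ (planeColoring_eq_two_iff.2 (by
      exact Or.inr (Or.inl ⟨_, rfl, Or.inr rfl, rfl⟩)))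
    grind
  refine affineEquiv_eq_one hg0 (LinearMap.prod_ext (LinearMap.prod_ext ?_ ?_)
    (LinearMap.pi_ext' fun i => ?_)) <;> refine LinearMap.ext_ring ?_
  · have : g ((1, 0), 0) = ((1, 0), 0) := Prod.ext ha (hplane _)
    simp [affineEquiv_linear_apply hg0, this]
  · have : g ((0, 1), 0) = ((0, 1), 0) := Prod.ext hb (hplane _)
    simp [affineEquiv_linear_apply hg0, this]
  · simp [affineEquiv_linear_apply hg0, hs, hfix]

end PlaneColoring

section Dimension3

variable {W : Type*} [AddCommGroup W] [Module (ZMod 2) W]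

/-- Three vectors in general position that determine every linear map. -/
structure IsTriad (x y z : W) : Prop where
  ne₁ : x ≠ 0
  ne₂ : y ≠ 0
  ne₃ : z ≠ 0
  ne₁₂ : x ≠ y
  ne₂₃ : y ≠ z
  ne₁₃ : x ≠ z
  sum_ne : x + y + z ≠ 0
  ext : ∀ g : W ≃ᵃ[ZMod 2] W, g 0 = 0 → g x = x → g y = y → g z = z → g = 1

theorem IsTriad.rotate {x y z : W} (h : IsTriad x y z) : IsTriad y z x where
  ne₁ := h.ne₂
  ne₂ := h.ne₃
  ne₃ := h.ne₁
  ne₁₂ := h.ne₂₃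
  ne₂₃ := h.ne₁₃.symm
  ne₁₃ := h.ne₁₂.symm
  sum_ne h' := h.sum_ne (by rw [← h']; abel)
  ext g h0 hy hz hx := h.ext g h0 hx hy hz

theorem IsTriad.swap {x y z : W} (h : IsTriad x y z) : IsTriad y x z where
  ne₁ := h.ne₂
  ne₂ := h.ne₁
  ne₃ := h.ne₃
  ne₁₂ := h.ne₁₂.symm
  ne₂₃ := h.ne₁₃
  ne₁₃ := h.ne₂₃
  sum_ne h' := h.sum_ne (by rw [← h']; abel)
  ext g h0 hy hx hz := h.ext g h0 hx hy hz

theorem affineEquiv_map_add_of_map_zero {g : W ≃ᵃ[ZMod 2] W} (h0 : g 0 = 0) (x y : W) :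
    g (x + y) = g x + g y := by
  rw [affineEquiv_map_add, h0, sub_zero]

theorem IsTriad.add {x y z : W} (h : IsTriad x y z) : IsTriad (x + y) y z where
  ne₁ := by have := h.ne₁₂; have := ZModModule.add_self y; grind
  ne₂ := h.ne₂
  ne₃ := h.ne₃
  ne₁₂ := by have := h.ne₁; grind
  ne₂₃ := h.ne₂₃
  ne₁₃ := by have := h.sum_ne; have := ZModModule.add_self z; grind
  sum_ne := by
    have := h.ne₁₃; have := ZModModule.add_self y; have := ZModModule.add_self z; grind
  ext g h0 hxy hy hz := h.ext g h0 (by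
    rw [affineEquiv_map_add_of_map_zero h0, hy] at hxy
    exact add_right_cancel hxy) hy hz

variable {G : Subgroup (W ≃ᵃ[ZMod 2] W)}

/-- Two transvections in `G` fixing `r` whose product has order three. -/
theorem false_of_opposite_transvections (hG : ∀ g ∈ G, g ^ 3 = 1 → g = 1) {x y r : W}
    (hne : x ≠ y)
    (hext : ∀ g : W ≃ᵃ[ZMod 2] W, g 0 = 0 → g x = x → g y = y → g r = r → g = 1)
    {g h : W ≃ᵃ[ZMod 2] W} (hg : g ∈ G) (hh : h ∈ G)
    (hg0 : g 0 = 0) (hh0 : h 0 = 0) (hgx : g x = x) (hgr : g r = r) (hgy : g y = x + y)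
    (hhy : h y = y) (hhr : h r = r) (hhx : h x = x + y) : False := by
  have hga := affineEquiv_map_add_of_map_zero hg0
  have hha := affineEquiv_map_add_of_map_zero hh0
  have hx := ZModModule.add_self x
  have hy := ZModModule.add_self y
  have h1 : (g * h) x = y := by
    simp only [AffineEquiv.mul_def, AffineEquiv.trans_apply, hhx, hga, hgx, hgy]; grind
  have h2 : (g * h) y = x + y := by
    simp only [AffineEquiv.mul_def, AffineEquiv.trans_apply, hhy, hgy]
  have h3 : (g * h) (x + y) = x := by
    simp only [AffineEquiv.mul_def, AffineEquiv.trans_apply, hhx, hhy, hha, hga, hgx, hgy]; grind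
  have h4 : (g * h) r = r := by simp [AffineEquiv.mul_def, hhr, hgr]
  have h5 : (g * h) 0 = 0 := by simp [AffineEquiv.mul_def, hh0, hg0]
  have hpow (w : W) : ((g * h) ^ 3) w = (g * h) ((g * h) ((g * h) w)) := rfl
  have := hG _ (G.mul_mem hg hh) (hext _ (by rw [hpow, h5, h5, h5]) (by rw [hpow, h1, h2, h3])
    (by rw [hpow, h2, h3, h1]) (by rw [hpow, h4, h4, h4]))
  rw [this] at h1
  exact hne h1

open Classical in
/-- A coloring that is preserved only by the permutations of `x, y, z`. -/
noncomputable def triadColoring (x y z w : W) : Fin 3 :=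
  if w = x ∨ w = y ∨ w = z then 1 else if w = 0 ∨ w = x + y + z then 2 else 0

theorem exists_transposition (hG : ∀ g ∈ G, g ^ 3 = 1 → g = 1)
    (hno : ∀ f : W → Fin 3, ∃ g ∈ G, (∀ w, f (g w) = f w) ∧ g ≠ 1) {x y z : W}
    (hT : IsTriad x y z) : ∃ g ∈ G, g 0 = 0 ∧ ((g x = y ∧ g y = x ∧ g z = z) ∨
      (g y = z ∧ g z = y ∧ g x = x) ∨ (g x = z ∧ g z = x ∧ g y = y)) := by
  obtain ⟨g, hg, hf, hne⟩ := hno (triadColoring x y z)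
  have hcol (w : W) (hw : w = x ∨ w = y ∨ w = z) : g w = x ∨ g w = y ∨ g w = z := by
    have h := hf w
    have hc : triadColoring x y z w = 1 := if_pos hw
    rw [hc] at h
    unfold triadColoring at h
    split_ifs at h <;> simp_all
  have hx := hcol x (by simp)
  have hy := hcol y (by simp)
  have hz := hcol z (by simp)
  have hxy := g.injective.ne hT.ne₁₂
  have hyz := g.injective.ne hT.ne₂₃
  have hxz := g.injective.ne hT.ne₁₃
  have hsum : g (x + y + z) = x + y + z := by
    rw [affineEquiv_map_add_add]
    grind
  have h0 : g 0 = 0 := by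
    have h := hf 0
    have hc : triadColoring x y z 0 = 2 := by
      unfold triadColoring
      rw [if_neg, if_pos (Or.inl rfl)]
      have := hT.ne₁; have := hT.ne₂; have := hT.ne₃
      grind
    rw [hc] at h
    have : g 0 = 0 ∨ g 0 = x + y + z := by
      unfold triadColoring at h
      split_ifs at h <;> simp_all
    refine this.resolve_right fun h => hT.sum_ne (g.injective (hsum.trans h.symm))
  refine ⟨g, hg, h0, ?_⟩
  by_contra hcon
  have hpow (w : W) : (g ^ 3) w = g (g (g w)) := rfl
  have hcyc : (g x = x ∧ g y = y ∧ g z = z) ∨ (g x = y ∧ g y = z ∧ g z = x) ∨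
      (g x = z ∧ g y = x ∧ g z = y) := by
    clear hcol hsum hf hno hG hpow
    grind
  refine hne (hG g hg ?_)
  rcases hcyc with ⟨h1, h2, h3⟩ | ⟨h1, h2, h3⟩ | ⟨h1, h2, h3⟩ <;>
    refine hT.ext _ ?_ ?_ ?_ ?_ <;> simp only [hpow, h0, h1, h2, h3]

/-- A transvection with center `p` fixing `q` forces one of two further transvections. -/
theorem exists_second_transvection (hG : ∀ g ∈ G, g ^ 3 = 1 → g = 1)
    (hno : ∀ f : W → Fin 3, ∃ g ∈ G, (∀ w, f (g w) = f w) ∧ g ≠ 1) {p q d : W}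
    (hT : IsTriad p q d) {g : W ≃ᵃ[ZMod 2] W} (hg : g ∈ G) (h0 : g 0 = 0) (hgp : g p = p)
    (hgq : g q = q) (hgd : g d = d + p) :
    ∃ h ∈ G, h 0 = 0 ∧ ((h q = q ∧ h d = d ∧ h p = p + q) ∨
      (h p = p ∧ h d = d ∧ h q = q + d + p)) := by
  have hp2 := ZModModule.add_self p
  have hq2 := ZModModule.add_self q
  have hd2 := ZModModule.add_self d
  have hga := affineEquiv_map_add_of_map_zero h0
  have hT' : IsTriad (d + q) p (q + p) :=
    hT.rotate.swap.add.rotate.add.rotate.swap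
  obtain ⟨h, hh, hh0, hcase⟩ := exists_transposition hG hno hT'
  have hha := affineEquiv_map_add_of_map_zero hh0
  simp only [hha] at hcase
  refine ⟨h, hh, hh0, ?_⟩
  rcases hcase with ⟨h1, h2, h3⟩ | ⟨h1, h2, h3⟩ | ⟨h1, h2, h3⟩
  · exfalso
    have hT2 : IsTriad p (d + q + p) (q + p) := hT'.add.swap
    exact false_of_opposite_transvections hG hT2.ne₁₂ hT2.ext hg hh h0 hh0 hgp
      (by rw [hga, hgp, hgq]) (by rw [hga, hga, hgp, hgq, hgd]; grind)
      (by rw [hha, hha]; grind) (by rw [hha]; grind) (by grind)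
  · left; grind
  · right; grind

theorem false_of_transvection (hG : ∀ g ∈ G, g ^ 3 = 1 → g = 1)
    (hno : ∀ f : W → Fin 3, ∃ g ∈ G, (∀ w, f (g w) = f w) ∧ g ≠ 1) {p q d : W}
    (hT : IsTriad p q d) {g : W ≃ᵃ[ZMod 2] W} (hg : g ∈ G) (h0 : g 0 = 0) (hgp : g p = p)
    (hgq : g q = q) (hgd : g d = d + p) : False := by
  have hp2 := ZModModule.add_self p
  have hq2 := ZModModule.add_self q
  have hga := affineEquiv_map_add_of_map_zero h0
  have key (d : W) (hT : IsTriad p q d) (hgd : g d = d + p) :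
      ∃ h ∈ G, h 0 = 0 ∧ h p = p ∧ h d = d ∧ h q = q + d + p := by
    have hT' : IsTriad p (q + p) d := hT.swap.add.swap
    obtain ⟨h, hh, hh0, h1 | h1⟩ := exists_second_transvection hG hno hT hg h0 hgp hgq hgd
    · obtain ⟨h', hh', hh0', h2 | h2⟩ := exists_second_transvection hG hno hT' hg h0 hgp
        (by rw [hga, hgp, hgq]) hgd
      · exfalso
        have hha := affineEquiv_map_add_of_map_zero hh0
        have hha' := affineEquiv_map_add_of_map_zero hh0'
        rw [hha'] at h2
        exact false_of_opposite_transvections hG hT.add.swap.ne₁₂ hT.add.swap.ext hh hh' hh0 hh0'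
          h1.1 h1.2.1 (by rw [hha]; grind) (by rw [hha']; grind) h2.2.1 (by grind)
      · have hha' := affineEquiv_map_add_of_map_zero hh0'
        rw [hha'] at h2
        exact ⟨h', hh', hh0', by grind⟩
    · exact ⟨h, hh, hh0, h1⟩
  have hd2 := ZModModule.add_self d
  have hT' : IsTriad p q (d + q) := hT.rotate.swap.add.rotate.swap
  obtain ⟨h, hh, hh0, h1, h2, h3⟩ := key d hT hgd
  obtain ⟨h', hh', hh0', h1', h2', h3'⟩ := key (d + q) hT' (by rw [hga, hgd, hgq]; abel)
  have hha := affineEquiv_map_add_of_map_zero hh0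
  have hha' := affineEquiv_map_add_of_map_zero hh0'
  rw [hha'] at h2'
  have hT2 : IsTriad (d + p) (q + (d + p)) p :=
    hT.rotate.rotate.add.rotate.rotate.add.swap
  exact false_of_opposite_transvections hG hT2.ne₁₂ hT2.ext hh hh' hh0 hh0'
    (by rw [hha]; grind) h1 (by rw [hha, hha]; grind) (by rw [hha', hha']; grind) h1'
    (by rw [hha']; grind)

theorem exists_regular_of_triad (hG : ∀ g ∈ G, g ^ 3 = 1 → g = 1) {x y z : W}
    (hT : IsTriad x y z) : ∃ f : W → Fin 3, ∀ g ∈ G, (∀ w, f (g w) = f w) → g = 1 := by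
  by_contra! hno
  have key {x y z : W} (hT : IsTriad x y z) {g : W ≃ᵃ[ZMod 2] W} (hg : g ∈ G) (h0 : g 0 = 0)
      (hx : g x = y) (hy : g y = x) (hz : g z = z) : False := by
    have hga := affineEquiv_map_add_of_map_zero h0
    have := ZModModule.add_self y
    exact false_of_transvection hG hno hT.add.rotate.swap.rotate.rotate hg h0
      (by rw [hga, hx, hy, add_comm]) hz (by grind)
  obtain ⟨g, hg, h0, h | h | h⟩ := exists_transposition hG hno hT
  · exact key hT hg h0 h.1 h.2.1 h.2.2
  · exact key hT.rotate hg h0 h.1 h.2.1 h.2.2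
  · exact key hT.rotate.swap.rotate.rotate hg h0 h.1 h.2.1 h.2.2

end Dimension3

theorem isTriad_basis {W : Type*} [AddCommGroup W] [Module (ZMod 2) W]
    (b : Module.Basis (Fin 3) (ZMod 2) W) : IsTriad (b 0) (b 1) (b 2) where
  ne₁ := b.ne_zero 0
  ne₂ := b.ne_zero 1
  ne₃ := b.ne_zero 2
  ne₁₂ := b.injective.ne (by decide)
  ne₂₃ := b.injective.ne (by decide)
  ne₁₃ := b.injective.ne (by decide)
  sum_ne h := by simpa using congrArg (fun w => b.repr w 0) h
  ext g h0 h1 h2 h3 := by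
    refine affineEquiv_eq_one h0 (b.ext fun i => ?_)
    fin_cases i <;> simpa [affineEquiv_linear_apply h0]

section Dimension2

variable {W : Type*} [AddCommGroup W] [Module (ZMod 2) W]

open Classical in
theorem exists_transvection_of_basis {G : Subgroup (W ≃ᵃ[ZMod 2] W)}
    (hno : ∀ f : W → Fin 3, ∃ g ∈ G, (∀ w, f (g w) = f w) ∧ g ≠ 1)
    (b : Module.Basis (Fin 2) (ZMod 2) W) :
    ∃ g ∈ G, g 0 = 0 ∧ g (b 0) = b 0 ∧ g (b 1) = b 0 + b 1 := by
  obtain ⟨g, hg, hf, hne⟩ := hno fun w => if w = 0 then 0 else if w = b 0 then 1 else 2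
  have h0 : g 0 = 0 := by
    have := hf 0
    split_ifs at this <;> simp_all
  have h1 : g (b 0) = b 0 := by
    have := hf (b 0)
    have := b.ne_zero 0
    split_ifs at * <;> simp_all
  refine ⟨g, hg, h0, h1, ?_⟩
  have hrep : g (b 1) = b.repr (g (b 1)) 0 • b 0 + b.repr (g (b 1)) 1 • b 1 := by
    rw [← Fin.sum_univ_two fun i => b.repr (g (b 1)) i • b i, b.sum_repr]
  have hbit : ∀ c : ZMod 2, c = 0 ∨ c = 1 := by decide
  have hne0 : g (b 1) ≠ 0 := fun h => b.ne_zero 1 (g.injective (h.trans h0.symm))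
  have hne1 : g (b 1) ≠ b 0 := fun h =>
    b.injective.ne (show (1 : Fin 2) ≠ 0 by decide) (g.injective (h.trans h1.symm))
  have hne2 : g (b 1) ≠ b 1 := by
    refine fun h => hne (affineEquiv_eq_one h0 (b.ext fun i => ?_))
    fin_cases i <;> simpa [affineEquiv_linear_apply h0]
  rcases hbit (b.repr (g (b 1)) 0) with h2 | h2 <;>
    rcases hbit (b.repr (g (b 1)) 1) with h3 | h3 <;>
    rw [h2, h3] at hrep <;> simp_all

theorem exists_regular_of_basis_two {G : Subgroup (W ≃ᵃ[ZMod 2] W)}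
    (hG : ∀ g ∈ G, g ^ 3 = 1 → g = 1) (b : Module.Basis (Fin 2) (ZMod 2) W) :
    ∃ f : W → Fin 3, ∀ g ∈ G, (∀ w, f (g w) = f w) → g = 1 := by
  by_contra! hno
  obtain ⟨g, hg, hg0, hgx, hgy⟩ := exists_transvection_of_basis hno b
  obtain ⟨h, hh, hh0, hhy, hhx⟩ := exists_transvection_of_basis hno (b.reindex (Equiv.swap 0 1))
  simp only [Module.Basis.reindex_apply, Equiv.symm_swap, Equiv.swap_apply_left,
    Equiv.swap_apply_right] at hhx hhy
  refine false_of_opposite_transvections hG (b.injective.ne (by decide : (0 : Fin 2) ≠ 1))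
    (r := 0) (fun t h0 h1 h2 _ => affineEquiv_eq_one h0 (b.ext fun i => ?_)) hg hh hg0 hh0 hgx hg0
    hgy hhy hh0 (hhx.trans (add_comm _ _))
  fin_cases i <;> simpa [affineEquiv_linear_apply h0]

end Dimension2

theorem exists_regular_three_of_binary {W : Type*} [AddCommGroup W] [Module (ZMod 2) W] [Finite W]
    {G : Subgroup (W ≃ᵃ[ZMod 2] W)} (hG : ∀ g ∈ G, g ^ 3 = 1 → g = 1) :
    ∃ f : W → Fin 3, ∀ g ∈ G, (∀ w, f (g w) = f w) → g = 1 := by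
  have : Fact (Nat.Prime 2) := ⟨Nat.prime_two⟩
  obtain h | h | h | h : Module.finrank (ZMod 2) W ≤ 1 ∨ Module.finrank (ZMod 2) W = 2 ∨
      Module.finrank (ZMod 2) W = 3 ∨ 4 ≤ Module.finrank (ZMod 2) W := by omega
  · have hcard : Nat.card W ≤ 2 := by
      rw [Module.natCard_eq_pow_finrank (K := ZMod 2), Nat.card_zmod]
      exact (Nat.pow_le_pow_right (by norm_num) h).trans (by norm_num)
    have := Fintype.ofFinite W
    obtain ⟨f⟩ : Nonempty (W ↪ Fin 3) := Function.Embedding.nonempty_of_card_le (by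
      rw [← Nat.card_eq_fintype_card, Fintype.card_fin]; omega)
    exact ⟨f, fun g _ hf => by ext w; exact f.injective (hf w)⟩
  · exact exists_regular_of_basis_two hG (Module.finBasisOfFinrankEq _ _ h)
  · exact exists_regular_of_triad hG (isTriad_basis (Module.finBasisOfFinrankEq _ _ h))
  · have e : W ≃ₗ[ZMod 2]
        (ZMod 2 × ZMod 2) × (Fin (Module.finrank (ZMod 2) W - 2) → ZMod 2) :=
      LinearEquiv.ofFinrankEq _ _ (by simp; omega)
    obtain ⟨f, hf⟩ := exists_isAffineRigid_of_linearEquiv e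
      ⟨_, isAffineRigid_planeColoring (by omega)⟩
    exact ⟨f, fun g _ => hf g⟩

theorem exists_isAffineRigid_five {K W : Type*} [Field K] [AddCommGroup W] [Module K W]
    [FiniteDimensional K W] : ∃ f : W → Fin 5, IsAffineRigid K f :=
  exists_isAffineRigid_of_linearEquiv (Module.finBasis K W).equivFun
    ⟨_, isAffineRigid_pathColoring _⟩

theorem exists_isAffineRigid_three {K W : Type*} [Field K] [AddCommGroup W] [Module K W]
    [FiniteDimensional K W] (h2 : (2 : K) ≠ 0) (h3 : (3 : K) ≠ 0) :
    ∃ f : W → Fin 3, IsAffineRigid K f := by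
  obtain ⟨b⟩ := AffineBasis.exists_affineBasis_of_finiteDimensional
    (ι := Fin (Module.finrank K W + 1)) (k := K) (P := W) (by simp)
  exact ⟨_, isAffineRigid_frameColoring h2 h3 b⟩

theorem prime_dvd_card_of_translations_mem {q : ℕ} [Fact q.Prime] {W : Type*} [AddCommGroup W]
    [Module (ZMod q) W] [Finite W] [Nontrivial W] {G : Subgroup (W ≃ᵃ[ZMod q] W)}
    (htrans : ∀ w : W, AffineEquiv.constVAdd (ZMod q) W w ∈ G) : q ∣ Nat.card G := by
  let φ : Multiplicative W →* G := MonoidHom.codRestrict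
    (AffineEquiv.constVAddHom (ZMod q) W) G fun w => htrans w.toAdd
  have hφ : Function.Injective φ := fun v w h => by
    have h' : v.toAdd + 0 = w.toAdd + 0 := congrArg (fun t : G => (t : W ≃ᵃ[ZMod q] W) 0) h
    exact Multiplicative.toAdd.injective (by simpa using h')
  have hq : q ∣ Nat.card (Multiplicative W) := by
    rw [Nat.card_congr Multiplicative.toAdd, Module.natCard_eq_pow_finrank (K := ZMod q),
      Nat.card_zmod]
    exact dvd_pow_self q Module.finrank_pos.ne'
  exact hq.trans (Subgroup.card_dvd_of_injective φ hφ)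

/-- **Halasi–Podoski, Corollary 2.3 (existence part).**
Let `W` be a finite vector space over a prime field `𝔽_q`, let `G` with `W ≤ G ≤ AGL(W)`
(i.e. `G` contains all translations), and let `p ≥ 3` be a prime not dividing `|G|`.  Then
there is a `G`-regular partition of `W` into at most `p` parts.  (The partition is encoded by a
coloring `f : W → Fin p`; its parts are the nonempty fibers of `f`, and `G`-regularity says
that only the identity of `G` stabilizes every fiber setwise.) -/
theorem affine_coprime_regular_partition_into_p_parts
    (q : ℕ) (hq : q.Prime)
    (W : Type*) [AddCommGroup W] [Module (ZMod q) W] [Finite W]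
    (G : Subgroup (W ≃ᵃ[ZMod q] W))
    (htrans : ∀ w : W, AffineEquiv.constVAdd (ZMod q) W w ∈ G)
    (p : ℕ) (hp : p.Prime) (hp3 : 3 ≤ p)
    (hpG : ¬ (p ∣ Nat.card G)) :
    ∃ f : W → Fin p, ∀ g ∈ G, (∀ w : W, f (g w) = f w) → g = 1 := by
  have : Fact q.Prime := ⟨hq⟩
  suffices h : ∃ k ≤ p, ∃ f : W → Fin k, ∀ g ∈ G, (∀ w : W, f (g w) = f w) → g = 1 by
    obtain ⟨k, hk, f, hf⟩ := h
    exact ⟨fun w => Fin.castLE hk (f w), fun g hg h =>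
      hf g hg fun w => Fin.castLE_injective hk (h w)⟩
  rcases subsingleton_or_nontrivial W with hW | hW
  · exact ⟨3, hp3, fun _ => 0, fun g _ _ => by ext w; exact Subsingleton.elim _ _⟩
  have hpq : p ≠ q := by
    rintro rfl
    exact hpG (prime_dvd_card_of_translations_mem htrans)
  rcases Nat.lt_or_ge p 5 with hp5 | hp5
  · obtain rfl : p = 3 := by
      interval_cases p
      · rfl
      · exact absurd hp (by norm_num)
    refine ⟨3, le_rfl, ?_⟩
    by_cases hq2 : q = 2
    · subst hq2
      refine exists_regular_three_of_binary fun g hg hg3 => ?_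
      have : Fact (Nat.Prime 3) := ⟨hp⟩
      by_contra hne
      have h3 : orderOf (⟨g, hg⟩ : G) = 3 :=
        orderOf_eq_prime (Subtype.ext hg3) fun h => hne (congrArg Subtype.val h)
      exact hpG (h3 ▸ orderOf_dvd_natCard _)
    · have hcast (r : ℕ) (hr : r.Prime) (hrq : q ≠ r) : (r : ZMod q) ≠ 0 := by
        rw [Ne, ZMod.natCast_eq_zero_iff]
        exact fun h => hrq ((Nat.prime_dvd_prime_iff_eq hq hr).1 h)
      obtain ⟨f, hf⟩ := exists_isAffineRigid_three (K := ZMod q) (W := W)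
        (by exact_mod_cast hcast 2 Nat.prime_two hq2) (by exact_mod_cast hcast 3 hp hpq.symm)
      exact ⟨f, fun g _ => hf g⟩
  · obtain ⟨f, hf⟩ := exists_isAffineRigid_five (K := ZMod q) (W := W)
    exact ⟨5, hp5, f, fun g _ => hf g⟩
end

section
/- Let G ≤ Sym(Ω) be a solvable permutation group on a finite set Ω, and let p be a prime not dividing the order of G. Then there exists a G-regular partition of Ω into at most p parts. -/
open scoped Classical in
/-- Extend a coloring of the subgroup `W` by giving `v` the color `Y` and every other point outside
`W` the color `X`. -/
noncomputable def extendColoring {V C : Type*} [AddCommGroup V] (W : AddSubgroup V) (f : V → C)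
    (v : V) (X Y : C) (x : V) : C :=
  if x ∈ W then f x else if x = v then Y else X

section Affine

variable {V C : Type*} [AddCommGroup V]

/-- A map between abelian groups that preserves the operation `x - y + z`. -/
def IsAffine (φ : V → V) : Prop := ∀ x y z, φ (x - y + z) = φ x - φ y + φ z

/-- A set is affinely closed if it is empty or a coset of a subgroup. -/
def AffinelyClosed (K : Set V) : Prop := ∀ x ∈ K, ∀ y ∈ K, ∀ z ∈ K, x - y + z ∈ K

/-- Every affinely closed set containing `T` contains `W`. -/
def AffinelySpans (T : Set V) (W : AddSubgroup V) : Prop :=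
  ∀ K, AffinelyClosed K → T ⊆ K → (W : Set V) ⊆ K

/-- The set `T` still affinely spans `W` after any one point is removed. -/
def RobustlySpans (T : Set V) (W : AddSubgroup V) : Prop :=
  ∀ t, AffinelySpans (T \ {t}) W

/-- An affine permutation of order prime to `p` that preserves `W` and the coloring `f` of `W`
fixes `W` pointwise. -/
def IsRigidOn (p : ℕ) (W : AddSubgroup V) (f : V → C) : Prop :=
  ∀ φ : Equiv.Perm V, IsAffine φ → (∃ m, ¬ p ∣ m ∧ φ ^ m = 1) → (∀ x ∈ W, φ x ∈ W) →
    (∀ x ∈ W, f (φ x) = f x) → ∀ x ∈ W, φ x = x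

lemma AffinelyClosed.preimage {φ : V → V} (hφ : IsAffine φ) {K : Set V} (hK : AffinelyClosed K) :
    AffinelyClosed (φ ⁻¹' K) := fun x hx y hy z hz => by
  rw [Set.mem_preimage, hφ]; exact hK _ hx _ hy _ hz

lemma affinelyClosed_addSubgroup (W : AddSubgroup V) : AffinelyClosed (W : Set V) :=
  fun _ hx _ hy _ hz => W.add_mem (W.sub_mem hx hy) hz

lemma IsAffine.affinelyClosed_fixed {φ : V → V} (hφ : IsAffine φ) :
    AffinelyClosed {x | φ x = x} := fun x hx y hy z hz => by
  simp only [Set.mem_ofPred_eq] at *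
  rw [hφ, hx, hy, hz]

/-- The subgroup of differences of an affinely closed set from one of its points. -/
def AffinelyClosed.direction {K : Set V} (hK : AffinelyClosed K) {w : V} (hw : w ∈ K) :
    AddSubgroup V where
  carrier := {x | x + w ∈ K}
  zero_mem' := by simpa using hw
  add_mem' {x y} hx hy := by
    have := hK _ hx _ hw _ hy
    rwa [show x + w - w + (y + w) = x + y + w by abel] at this
  neg_mem' {x} hx := by
    have := hK _ hw _ hx _ hw
    rwa [show w - (x + w) + w = -x + w by abel] at this

lemma AffinelyClosed.le_of_zero_mem {K : Set V} (hK : AffinelyClosed K) (h0 : (0 : V) ∈ K)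
    {S : Set V} (hS : S ⊆ K) : ((AddSubgroup.closure S : AddSubgroup V) : Set V) ⊆ K := by
  intro x hx
  have h : AddSubgroup.closure S ≤ hK.direction h0 := by
    rw [AddSubgroup.closure_le]
    intro s hs
    change s + 0 ∈ K
    simpa using hS hs
  have hx' : x + 0 ∈ K := h hx
  simpa using hx'

lemma AffinelyClosed.sup_zmultiples_le {K : Set V} (hK : AffinelyClosed K) {W : AddSubgroup V}
    (hW : (W : Set V) ⊆ K) {v : V} (hv : v ∈ K) :
    ((W ⊔ AddSubgroup.zmultiples v : AddSubgroup V) : Set V) ⊆ K := by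
  have h := hK.le_of_zero_mem (hW W.zero_mem) (S := (W : Set V) ∪ {v})
    (Set.union_subset hW (Set.singleton_subset_iff.2 hv))
  rwa [AddSubgroup.closure_union, AddSubgroup.closure_eq, ← AddSubgroup.zmultiples_eq_closure] at h

lemma RobustlySpans.mono {T T' : Set V} {W : AddSubgroup V} (h : RobustlySpans T W)
    (hT : T ⊆ T') : RobustlySpans T' W :=
  fun t K hK hTK => h t K hK ((Set.sdiff_subset_sdiff_left hT).trans hTK)

lemma apply_mem_iff_of_forall_mem [Finite V] {W : AddSubgroup V} {φ : Equiv.Perm V}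
    (hW : ∀ x ∈ W, φ x ∈ W) {x : V} : φ x ∈ W ↔ x ∈ W := by
  refine ⟨fun h => ?_, hW x⟩
  have hbij := Finite.surjective_of_injective
    (f := fun y : W => (⟨φ y, hW y y.2⟩ : W))
    (fun a b hab => Subtype.ext (φ.injective (congrArg Subtype.val hab)))
  obtain ⟨y, hy⟩ := hbij ⟨φ x, h⟩
  have : (y : V) = x := φ.injective (congrArg Subtype.val hy)
  exact this ▸ y.2

variable {p : ℕ} {W : AddSubgroup V} {f : V → C} {X Y : C} {v : V}

lemma extendColoring_of_mem {x : V} (hx : x ∈ W) : extendColoring W f v X Y x = f x := by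
  simp [extendColoring, hx]

lemma extendColoring_self (hv : v ∉ W) : extendColoring W f v X Y v = Y := by
  simp [extendColoring, hv]

lemma extendColoring_of_notMem {x : V} (hx : x ∉ W) (hxv : x ≠ v) :
    extendColoring W f v X Y x = X := by
  simp [extendColoring, hx, hxv]

/-- A rigid coloring of `W` extends to a rigid coloring of `W ⊔ ⟨v⟩` as soon as the symmetries of
the extended coloring are known to preserve `W`. -/
lemma IsRigidOn.extend [Finite V] (hf : IsRigidOn p W f) (hXY : X ≠ Y) (hv : v ∉ W)
    (hR : ∀ φ : Equiv.Perm V, IsAffine φ →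
      (∀ x ∈ W ⊔ AddSubgroup.zmultiples v, φ x ∈ W ⊔ AddSubgroup.zmultiples v) →
      (∀ x ∈ W ⊔ AddSubgroup.zmultiples v,
        extendColoring W f v X Y (φ x) = extendColoring W f v X Y x) →
      ∀ x ∈ W, φ x ∈ W) :
    IsRigidOn p (W ⊔ AddSubgroup.zmultiples v) (extendColoring W f v X Y) := by
  intro φ hφ hm hmem hcol
  have hW := hR φ hφ hmem hcol
  have hle : W ≤ W ⊔ AddSubgroup.zmultiples v := le_sup_left
  have hvm : v ∈ W ⊔ AddSubgroup.zmultiples v :=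
    (le_sup_right : _ ≤ W ⊔ AddSubgroup.zmultiples v) (AddSubgroup.mem_zmultiples v)
  have hfix := hf φ hφ hm hW fun x hx => by
    have := hcol x (hle hx)
    rwa [extendColoring_of_mem hx, extendColoring_of_mem (hW x hx)] at this
  have hφv : φ v ∉ W := fun h => hv ((apply_mem_iff_of_forall_mem hW).1 h)
  have hvv : φ v = v := by
    by_contra hne
    have := hcol v hvm
    rw [extendColoring_self hv, extendColoring_of_notMem hφv hne] at this
    exact hXY this
  exact hφ.affinelyClosed_fixed.sup_zmultiples_le hfix hvv

/-- The color of `v` identifies `W` if its color class in `W` spans `W` robustly. -/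
lemma IsRigidOn.extend_of_robustlySpans [Finite V] (hf : IsRigidOn p W f) (hXY : X ≠ Y)
    (hv : v ∉ W) (hY : RobustlySpans {x | x ∈ W ∧ f x = Y} W) :
    IsRigidOn p (W ⊔ AddSubgroup.zmultiples v) (extendColoring W f v X Y) := by
  refine hf.extend hXY hv fun φ hφ hmem hcol => ?_
  refine hY (φ.symm v) _ ((affinelyClosed_addSubgroup W).preimage hφ) ?_
  rintro t ⟨⟨htW, htY⟩, htv⟩
  by_contra hφt
  have hne : φ t ≠ v := fun h => htv (by simp [← h])
  have := hcol t ((le_sup_left : W ≤ W ⊔ AddSubgroup.zmultiples v) htW)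
  rw [extendColoring_of_mem htW, htY, extendColoring_of_notMem hφt hne] at this
  exact hXY this

/-- A color not used outside `W` identifies `W` if its color class spans `W`. -/
lemma IsRigidOn.extend_of_affinelySpans [Finite V] (hf : IsRigidOn p W f) (hXY : X ≠ Y)
    (hv : v ∉ W) {Z : C} (hZX : Z ≠ X) (hZY : Z ≠ Y)
    (hZ : AffinelySpans {x | x ∈ W ∧ f x = Z} W) :
    IsRigidOn p (W ⊔ AddSubgroup.zmultiples v) (extendColoring W f v X Y) := by
  refine hf.extend hXY hv fun φ hφ hmem hcol => ?_
  refine hZ _ ((affinelyClosed_addSubgroup W).preimage hφ) ?_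
  rintro t ⟨htW, htZ⟩
  by_contra hφt
  have := hcol t ((le_sup_left : W ≤ W ⊔ AddSubgroup.zmultiples v) htW)
  rw [extendColoring_of_mem htW, htZ] at this
  by_cases hne : φ t = v
  · rw [hne, extendColoring_self hv] at this
    exact hZY this.symm
  · rw [extendColoring_of_notMem hφt hne] at this
    exact hZX this.symm

lemma exists_mem_notMem_finset {s : Finset V} (hs : s.card < Nat.card W) :
    ∃ u ∈ W, u ∉ s := by
  by_contra! h
  have : (W : Set V).ncard ≤ (s : Set V).ncard :=
    Set.ncard_le_ncard (fun u hu => h u hu) s.finite_toSet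
  rw [Set.ncard_coe_finset] at this
  exact absurd hs (not_lt.2 this)

/-- The color given to most points outside `W` robustly spans the extended subgroup. -/
lemma robustlySpans_extendColoring (hW : 5 ≤ Nat.card W) (hv : v ∉ W)
    (hX : (∃ a ∈ W, ∃ b ∈ W, a ≠ b ∧ f a = X ∧ f b = X) ∨ v + v ∉ W) :
    RobustlySpans {x | x ∈ W ⊔ AddSubgroup.zmultiples v ∧ extendColoring W f v X Y x = X}
      (W ⊔ AddSubgroup.zmultiples v) := by
  classical
  intro x K hK hXK
  have hle : W ≤ W ⊔ AddSubgroup.zmultiples v := le_sup_left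
  have hvm : v ∈ W ⊔ AddSubgroup.zmultiples v :=
    (le_sup_right : _ ≤ W ⊔ AddSubgroup.zmultiples v) (AddSubgroup.mem_zmultiples v)
  have hout : ∀ y ∈ W ⊔ AddSubgroup.zmultiples v, y ∉ W → y ≠ v → y ≠ x → y ∈ K :=
    fun y hy hyW hyv hyx => hXK ⟨⟨hy, extendColoring_of_notMem hyW hyv⟩, hyx⟩
  have havoid : ∀ y ∈ W ⊔ AddSubgroup.zmultiples v, y ∉ W → ∃ u ∈ W, y + u ∈ K := by
    intro y hy hyW
    obtain ⟨u, hu, hus⟩ := exists_mem_notMem_finset (W := W) (s := {v - y, x - y})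
      (by have := Finset.card_le_two (a := v - y) (b := x - y); omega)
    simp only [Finset.mem_insert, Finset.mem_singleton, not_or] at hus
    refine ⟨u, hu, hout _ (add_mem hy (hle hu)) (fun h => hyW ?_) ?_ ?_⟩
    · simpa using W.sub_mem h hu
    · rintro h; exact hus.1 (by rw [← h]; abel)
    · rintro h; exact hus.2 (by rw [← h]; abel)
  have hwK : ∃ w ∈ W, w ∈ K := by
    rcases hX with ⟨a, ha, b, hb, hab, hfa, hfb⟩ | h2
    · by_cases hax : a = x
      · exact ⟨b, hb, hXK ⟨⟨hle hb, by rw [extendColoring_of_mem hb, hfb]⟩,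
          fun h => hab (hax.trans (Eq.symm h))⟩⟩
      · exact ⟨a, ha, hXK ⟨⟨hle ha, by rw [extendColoring_of_mem ha, hfa]⟩, hax⟩⟩
    · obtain ⟨u, hu, huK⟩ := havoid v hvm hv
      obtain ⟨u', hu', huK'⟩ := havoid (v + v) (add_mem hvm hvm) h2
      refine ⟨_, ?_, hK _ huK _ huK' _ huK⟩
      rw [show v + u - (v + v + u') + (v + u) = u - u' + u by abel]
      exact W.add_mem (W.sub_mem hu hu') hu
  obtain ⟨w, hw, hwK⟩ := hwK
  have hWK : (W : Set V) ⊆ K := by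
    intro y hy
    obtain ⟨u, hu, hus⟩ := exists_mem_notMem_finset (W := W)
      (s := {0, x - v, w - y, x - v + w - y})
      (by have := Finset.card_le_four (a := 0) (b := x - v) (c := w - y) (d := x - v + w - y)
          omega)
    simp only [Finset.mem_insert, Finset.mem_singleton, not_or] at hus
    obtain ⟨h1, h2, h3, h4⟩ := hus
    have hb : v + u ∈ K := by
      refine hout _ (add_mem hvm (hle hu)) (fun h => hv ?_) ?_ ?_
      · simpa using W.sub_mem h hu
      · simpa using h1
      · rintro h; exact h2 (by rw [← h]; abel)
    have ha : v + u + y - w ∈ K := by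
      refine hout _ (sub_mem (add_mem (add_mem hvm (hle hu)) (hle hy)) (hle hw))
        (fun h => hv ?_) ?_ ?_
      · have := W.sub_mem (W.sub_mem (W.add_mem h hw) hy) hu
        rwa [show v + u + y - w + w - y - u = v by abel] at this
      · intro h
        refine h3 ?_
        rw [show w - y = v + u - (v + u + y - w) by abel, h]; abel
      · intro h
        refine h4 ?_
        rw [← h]; abel
    have := hK _ ha _ hb _ hwK
    rwa [show v + u + y - w - (v + u) + w = y by abel] at this
  refine hK.sup_zmultiples_le hWK ?_
  obtain ⟨u, hu, huK⟩ := havoid v hvm hv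
  have := hK _ huK _ (hWK hu) _ (hWK W.zero_mem)
  simpa using this

/-- Rigid colorings of a subgroup extend to the whole group. -/
lemma exists_isRigidOn_top [Finite V] (hW : 5 ≤ Nat.card W) (hf : IsRigidOn p W f) (hXY : X ≠ Y)
    (hY : RobustlySpans {x | x ∈ W ∧ f x = Y} W)
    (hX : (∃ a ∈ W, ∃ b ∈ W, a ≠ b ∧ f a = X ∧ f b = X) ∨
      ∀ (U : AddSubgroup V) (x : V), x + x ∈ U → x ∈ U) :
    ∃ f : V → C, IsRigidOn p ⊤ f := by
  induction W using WellFoundedGT.induction generalizing f X Y with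
  | ind W ih =>
    by_cases htop : W = ⊤
    · exact ⟨f, htop ▸ hf⟩
    obtain ⟨v, hv⟩ : ∃ v, v ∉ W := by
      by_contra! h
      exact htop (eq_top_iff.2 fun x _ => h x)
    have hvm : v ∈ W ⊔ AddSubgroup.zmultiples v :=
      (le_sup_right : _ ≤ W ⊔ AddSubgroup.zmultiples v) (AddSubgroup.mem_zmultiples v)
    have hle : W ≤ W ⊔ AddSubgroup.zmultiples v := le_sup_left
    refine ih (W ⊔ AddSubgroup.zmultiples v) (lt_of_le_of_ne hle fun h => hv (h ▸ hvm))
      (X := Y) (Y := X)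
      (hW.trans (Nat.card_le_card_of_injective _ (AddSubgroup.inclusion_injective hle)))
      (hf.extend_of_robustlySpans hXY hv hY) hXY.symm
      (robustlySpans_extendColoring hW hv (hX.imp_right fun h h2 => hv (h W v h2))) ?_
    refine hX.imp_left fun _ => ?_
    have hnt : ∀ t, ∃ a ∈ W, f a = Y ∧ a ≠ t := by
      intro t
      by_contra! h
      have := hY t ∅ (fun x hx => hx.elim) (fun x hx => (hx.2 (h x hx.1.1 hx.1.2)).elim)
        W.zero_mem
      exact this.elim
    obtain ⟨a, ha, hfa, -⟩ := hnt 0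
    obtain ⟨b, hb, hfb, hba⟩ := hnt a
    exact ⟨a, hle ha, b, hle hb, hba.symm, by rw [extendColoring_of_mem ha, hfa],
      by rw [extendColoring_of_mem hb, hfb]⟩

end Affine

/-- A coloring of `𝔽₂⁴` with three colors that no nontrivial affine map preserves. -/
def binaryColor (x : Fin 4 → ZMod 2) : ℕ :=
  if x ∈ [0, ![1, 0, 0, 0], ![0, 1, 0, 0], ![0, 0, 1, 0]] then 0
  else if x ∈ [![1, 0, 1, 0], ![0, 1, 1, 0], ![0, 0, 0, 1], ![1, 0, 0, 1], ![0, 1, 0, 1],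
    ![1, 0, 1, 1]] then 1
  else 2

set_option synthInstance.maxSize 4000 in
set_option synthInstance.maxHeartbeats 400000 in
lemma eq_standard_of_binaryColor_eq :
    ∀ a, binaryColor a = 0 → ∀ b, binaryColor b = 0 → ∀ c, binaryColor c = 0 →
    binaryColor (b - a + c) = 2 → ∀ d, binaryColor d = 0 →
    binaryColor (b - a + d) = 1 → binaryColor (c - a + d) = 1 → ∀ e, binaryColor e = 1 →
    (∀ x : Fin 4 → ZMod 2, binaryColor
      (a + x 0 • (b - a) + x 1 • (c - a) + x 2 • (d - a) + x 3 • (e - a)) = binaryColor x) →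
    a = 0 ∧ b = ![1, 0, 0, 0] ∧ c = ![0, 1, 0, 0] ∧ d = ![0, 0, 1, 0] ∧ e = ![0, 0, 0, 1] := by
  decide +kernel

/-- Fewer than `p` points can be given private colors. -/
lemma exists_coloring_separating {V : Type*} {p : ℕ} (S : Finset V) (hS : S.card < p) :
    ∃ (f : V → ZMod p) (Y : ZMod p), (∀ s ∈ S, ∀ x, f x = f s → x = s) ∧
      (∀ s ∈ S, f s ≠ Y) ∧ ∀ x ∉ S, f x = Y := by
  classical
  have hinj : ∀ m n : ℕ, m < p → n < p → (m : ZMod p) = n → m = n := fun m n hm hn h => by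
    rw [ZMod.natCast_eq_natCast_iff'] at h
    rwa [Nat.mod_eq_of_lt hm, Nat.mod_eq_of_lt hn] at h
  have hsY : ∀ s (hs : s ∈ S), ((S.equivFin ⟨s, hs⟩ : ℕ) : ZMod p) ≠ (S.card : ZMod p) := by
    intro s hs h
    have h1 := (S.equivFin ⟨s, hs⟩).2
    have := hinj _ _ (h1.trans hS) hS h
    omega
  refine ⟨fun x => if h : x ∈ S then ((S.equivFin ⟨x, h⟩ : ℕ) : ZMod p) else (S.card : ZMod p),
    S.card, ?_, ?_, ?_⟩
  · intro s hs x hx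
    by_cases hxS : x ∈ S
    · simp only [hs, hxS, dif_pos] at hx
      have := hinj _ _ ((S.equivFin ⟨x, hxS⟩).2.trans hS) ((S.equivFin ⟨s, hs⟩).2.trans hS) hx
      simpa using S.equivFin.injective (Fin.ext this)
    · simp only [hs, hxS, dif_pos, dif_neg, not_false_eq_true] at hx
      exact absurd hx.symm (hsY s hs)
  · intro s hs
    simpa [hs] using hsY s hs
  · intro x hx
    simp [hx]

lemma Equiv.Perm.iterate_swap_ne {α : Type*} {φ : Equiv.Perm α} {a b : α} (hab : a ≠ b)
    (h1 : φ a = b) (h2 : φ b = a) {m : ℕ} (hm : ¬ 2 ∣ m) : φ ^ m ≠ 1 := by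
  intro h
  obtain ⟨k, rfl⟩ : Odd m := Nat.not_even_iff_odd.1 fun h => hm h.two_dvd
  have hsq : ∀ k, (φ ^ (2 * k)) a = a := by
    intro k
    induction k with
    | zero => simp
    | succ k ih =>
      rw [show 2 * (k + 1) = 2 * k + 1 + 1 by ring, pow_succ, pow_succ, Equiv.Perm.mul_apply,
        Equiv.Perm.mul_apply, h1, h2, ih]
  have := congrArg (fun ψ : Equiv.Perm α => ψ a) h
  rw [pow_succ'] at this
  simp only [Equiv.Perm.mul_apply, hsq, h1, Equiv.Perm.one_apply] at this
  exact hab this.symm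

section BaseColorings

variable {V : Type*} [AddCommGroup V] {p : ℕ}

/-- Points that are alone in their color class, one of them being `0`, generate a rigid subgroup. -/
lemma isRigidOn_closure {C : Type*} {f : V → C} {S : Set V} (h0 : (0 : V) ∈ S)
    (hS : ∀ s ∈ S, ∀ x, f x = f s → x = s) : IsRigidOn p (AddSubgroup.closure S) f := by
  intro φ hφ _ _ hcol
  have hfix : S ⊆ {x | φ x = x} := fun s hs =>
    hS s hs _ (hcol s (AddSubgroup.subset_closure hs))
  exact hφ.affinelyClosed_fixed.le_of_zero_mem (hfix h0) hfix

lemma exists_isRigidOn_zmultiples (hp : p.Prime) (a : V) :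
    ∃ (f : V → ZMod p) (Y : ZMod p), IsRigidOn p (AddSubgroup.zmultiples a) f ∧ f 0 ≠ Y ∧
      ∀ x, x ≠ 0 → x ≠ a → f x = Y := by
  classical
  rcases hp.two_le.eq_or_lt with rfl | hp3
  · refine ⟨fun x => if x = 0 ∨ x = a then 0 else 1, 1, ?_, by simp, fun x h0 ha => by
      simp [h0, ha]⟩
    rintro φ hφ ⟨m, hm, hφm⟩ - hcol
    have hmem : ∀ x ∈ AddSubgroup.zmultiples a, x = 0 ∨ x = a → φ x = 0 ∨ φ x = a := by
      intro x hx h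
      by_contra hne
      have := hcol x hx
      simp [h, hne] at this
    have ha := hmem a (AddSubgroup.mem_zmultiples a) (Or.inr rfl)
    have h0 := hmem 0 (zero_mem _) (Or.inl rfl)
    have h00 : φ 0 = 0 := by
      by_contra hne
      have h0a := h0.resolve_left hne
      have ha0 : φ a = 0 := ha.resolve_right fun h => by
        have := φ.injective (h.trans h0a.symm)
        subst this
        exact hne h
      exact Equiv.Perm.iterate_swap_ne (fun h => hne (by rw [h0a, h])) h0a ha0 hm hφm
    have haa : φ a = a := by
      rcases ha with h | h
      · have := φ.injective (h.trans h00.symm)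
        rw [this, h00]
      · exact h
    have := hφ.affinelyClosed_fixed.le_of_zero_mem (S := {a}) h00 (by simpa using haa)
    rwa [← AddSubgroup.zmultiples_eq_closure] at this
  · obtain ⟨f, Y, h1, h2, h3⟩ := exists_coloring_separating (p := p) {0, a}
      (Finset.card_le_two.trans_lt hp3)
    refine ⟨f, Y, ?_, h2 0 (by simp), fun x hx0 hxa => h3 x (by simp [hx0, hxa])⟩
    have := isRigidOn_closure (p := p) (f := f) (S := {0, a}) (by simp)
      (by simpa using h1)
    rwa [Set.pair_comm, Set.insert_eq, AddSubgroup.closure_union, AddSubgroup.closure_singleton_zero,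
      sup_bot_eq, ← AddSubgroup.zmultiples_eq_closure] at this

/-- In a cyclic group of prime order at least five, removing three points leaves a spanning set. -/
lemma robustlySpans_zmultiples {q : ℕ} (hq : q.Prime) (hq5 : 5 ≤ q) {a : V}
    (ha : addOrderOf a = q) :
    RobustlySpans {x | x ∈ AddSubgroup.zmultiples a ∧ x ≠ 0 ∧ x ≠ a}
      (AddSubgroup.zmultiples a) := by
  have hne : ∀ i j : ℕ, i < 5 → j < 5 → i ≠ j → i • a ≠ j • a := by
    intro i j hi hj hij h
    exact hij (nsmul_injOn_Iio_addOrderOf (by rw [Set.mem_Iio]; omega)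
      (by rw [Set.mem_Iio]; omega) h)
  intro t K hK hTK
  have hmem : ∀ i : ℕ, 2 ≤ i → i < 5 → i • a ≠ t → i • a ∈ K := fun i hi hi5 hit =>
    hTK ⟨⟨AddSubgroup.nsmul_mem_zmultiples a i, by simpa using hne i 0 hi5 (by omega) (by omega),
      by simpa using hne i 1 hi5 (by omega) (by omega)⟩, hit⟩
  have htwo : ∃ i j : ℕ, i < 5 ∧ j < 5 ∧ i ≠ j ∧ i • a ∈ K ∧ j • a ∈ K := by
    by_cases h2 : 2 • a = t
    · exact ⟨3, 4, by omega, by omega, by omega,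
        hmem 3 (by omega) (by omega) (h2 ▸ hne 3 2 (by omega) (by omega) (by omega)),
        hmem 4 (by omega) (by omega) (h2 ▸ hne 4 2 (by omega) (by omega) (by omega))⟩
    by_cases h3 : 3 • a = t
    · exact ⟨2, 4, by omega, by omega, by omega, hmem 2 (by omega) (by omega) h2,
        hmem 4 (by omega) (by omega) (h3 ▸ hne 4 3 (by omega) (by omega) (by omega))⟩
    · exact ⟨2, 3, by omega, by omega, by omega, hmem 2 (by omega) (by omega) h2,
        hmem 3 (by omega) (by omega) h3⟩
  obtain ⟨i, j, hi, hj, hij, hiK, hjK⟩ := htwo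
  have hdir : j • a - i • a ∈ hK.direction hiK := by
    change j • a - i • a + i • a ∈ K
    simpa using hjK
  have hle : AddSubgroup.zmultiples a ≤ hK.direction hiK := by
    rw [AddSubgroup.zmultiples_le]
    have hcop : IsCoprime ((j : ℤ) - i) (q : ℤ) := by
      rw [isCoprime_comm, (Nat.prime_iff_prime_int.1 hq).coprime_iff_not_dvd]
      intro hdvd
      have := Int.eq_zero_of_abs_lt_dvd hdvd (by rw [abs_lt]; constructor <;> omega)
      omega
    obtain ⟨r, s, hrs⟩ := hcop
    have hqa : (q : ℤ) • a = 0 := by rw [← ha]; simp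
    have hra : a = r • (j • a - i • a) := by
      have h1 : (r * ((j : ℤ) - i) + s * q) • a = a := by rw [hrs, one_smul]
      rw [add_smul, mul_smul s, hqa, smul_zero, add_zero, mul_smul, sub_smul] at h1
      simpa using h1.symm
    exact Set.mem_of_eq_of_mem hra (AddSubgroup.zsmul_mem _ hdir r)
  intro x hx
  have : x - i • a ∈ hK.direction hiK :=
    hle (sub_mem hx (AddSubgroup.nsmul_mem_zmultiples a i))
  have hx' : x - i • a + i • a ∈ K := this
  simpa using hx'

lemma three_dvd_of_zsmul_add_eq_zero {a b : V} (ha3 : (3 : ℤ) • a = 0) (hb3 : (3 : ℤ) • b = 0)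
    (ha : a ≠ 0) (hb : b ∉ AddSubgroup.zmultiples a) {i j : ℤ} (h : i • a + j • b = 0) :
    3 ∣ i ∧ 3 ∣ j := by
  have hj : 3 ∣ j := by
    by_contra hj
    obtain ⟨r, s, hrs⟩ := (Int.prime_three.coprime_iff_not_dvd).2 hj
    refine hb (AddSubgroup.mem_zmultiples_iff.2 ⟨-(s * i), ?_⟩)
    have h1 : (r * 3 + s * j) • b = b := by rw [hrs, one_smul]
    linear_combination (norm := module) h1 - r • hb3 - s • h
  refine ⟨?_, hj⟩
  by_contra hi
  obtain ⟨r, s, hrs⟩ := (Int.prime_three.coprime_iff_not_dvd).2 hi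
  obtain ⟨k, rfl⟩ := hj
  have h1 : (r * 3 + s * i) • a = a := by rw [hrs, one_smul]
  refine ha ?_
  linear_combination (norm := module) r • ha3 + s • h - h1 - (s * k) • hb3

/-- A plane over `𝔽₃` is colored rigidly by marking a parallelogram, or three of its vertices in
different colors. -/
lemma exists_isRigidOn_plane (hp : p.Prime) (hp3 : p ≠ 3) {a b : V} (ha3 : (3 : ℤ) • a = 0)
    (hb3 : (3 : ℤ) • b = 0) (ha : a ≠ 0) (hb : b ∉ AddSubgroup.zmultiples a) :
    ∃ (f : V → ZMod p) (Y : ZMod p), IsRigidOn p (AddSubgroup.closure {0, a, b}) f ∧ f 0 ≠ Y ∧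
      ∀ x, x ≠ 0 → x ≠ a → x ≠ b → x ≠ a + b → f x = Y := by
  classical
  have hind := fun i j : ℤ => three_dvd_of_zsmul_add_eq_zero ha3 hb3 ha hb (i := i) (j := j)
  have hb0 : b ≠ 0 := fun h => hb (h ▸ zero_mem _)
  have hab : a ≠ b := fun h => hb (h ▸ AddSubgroup.mem_zmultiples a)
  have hs0 : a + b ≠ 0 := fun h => by
    have := hind 1 1 (by linear_combination (norm := module) h); omega
  by_cases hp2 : p = 2
  · subst hp2
    let S : Finset V := {0, a, b, a + b}
    have hS3 : ∀ x ∈ S, (3 : ℤ) • x = 0 := by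
      simp only [S, Finset.mem_insert, Finset.mem_singleton]
      rintro x (rfl | rfl | rfl | rfl)
      · simp
      · exact ha3
      · exact hb3
      · rw [smul_add, ha3, hb3, add_zero]
    refine ⟨fun x => if x ∈ S then 0 else 1, 1, ?_, by simp [S], fun x h0 ha hb hc => by
      simp [S, h0, ha, hb, hc]⟩
    rintro φ hφ ⟨m, hm, hφm⟩ - hcol
    have hSW : ∀ x ∈ S, x ∈ AddSubgroup.closure ({0, a, b} : Set V) := by
      have h1 : a ∈ AddSubgroup.closure ({0, a, b} : Set V) :=
        AddSubgroup.subset_closure (by simp)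
      have h2 : b ∈ AddSubgroup.closure ({0, a, b} : Set V) :=
        AddSubgroup.subset_closure (by simp)
      simp only [S, Finset.mem_insert, Finset.mem_singleton]
      rintro x (rfl | rfl | rfl | rfl)
      exacts [zero_mem _, h1, h2, add_mem h1 h2]
    have hmem : ∀ x ∈ S, φ x ∈ S := by
      intro x hx
      by_contra hne
      have := hcol x (hSW x hx)
      simp [hx, hne] at this
    have himage : S.image φ = S :=
      Finset.eq_of_subset_of_card_le (Finset.image_subset_iff.2 hmem)
        (Finset.card_image_of_injective _ φ.injective).ge
    have hsum : ∑ x ∈ S, φ x = ∑ x ∈ S, x := by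
      conv_rhs => rw [← himage]
      rw [Finset.sum_image φ.injective.injOn]
    have hsumS : ∀ g : V → V, ∑ x ∈ S, g x = g 0 + (g a + (g b + g (a + b))) := by
      intro g
      rw [Finset.sum_insert (by simp [ha.symm, hb0.symm, hs0.symm]),
        Finset.sum_insert (by simp [hab, hb0]), Finset.sum_pair (by simp [ha])]
    rw [hsumS, hsumS] at hsum
    have hadd : φ (a + b) = φ a - φ 0 + φ b := by simpa using hφ a 0 b
    have h0S : (0 : V) ∈ S := by simp [S]
    have haS : a ∈ S := by simp [S]
    have hbS : b ∈ S := by simp [S]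
    have hopp : φ a + φ b = a + b := by
      have h3 := hS3 _ (hmem a haS)
      have h4 := hS3 _ (hmem b hbS)
      rw [hadd] at hsum
      linear_combination (norm := module) h3 + h4 - hsum - ha3 - hb3
    have hopp' : φ 0 + φ (a + b) = a + b := by
      rw [hadd]
      linear_combination (norm := module) hopp
    have hsq : ∃ m, ¬ 2 ∣ m ∧ (φ ^ 2) ^ m = 1 := ⟨m, hm, by rw [← pow_mul, mul_comm, pow_mul, hφm,
      one_pow]⟩
    have hno : ∀ {x y : V}, x ≠ y → φ x = y → φ y ≠ x := fun hxy h1 h2 =>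
      Equiv.Perm.iterate_swap_ne hxy h1 h2 hm hφm
    have hno2 : ∀ {x y : V}, x ≠ y → φ (φ x) = y → φ (φ y) ≠ x := fun hxy h1 h2 => by
      obtain ⟨m, hm, hφm⟩ := hsq
      exact Equiv.Perm.iterate_swap_ne (φ := φ ^ 2) hxy (by simpa [pow_two] using h1)
        (by simpa [pow_two] using h2) hm hφm
    have hinj : ∀ {x y : V}, φ x = φ y → x = y := fun h => φ.injective h
    have h0 := hmem 0 h0S
    have ha' := hmem a haS
    simp only [S, Finset.mem_insert, Finset.mem_singleton] at h0 ha'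
    have hfix : φ 0 = 0 ∧ φ a = a ∧ φ b = b := by
      rcases h0 with h0 | h0 | h0 | h0
      · have hs : φ (a + b) = a + b := by simpa [h0] using hopp'
        rcases ha' with h | h | h | h
        · exact absurd (hinj (h.trans h0.symm)) ha
        · exact ⟨h0, h, by simpa [h] using hopp⟩
        · exact absurd (by simpa [h, add_comm a b] using hopp) (hno hab h)
        · exact absurd (hinj (h.trans hs.symm)) (by simpa using hb0)
      · have hs : φ (a + b) = b := by simpa [h0] using hopp'
        rcases ha' with h | h | h | h
        · exact absurd h (hno ha.symm h0)
        · exact absurd (hinj (h.trans h0.symm)) ha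
        · exact absurd (hinj (h.trans hs.symm)) (by simpa using hb0)
        · have hb' : φ b = 0 := by simpa [h] using hopp
          exact absurd (by rw [hs, hb']) (hno2 hs0.symm (by rw [h0, h]))
      · have hs : φ (a + b) = a := by simpa [h0, add_comm a b] using hopp'
        rcases ha' with h | h | h | h
        · have hb' : φ b = a + b := by simpa [h] using hopp
          exact absurd (by rw [hs, h]) (hno2 hs0.symm (by rw [h0, hb']))
        · exact absurd (hinj (h.trans hs.symm)) (by simpa using hb0)
        · exact absurd (hinj (h.trans h0.symm)) ha
        · exact absurd (by simpa [h] using hopp) (hno hb0.symm h0)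
      · exact absurd (by simpa [h0] using hopp') (hno hs0.symm h0)
    refine hφ.affinelyClosed_fixed.le_of_zero_mem hfix.1 ?_
    rintro x (rfl | rfl | rfl)
    exacts [hfix.1, hfix.2.1, hfix.2.2]
  · have hp4 : 3 < p := by
      have := hp.two_le
      omega
    obtain ⟨f, Y, h1, h2, h3⟩ := exists_coloring_separating (p := p) {0, a, b}
      (Finset.card_le_three.trans_lt hp4)
    exact ⟨f, Y, isRigidOn_closure (by simp) (by simpa using h1), h2 0 (by simp),
      fun x hx0 hxa hxb _ => h3 x (by simp [hx0, hxa, hxb])⟩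

lemma robustlySpans_plane {a b : V} (ha3 : (3 : ℤ) • a = 0) (hb3 : (3 : ℤ) • b = 0) (ha : a ≠ 0)
    (hb : b ∉ AddSubgroup.zmultiples a) :
    RobustlySpans {x | x ∈ AddSubgroup.closure {0, a, b} ∧ x ≠ 0 ∧ x ≠ a ∧ x ≠ b ∧ x ≠ a + b}
      (AddSubgroup.closure {0, a, b}) := by
  have hind := fun i j : ℤ => three_dvd_of_zsmul_add_eq_zero ha3 hb3 ha hb (i := i) (j := j)
  have hne : ∀ i j k l : ℤ, ¬ (3 ∣ i - k ∧ 3 ∣ j - l) → i • a + j • b ≠ k • a + l • b :=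
    fun i j k l h he => h (hind _ _ (by linear_combination (norm := module) he))
  intro t K hK hTK
  have hmem : ∀ i j : ℤ, ¬ (3 ∣ i ∧ 3 ∣ j) → ¬ (3 ∣ i - 1 ∧ 3 ∣ j) → ¬ (3 ∣ i ∧ 3 ∣ j - 1) →
      ¬ (3 ∣ i - 1 ∧ 3 ∣ j - 1) → i • a + j • b ≠ t → i • a + j • b ∈ K := by
    intro i j h1 h2 h3 h4 ht
    refine hTK ⟨⟨?_, ?_, ?_, ?_, ?_⟩, ht⟩
    · exact add_mem (AddSubgroup.zsmul_mem _ (AddSubgroup.subset_closure (by simp)) _)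
        (AddSubgroup.zsmul_mem _ (AddSubgroup.subset_closure (by simp)) _)
    · simpa using hne i j 0 0 (by simpa using h1)
    · simpa using hne i j 1 0 (by simpa using h2)
    · simpa using hne i j 0 1 (by simpa using h3)
    · simpa using hne i j 1 1 h4
  have hP1 := hmem 2 0 (by omega) (by omega) (by omega) (by omega)
  have hP2 := hmem 0 2 (by omega) (by omega) (by omega) (by omega)
  have hP3 := hmem 1 2 (by omega) (by omega) (by omega) (by omega)
  have hP4 := hmem 2 1 (by omega) (by omega) (by omega) (by omega)
  have hP5 := hmem 2 2 (by omega) (by omega) (by omega) (by omega)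
  have hda : ∃ x ∈ K, ∃ y ∈ K, x - y = a := by
    by_cases h2 : (0 : ℤ) • a + (2 : ℤ) • b = t
    · refine ⟨_, hP5 (h2 ▸ hne _ _ _ _ (by omega)), _, hP3 (h2 ▸ hne _ _ _ _ (by omega)), ?_⟩
      module
    by_cases h3 : (1 : ℤ) • a + (2 : ℤ) • b = t
    · refine ⟨_, hP2 h2, _, hP5 (h3 ▸ hne _ _ _ _ (by omega)), ?_⟩
      linear_combination (norm := module) -ha3
    · refine ⟨_, hP3 h3, _, hP2 h2, ?_⟩
      module
  have hdb : ∃ x ∈ K, ∃ y ∈ K, x - y = b := by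
    by_cases h1 : (2 : ℤ) • a + (0 : ℤ) • b = t
    · refine ⟨_, hP5 (h1 ▸ hne _ _ _ _ (by omega)), _, hP4 (h1 ▸ hne _ _ _ _ (by omega)), ?_⟩
      module
    by_cases h4 : (2 : ℤ) • a + (1 : ℤ) • b = t
    · refine ⟨_, hP1 h1, _, hP5 (h4 ▸ hne _ _ _ _ (by omega)), ?_⟩
      linear_combination (norm := module) -hb3
    · refine ⟨_, hP4 h4, _, hP1 h1, ?_⟩
      module
  obtain ⟨x, hx, y, hy, hxy⟩ := hda
  obtain ⟨z, hz, w, hw, hzw⟩ := hdb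
  have hsa : ∀ u ∈ K, a + u ∈ K := fun u hu => hxy ▸ hK x hx y hy u hu
  have hsb : ∀ u ∈ K, b + u ∈ K := fun u hu => hzw ▸ hK z hz w hw u hu
  have h0K : (0 : V) ∈ K := by
    by_cases h2 : (0 : ℤ) • a + (2 : ℤ) • b = t
    · have := hsa _ (hP1 (h2 ▸ hne _ _ _ _ (by omega)))
      rwa [show a + ((2 : ℤ) • a + (0 : ℤ) • b) = 0 by linear_combination (norm := module) ha3] at this
    · have := hsb _ (hP2 h2)
      rwa [show b + ((0 : ℤ) • a + (2 : ℤ) • b) = 0 by linear_combination (norm := module) hb3] at this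
  refine hK.le_of_zero_mem h0K ?_
  rintro u (rfl | rfl | rfl)
  exacts [h0K, by simpa using hsa 0 h0K, by simpa using hsb 0 h0K]

end BaseColorings

section ElementaryAbelian

variable {V : Type*} [AddCommGroup V] [Finite V] {p q : ℕ}

/-- A nontrivial elementary abelian group of odd exponent has a rigid coloring with `p` colors. -/
lemma exists_isRigidOn_top_of_odd [Nontrivial V] (hp : p.Prime) (hq : q.Prime) (hq2 : q ≠ 2)
    (hpq : p ≠ q) (hV : ∀ x : V, q • x = 0) : ∃ f : V → ZMod p, IsRigidOn p ⊤ f := by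
  have hq3 : 3 ≤ q := by have := hq.two_le; omega
  have hhalf : ∀ (U : AddSubgroup V) (x : V), x + x ∈ U → x ∈ U := by
    intro U x hx
    obtain ⟨k, hk⟩ := hq.odd_of_ne_two hq2
    have := U.nsmul_mem hx (k + 1)
    rwa [show (k + 1) • (x + x) = q • x + x by rw [hk]; module, hV, zero_add] at this
  obtain ⟨a, ha⟩ := exists_ne (0 : V)
  have : Fact q.Prime := ⟨hq⟩
  have hord : addOrderOf a = q := addOrderOf_eq_prime (hV a) ha
  by_cases hq5 : 5 ≤ q
  · obtain ⟨f, Y, hf, h0, hY⟩ := exists_isRigidOn_zmultiples hp a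
    refine exists_isRigidOn_top (W := AddSubgroup.zmultiples a) (X := f 0) (Y := Y)
      (by rw [Nat.card_zmultiples, hord]; exact hq5) hf h0 ?_ (Or.inr hhalf)
    exact (robustlySpans_zmultiples hq hq5 hord).mono fun x hx => ⟨hx.1, hY x hx.2.1 hx.2.2⟩
  obtain rfl : q = 3 := by
    have h4 : q ≠ 4 := by rintro rfl; revert hq; decide
    omega
  by_cases htop : ∀ b, b ∈ AddSubgroup.zmultiples a
  · obtain ⟨f, -, hf, -, -⟩ := exists_isRigidOn_zmultiples hp a
    exact ⟨f, by rwa [(AddSubgroup.eq_top_iff' _).2 htop] at hf⟩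
  push Not at htop
  obtain ⟨b, hb⟩ := htop
  have h3 : ∀ x : V, (3 : ℤ) • x = 0 := fun x => by
    exact_mod_cast hV x
  obtain ⟨f, Y, hf, h0, hY⟩ := exists_isRigidOn_plane hp hpq (h3 a) (h3 b) ha hb
  refine exists_isRigidOn_top (W := AddSubgroup.closure {0, a, b}) (X := f 0) (Y := Y)
    ?_ hf h0 ?_ (Or.inr hhalf)
  · have hle : AddSubgroup.zmultiples a ≤ AddSubgroup.closure {0, a, b} := by
      rw [AddSubgroup.zmultiples_le]
      exact AddSubgroup.subset_closure (by simp)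
    have hbW : b ∈ AddSubgroup.closure ({0, a, b} : Set V) :=
      AddSubgroup.subset_closure (by simp)
    have hdvd := AddSubgroup.card_dvd_of_le hle
    have hcard : Nat.card (AddSubgroup.zmultiples a) = 3 := by rw [Nat.card_zmultiples, hord]
    have hne : Nat.card (AddSubgroup.closure ({0, a, b} : Set V)) ≠ 3 := by
      intro h
      have := AddSubgroup.eq_of_le_of_card_ge hle (by rw [h, hcard])
      exact hb (this ▸ hbW)
    have hpos : 0 < Nat.card (AddSubgroup.closure ({0, a, b} : Set V)) := Nat.card_pos
    rw [hcard] at hdvd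
    omega
  · exact (robustlySpans_plane (h3 a) (h3 b) ha hb).mono fun x hx =>
      ⟨hx.1, hY x hx.2.1 hx.2.2.1 hx.2.2.2.1 hx.2.2.2.2⟩

/-- Private colors for an affine basis give a rigid coloring of a small space over `𝔽₂`. -/
lemma exists_isRigidOn_top_of_finrank_lt [Module (ZMod 2) V]
    (hn : Module.finrank (ZMod 2) V + 1 < p) : ∃ f : V → ZMod p, IsRigidOn p ⊤ f := by
  classical
  have : Module.Finite (ZMod 2) V := Module.Finite.of_finite
  let b := Module.finBasis (ZMod 2) V
  obtain ⟨f, -, hf, -, -⟩ := exists_coloring_separating (p := p)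
    (insert 0 (Finset.univ.image b)) ((Finset.card_insert_le _ _).trans_lt
      ((Nat.add_le_add_right Finset.card_image_le 1).trans_lt (by simpa using hn)))
  have h := isRigidOn_closure (p := p) (f := f)
    (S := (insert 0 (Finset.univ.image b) : Finset V)) (by simp) (fun s hs => hf s hs)
  refine ⟨f, ?_⟩
  have htop : AddSubgroup.closure (((insert 0 (Finset.univ.image b) : Finset V)) : Set V) = ⊤ := by
    rw [AddSubgroup.eq_top_iff']
    intro x
    rw [← b.sum_repr x]
    refine AddSubgroup.sum_mem _ fun i _ => ?_
    obtain ⟨m, hm⟩ := ZMod.natCast_zmod_surjective (b.repr x i)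
    rw [← hm, Nat.cast_smul_eq_nsmul]
    exact AddSubgroup.nsmul_mem _ (AddSubgroup.subset_closure (by simp)) m
  rwa [htop] at h

lemma binaryColor_lt_three (x : Fin 4 → ZMod 2) : binaryColor x < 3 := by
  unfold binaryColor
  split_ifs <;> norm_num

lemma natCast_binaryColor_inj (hp3 : 3 ≤ p) {x y : Fin 4 → ZMod 2}
    (h : (binaryColor x : ZMod p) = binaryColor y) : binaryColor x = binaryColor y := by
  rw [ZMod.natCast_eq_natCast_iff'] at h
  rwa [Nat.mod_eq_of_lt ((binaryColor_lt_three x).trans_le hp3),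
    Nat.mod_eq_of_lt ((binaryColor_lt_three y).trans_le hp3)] at h

/-- An affine self-map of `𝔽₂⁴` in terms of the images of `0` and of the standard basis. -/
lemma IsAffine.eq_sum_zmod_two {τ : (Fin 4 → ZMod 2) → Fin 4 → ZMod 2} (hτ : IsAffine τ)
    (x : Fin 4 → ZMod 2) : τ x = τ 0 + x 0 • (τ ![1, 0, 0, 0] - τ 0) +
      x 1 • (τ ![0, 1, 0, 0] - τ 0) + x 2 • (τ ![0, 0, 1, 0] - τ 0) +
      x 3 • (τ ![0, 0, 0, 1] - τ 0) := by
  let L : (Fin 4 → ZMod 2) →+ (Fin 4 → ZMod 2) :=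
    { toFun := fun y => τ y - τ 0
      map_zero' := sub_self _
      map_add' := fun y z => by
        have := hτ y 0 z
        rw [sub_zero] at this
        rw [this]
        abel }
  have hL := LinearMap.pi_apply_eq_sum_univ (L.toZModLinearMap 2) x
  have h0 : (fun j : Fin 4 => if (0 : Fin 4) = j then (1 : ZMod 2) else 0) = ![1, 0, 0, 0] := by
    decide
  have h1 : (fun j : Fin 4 => if (1 : Fin 4) = j then (1 : ZMod 2) else 0) = ![0, 1, 0, 0] := by
    decide
  have h2 : (fun j : Fin 4 => if (2 : Fin 4) = j then (1 : ZMod 2) else 0) = ![0, 0, 1, 0] := by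
    decide
  have h3 : (fun j : Fin 4 => if (3 : Fin 4) = j then (1 : ZMod 2) else 0) = ![0, 0, 0, 1] := by
    decide
  rw [Fin.sum_univ_four, h0, h1, h2, h3] at hL
  have hL' : τ x - τ 0 = x 0 • (τ ![1, 0, 0, 0] - τ 0) + x 1 • (τ ![0, 1, 0, 0] - τ 0) +
      x 2 • (τ ![0, 0, 1, 0] - τ 0) + x 3 • (τ ![0, 0, 0, 1] - τ 0) := hL
  linear_combination (norm := module) hL'

lemma IsAffine.eq_self_of_binaryColor_eq {τ : (Fin 4 → ZMod 2) → Fin 4 → ZMod 2}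
    (hτ : IsAffine τ) (hcol : ∀ x, binaryColor (τ x) = binaryColor x) (x : Fin 4 → ZMod 2) :
    τ x = x := by
  obtain ⟨h0, h1, h2, h3, h4⟩ := eq_standard_of_binaryColor_eq (τ 0) ((hcol _).trans (by decide))
    (τ ![1, 0, 0, 0]) ((hcol _).trans (by decide)) (τ ![0, 1, 0, 0]) ((hcol _).trans (by decide))
    (by rw [← hτ, hcol]; decide) (τ ![0, 0, 1, 0]) ((hcol _).trans (by decide))
    (by rw [← hτ, hcol]; decide) (by rw [← hτ, hcol]; decide) (τ ![0, 0, 0, 1])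
    ((hcol _).trans (by decide)) (fun x => by rw [← hτ.eq_sum_zmod_two, hcol])
  rw [hτ.eq_sum_zmod_two, h0, h1, h2, h3, h4]
  funext i
  fin_cases i <;> simp

/-- The affine span of the points of color `1` is everything. -/
lemma AffinelyClosed.mem_of_binaryColor_eq_one {K : Set (Fin 4 → ZMod 2)} (hK : AffinelyClosed K)
    (h : ∀ x, binaryColor x = 1 → x ∈ K) (x : Fin 4 → ZMod 2) : x ∈ K := by
  have h5 := h ![1, 0, 1, 0] (by decide)
  have h8 := h ![0, 0, 0, 1] (by decide)
  have h9 := h ![1, 0, 0, 1] (by decide)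
  have h10 := h ![0, 1, 0, 1] (by decide)
  have h13 := h ![1, 0, 1, 1] (by decide)
  have h0 : (0 : Fin 4 → ZMod 2) ∈ K := by
    have := hK _ h5 _ h13 _ h8
    rwa [show ![1, 0, 1, 0] - ![1, 0, 1, 1] + ![0, 0, 0, 1] = (0 : Fin 4 → ZMod 2) by decide]
      at this
  have h1 : ![1, 0, 0, 0] ∈ K := by
    have := hK _ h9 _ h8 _ h0
    rwa [show ![1, 0, 0, 1] - ![0, 0, 0, 1] + 0 = (![1, 0, 0, 0] : Fin 4 → ZMod 2) by decide]
      at this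
  have h2 : ![0, 1, 0, 0] ∈ K := by
    have := hK _ h10 _ h8 _ h0
    rwa [show ![0, 1, 0, 1] - ![0, 0, 0, 1] + 0 = (![0, 1, 0, 0] : Fin 4 → ZMod 2) by decide]
      at this
  have h4 : ![0, 0, 1, 0] ∈ K := by
    have := hK _ h5 _ h1 _ h0
    rwa [show ![1, 0, 1, 0] - ![1, 0, 0, 0] + 0 = (![0, 0, 1, 0] : Fin 4 → ZMod 2) by decide]
      at this
  have hm : ∀ y ∈ K, ∀ c : ZMod 2, c • y ∈ (hK.direction h0) := by
    intro y hy c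
    obtain ⟨m, rfl⟩ := ZMod.natCast_zmod_surjective c
    rw [Nat.cast_smul_eq_nsmul]
    exact AddSubgroup.nsmul_mem _ (show y + 0 ∈ K by simpa using hy) m
  have hx : x = x 0 • ![1, 0, 0, 0] + x 1 • ![0, 1, 0, 0] + x 2 • ![0, 0, 1, 0] +
      x 3 • ![0, 0, 0, 1] := by
    funext i
    fin_cases i <;> simp
  have : x ∈ hK.direction h0 := by
    rw [hx]
    exact add_mem (add_mem (add_mem (hm _ h1 _) (hm _ h2 _)) (hm _ h4 _)) (hm _ h8 _)
  simpa using (show x + 0 ∈ K from this)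

/-- A vector space over `𝔽₂` of dimension at least four has a rigid coloring with `p ≥ 3` colors. -/
lemma exists_isRigidOn_top_of_le_finrank [Module (ZMod 2) V] (hp3 : 3 ≤ p)
    (hn : 4 ≤ Module.finrank (ZMod 2) V) : ∃ f : V → ZMod p, IsRigidOn p ⊤ f := by
  obtain ⟨e, he⟩ := exists_linearIndependent_of_le_finrank hn
  let ψ : (Fin 4 → ZMod 2) →ₗ[ZMod 2] V := Fintype.linearCombination (ZMod 2) e
  have hψ : Function.Injective ψ := linearIndependent_iff_injective_fintypeLinearCombination.1 he
  let W : AddSubgroup V := ψ.toAddMonoidHom.range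
  have hmemW : ∀ x, ψ x ∈ W := fun x => ⟨x, rfl⟩
  let f : V → ZMod p := fun v => binaryColor (Function.invFun ψ v)
  have hfψ : ∀ x, f (ψ x) = binaryColor x := fun x => by
    simp only [f, Function.leftInverse_invFun hψ x]
  have h012 : (1 : ZMod p) ≠ 2 ∧ (2 : ZMod p) ≠ 0 ∧ (1 : ZMod p) ≠ 0 := by
    have h (m n : ℕ) (hm : m < p) (hn : n < p) (hmn : m ≠ n) : (m : ZMod p) ≠ n := by
      rwa [Ne, ZMod.natCast_eq_natCast_iff', Nat.mod_eq_of_lt hm, Nat.mod_eq_of_lt hn]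
    exact ⟨by exact_mod_cast h 1 2 (by omega) (by omega) (by omega),
      by exact_mod_cast h 2 0 (by omega) (by omega) (by omega),
      by exact_mod_cast h 1 0 (by omega) (by omega) (by omega)⟩
  have hcardW : 5 ≤ Nat.card W := by
    have : Nat.card W = 16 := by
      have h : Nat.card (Set.range ψ) = 16 := by
        rw [← Nat.card_congr (Equiv.ofInjective ψ hψ)]
        simp
      exact h
    omega
  have hrigid : IsRigidOn p W f := by
    rintro φ hφ - hφW hcol
    choose! τ hτ using fun x => hφW (ψ x) (hmemW x)
    replace hτ : ∀ x, ψ (τ x) = φ (ψ x) := hτ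
    have hτa : IsAffine τ := fun x y z => hψ (by
      simp only [map_add, map_sub, hτ, hφ _ _ _])
    have hτc : ∀ x, binaryColor (τ x) = binaryColor x := fun x =>
      natCast_binaryColor_inj hp3 (by rw [← hfψ, ← hfψ, hτ]; exact hcol _ (hmemW x))
    rintro _ ⟨x, rfl⟩
    change φ (ψ x) = ψ x
    rw [← hτ, hτa.eq_self_of_binaryColor_eq hτc]
  by_cases htop : W = ⊤
  · exact ⟨f, htop ▸ hrigid⟩
  obtain ⟨v, hv⟩ : ∃ v, v ∉ W := by
    by_contra! h
    exact htop ((AddSubgroup.eq_top_iff' _).2 h)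
  have hspan : AffinelySpans {x | x ∈ W ∧ f x = 1} W := by
    intro K hK hTK
    rintro _ ⟨x, rfl⟩
    have hK' : AffinelyClosed (ψ ⁻¹' K) := fun x hx y hy z hz => by
      rw [Set.mem_preimage, map_add, map_sub]
      exact hK _ hx _ hy _ hz
    exact hK'.mem_of_binaryColor_eq_one (fun y hy => hTK ⟨hmemW y, by simp [hfψ, hy]⟩) x
  have hle : W ≤ W ⊔ AddSubgroup.zmultiples v := le_sup_left
  have hext := hrigid.extend_of_affinelySpans (X := 2) (Y := 0) h012.2.1 hv h012.1 h012.2.2 hspan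
  have hrob : RobustlySpans {x | x ∈ W ⊔ AddSubgroup.zmultiples v ∧
      extendColoring W f v 2 0 x = 2} (W ⊔ AddSubgroup.zmultiples v) := by
    refine robustlySpans_extendColoring hcardW hv (Or.inl
      ⟨ψ ![1, 1, 0, 0], hmemW _, ψ ![1, 1, 1, 0], hmemW _, hψ.ne (by decide), ?_, ?_⟩)
    · rw [hfψ, show binaryColor ![1, 1, 0, 0] = 2 by decide, Nat.cast_two]
    · rw [hfψ, show binaryColor ![1, 1, 1, 0] = 2 by decide, Nat.cast_two]
  refine exists_isRigidOn_top (hcardW.trans (Nat.card_mono (Set.toFinite _) hle)) hext h012.1 hrob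
    (Or.inl ⟨ψ ![0, 0, 0, 1], hle (hmemW _), ψ ![1, 0, 0, 1], hle (hmemW _),
      hψ.ne (by decide), ?_, ?_⟩)
  · rw [extendColoring_of_mem (hmemW _), hfψ, show binaryColor ![0, 0, 0, 1] = 1 by decide,
      Nat.cast_one]
  · rw [extendColoring_of_mem (hmemW _), hfψ, show binaryColor ![1, 0, 0, 1] = 1 by decide,
      Nat.cast_one]

/-- A nontrivial elementary abelian group of exponent prime to `p` has a rigid coloring with `p`
colors, except possibly for groups of order `4` and `8` with `p = 3`. -/
lemma exists_isRigidOn_top_or_card [Nontrivial V] (hp : p.Prime) (hq : q.Prime) (hpq : p ≠ q)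
    (hV : ∀ x : V, q • x = 0) : (∃ f : V → ZMod p, IsRigidOn p ⊤ f) ∨
      p = 3 ∧ q = 2 ∧ (Nat.card V = 4 ∨ Nat.card V = 8) := by
  by_cases hq2 : q = 2
  · subst hq2
    let : Module (ZMod 2) V := AddCommGroup.zmodModule hV
    have hp3 : 3 ≤ p := by have := hp.two_le; omega
    have hcard : Nat.card V = 2 ^ Module.finrank (ZMod 2) V := by
      rw [Module.natCard_eq_pow_finrank (K := ZMod 2), Nat.card_zmod]
    by_cases h1 : Module.finrank (ZMod 2) V + 1 < p
    · exact Or.inl (exists_isRigidOn_top_of_finrank_lt h1)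
    by_cases h2 : 4 ≤ Module.finrank (ZMod 2) V
    · exact Or.inl (exists_isRigidOn_top_of_le_finrank hp3 h2)
    have hp4 : p ≠ 4 := by rintro rfl; revert hp; decide
    obtain rfl : p = 3 := by omega
    have h : Module.finrank (ZMod 2) V = 2 ∨ Module.finrank (ZMod 2) V = 3 := by omega
    refine Or.inr ⟨rfl, rfl, ?_⟩
    rcases h with h | h <;> rw [hcard, h] <;> norm_num
  · exact Or.inl (exists_isRigidOn_top_of_odd hp hq hq2 hpq hV)

end ElementaryAbelian

section RegularNormalSubgroup

open MulAction

variable {G Ω : Type*} [Group G] [MulAction G Ω]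

lemma smul_eq_of_pow_smul_eq {g : G} {x : Ω} {k : ℕ} (h : g ^ k • x = x)
    (hk : k.Coprime (Nat.card G)) : g • x = x := by
  have h1 : MulAction.period g x ∣ k := pow_smul_eq_iff_period_dvd.1 h
  have h2 : MulAction.period g x ∣ Nat.card G :=
    pow_smul_eq_iff_period_dvd.1 (by rw [pow_card_eq_one', one_smul])
  have h3 : MulAction.period g x ∣ 1 := (Nat.dvd_gcd h1 h2).trans hk.dvd
  simpa using pow_smul_eq_iff_period_dvd.2 h3

/-- A nontrivial finite solvable group has a nontrivial normal elementary abelian subgroup. -/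
lemma exists_normal_elementary_abelian [Finite G] [Nontrivial G] [Group.IsSolvable G] :
    ∃ (N : Subgroup G) (q : ℕ), N.Normal ∧ N ≠ ⊥ ∧ q.Prime ∧ (∀ a ∈ N, ∀ b ∈ N, a * b = b * a) ∧
      ∀ a ∈ N, a ^ q = 1 := by
  classical
  have hex : ∃ n, derivedSeries G n = ⊥ := Group.IsSolvable.solvable
  obtain ⟨n, hn⟩ : ∃ n, Nat.find hex = n + 1 := by
    refine Nat.exists_eq_succ_of_ne_zero fun h => ?_
    have := Nat.find_spec hex
    rw [h, derivedSeries_zero] at this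
    exact top_ne_bot this
  have hA : derivedSeries G n ≠ ⊥ := Nat.find_min hex (by omega)
  have hcomm : ∀ a ∈ derivedSeries G n, ∀ b ∈ derivedSeries G n, a * b = b * a := by
    have := Nat.find_spec hex
    rw [hn, derivedSeries_succ, Subgroup.commutator_eq_bot_iff_le_centralizer] at this
    exact fun a ha b hb => (Subgroup.mem_centralizer_iff.1 (this ha) b hb).symm
  have hnorm : (derivedSeries G n).Normal := derivedSeries_normal G n
  have hcard : Nat.card (derivedSeries G n) ≠ 1 := by
    rwa [Ne, Subgroup.card_eq_one]
  obtain ⟨q, hq, hqA⟩ := Nat.exists_prime_and_dvd hcard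
  have : Fact q.Prime := ⟨hq⟩
  obtain ⟨a, ha⟩ := exists_prime_orderOf_dvd_card' q hqA
  refine ⟨{ carrier := {x | x ∈ derivedSeries G n ∧ x ^ q = 1}
            mul_mem' := ?_
            one_mem' := ⟨one_mem _, one_pow _⟩
            inv_mem' := ?_ }, q, ⟨?_⟩, ?_, hq, ?_, ?_⟩
  · rintro x y ⟨hx, hxq⟩ ⟨hy, hyq⟩
    refine ⟨mul_mem hx hy, ?_⟩
    rw [(show Commute x y from hcomm x hx y hy).mul_pow, hxq, hyq, one_mul]
  · rintro x ⟨hx, hxq⟩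
    exact ⟨inv_mem hx, by rw [inv_pow, hxq, inv_one]⟩
  · rintro x ⟨hx, hxq⟩ g
    exact ⟨hnorm.conj_mem x hx g, by rw [conj_pow, hxq]; simp⟩
  · rw [Subgroup.ne_bot_iff_exists_ne_one]
    refine ⟨⟨a, a.2, ?_⟩, ?_⟩
    · rw [← ha]
      exact_mod_cast pow_orderOf_eq_one a
    · intro h
      have : (a : G) = 1 := congrArg Subtype.val h
      have : a = 1 := Subtype.ext this
      rw [this, orderOf_one] at ha
      exact hq.one_lt.ne ha
  · exact fun x hx y hy => hcomm x hx.1 y hy.1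
  · exact fun x hx => hx.2

/-- A finite solvable primitive permutation group has a regular normal elementary abelian
subgroup. -/
lemma exists_regular_normal_elementary_abelian [Finite G] [Group.IsSolvable G] [Nontrivial Ω]
    [FaithfulSMul G Ω] [IsPreprimitive G Ω] :
    ∃ (N : Subgroup G) (q : ℕ), N.Normal ∧ q.Prime ∧ (∀ a ∈ N, ∀ b ∈ N, a * b = b * a) ∧
      (∀ a ∈ N, a ^ q = 1) ∧ IsPretransitive N Ω ∧ ∀ a ∈ N, ∀ x : Ω, a • x = x → a = 1 := by
  have : Nontrivial G := by
    obtain ⟨x, y, hxy⟩ := exists_pair_ne Ω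
    obtain ⟨g, hg⟩ := exists_smul_eq G x y
    refine ⟨g, 1, ?_⟩
    rintro rfl
    exact hxy (by simpa using hg)
  obtain ⟨N, q, hN, hbot, hq, hcomm, hexp⟩ := exists_normal_elementary_abelian (G := G)
  have htrans : IsPretransitive N Ω := by
    refine IsQuasiPreprimitive.isPretransitive_of_normal (G := G) fun h => hbot ?_
    rw [Subgroup.eq_bot_iff_forall]
    intro a ha
    refine FaithfulSMul.eq_of_smul_eq_smul (α := Ω) fun x => ?_
    rw [one_smul]
    exact (h ▸ Set.mem_univ x : x ∈ fixedPoints N Ω) ⟨a, ha⟩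
  refine ⟨N, q, hN, hq, hcomm, hexp, htrans, fun a ha x hax => ?_⟩
  refine FaithfulSMul.eq_of_smul_eq_smul (α := Ω) fun y => ?_
  obtain ⟨⟨b, hb⟩, rfl⟩ := exists_smul_eq N x y
  change a • b • x = (1 : G) • b • x
  rw [one_smul, smul_smul, hcomm a ha b hb, mul_smul, hax]

/-- A finite solvable primitive permutation group acts by affine maps, including all translations,
for a suitable structure of an elementary abelian group on the points. -/
lemma exists_addCommGroup_isAffine [Finite G] [Group.IsSolvable G] [Nontrivial Ω]
    [FaithfulSMul G Ω] [IsPreprimitive G Ω] :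
    ∃ (_ : AddCommGroup Ω) (q : ℕ), q.Prime ∧ q ∣ Nat.card G ∧ (∀ x : Ω, q • x = 0) ∧
      (∀ g : G, IsAffine fun x : Ω => g • x) ∧ ∀ v : Ω, ∃ g : G, ∀ x : Ω, g • x = v + x := by
  obtain ⟨N, q, hN, hq, hcomm, hexp, htrans, hfree⟩ :=
    exists_regular_normal_elementary_abelian (G := G) (Ω := Ω)
  obtain ⟨ω, ω', hω⟩ := exists_pair_ne Ω
  have hreg : ∀ a ∈ N, ∀ b ∈ N, ∀ x : Ω, a • x = b • x → a = b := by
    intro a ha b hb x h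
    have := hfree (b⁻¹ * a) (mul_mem (inv_mem hb) ha) x (by rw [mul_smul, h, inv_smul_smul])
    exact (inv_mul_eq_one.1 this).symm
  let : CommGroup N := { (inferInstance : Group N) with
    mul_comm := fun a b => Subtype.ext (hcomm a a.2 b b.2) }
  let e : Additive N ≃ Ω := Equiv.ofBijective (fun n => (n.toMul : G) • ω)
    ⟨fun a b h => Additive.toMul.injective
      (Subtype.ext (hreg _ a.toMul.2 _ b.toMul.2 ω h)), fun y => by
      obtain ⟨n, hn⟩ := exists_smul_eq N ω y
      exact ⟨Additive.ofMul n, hn⟩⟩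
  let : AddCommGroup Ω := e.symm.addCommGroup
  let c : Ω → G := fun x => ((e.symm x).toMul : G)
  have hcN : ∀ x, c x ∈ N := fun x => (e.symm x).toMul.2
  have hc : ∀ x, c x • ω = x := fun x => e.apply_symm_apply x
  have hadd : ∀ x y, c (x + y) = c x * c y := fun x y => by
    simp only [c, Equiv.add_def, Equiv.symm_symm, Equiv.symm_apply_apply]
    rfl
  have hinj : ∀ x y, c x = c y → x = y := fun x y h => by rw [← hc x, ← hc y, h]
  have hsub : ∀ x y, c (x - y) = c x * (c y)⁻¹ := fun x y => by
    rw [eq_mul_inv_iff_mul_eq, ← hadd, sub_add_cancel]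
  have hzero : c 0 = 1 := by simpa using hsub 0 0
  have hnsmul : ∀ (n : ℕ) x, c (n • x) = c x ^ n := by
    intro n x
    induction n with
    | zero => rw [zero_nsmul, hzero, pow_zero]
    | succ n ih => rw [succ_nsmul, hadd, ih, pow_succ]
  have htransl : ∀ v x : Ω, c v • x = v + x := fun v x => by
    rw [← hc (v + x), hadd, mul_smul, hc]
  refine ⟨this, q, hq, ?_, fun x => hinj _ _ (by rw [hnsmul, hexp _ (hcN x), hzero]), ?_,
    fun v => ⟨c v, htransl v⟩⟩
  · have hne : c ω' ≠ c ω := fun h => hω (hinj _ _ h).symm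
    have hne1 : c (ω' - ω) ≠ 1 := by
      rw [hsub, Ne, mul_inv_eq_one]
      exact hne
    have : Fact q.Prime := ⟨hq⟩
    rw [← orderOf_eq_prime (hexp _ (hcN _)) hne1]
    exact orderOf_dvd_natCard _
  · intro g x y z
    have hconj : g * (c x * (c y)⁻¹) * g⁻¹ = c (g • x) * (c (g • y))⁻¹ := by
      refine hreg _ (hN.conj_mem _ (mul_mem (hcN x) (inv_mem (hcN y))) g) _
        (mul_mem (hcN _) (inv_mem (hcN _))) (g • y) ?_
      have h1 : (c y)⁻¹ • y = ω := by rw [inv_smul_eq_iff, hc]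
      have h2 : (c (g • y))⁻¹ • g • y = ω := by rw [inv_smul_eq_iff, hc]
      rw [mul_smul, mul_smul, inv_smul_smul, mul_smul, h1, hc, mul_smul, h2, hc]
    change g • (x - y + z) = g • x - g • y + g • z
    rw [← htransl, ← htransl, hsub, hsub, ← hconj]
    simp only [mul_smul, inv_smul_smul]

end RegularNormalSubgroup

section SmallDegree

open MulAction

variable {G : Type*} [Group G]

/-- A group of order prime to `3` acting on four points preserves some `3`-coloring only
trivially. -/
lemma exists_coloring_of_card_eq_four {Ω : Type*} [MulAction G Ω] (h4 : Nat.card Ω = 4)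
    (hG : ¬ 3 ∣ Nat.card G) :
    ∃ f : Ω → ZMod 3, ∀ g : G, (∀ x, f (g • x) = f x) → ∀ x : Ω, g • x = x := by
  classical
  have : Finite Ω := Nat.finite_of_card_ne_zero (by omega)
  let e : Fin 4 ≃ Ω := ((Finite.equivFin Ω).trans (finCongr h4)).symm
  have hne : ∀ i j : Fin 4, i ≠ j → e i ≠ e j := fun i j h => e.injective.ne h
  have hall : ∀ v : Ω, v = e 0 ∨ v = e 1 ∨ v = e 2 ∨ v = e 3 := by
    intro v
    obtain ⟨i, rfl⟩ := e.surjective v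
    fin_cases i <;> simp
  have h12 : (2 : ZMod 3) ≠ 0 ∧ (2 : ZMod 3) ≠ 1 := by decide
  by_contra! hcon
  have key : ∀ x y z : Ω, e 0 ≠ x → y ≠ z → e 0 ≠ y → e 0 ≠ z → x ≠ y → x ≠ z →
      (∀ v, v = e 0 ∨ v = x ∨ v = y ∨ v = z) →
      ∃ g : G, g • x = x ∧ g • y = z ∧ g • z = y := by
    intro x y z h0x hyz h0y h0z hxy hxz hv
    obtain ⟨g, hg, w, hw⟩ := hcon fun v => if v = e 0 then 0 else if v = x then 1 else 2
    have hg0 : g • e 0 = e 0 := by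
      have := hg (e 0)
      by_contra hne
      by_cases hx : g • e 0 = x <;> simp [hne, hx, h0x.symm, h12.1] at this
    have hgx : g • x = x := by
      have := hg x
      by_contra hne
      by_cases hx : g • x = e 0 <;> simp [hne, hx, h0x.symm, h12.2] at this
    have hmove : ∀ u v, e 0 ≠ u → x ≠ u → (∀ v', v' = e 0 ∨ v' = x ∨ v' = u ∨ v' = v) →
        g • u = u ∨ g • u = v := by
      intro u v hu hx hv
      rcases hv (g • u) with h | h | h | h
      · exact absurd (smul_left_cancel g (h.trans hg0.symm)) hu.symm
      · exact absurd (smul_left_cancel g (h.trans hgx.symm)) hx.symm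
      · exact Or.inl h
      · exact Or.inr h
    have hv' : ∀ v, v = e 0 ∨ v = x ∨ v = z ∨ v = y := fun v => by
      have := hv v
      tauto
    refine ⟨g, hgx, ?_⟩
    rcases hmove y z h0y hxy hv with h1 | h1 <;> rcases hmove z y h0z hxz hv' with h2 | h2
    · rcases hv w with rfl | rfl | rfl | rfl <;> contradiction
    · exact absurd (smul_left_cancel g (h1.trans h2.symm)) hyz
    · exact absurd (smul_left_cancel g (h1.trans h2.symm)) hyz
    · exact ⟨h1, h2⟩
  obtain ⟨s, hs1, hs2, hs3⟩ := key (e 1) (e 2) (e 3) (hne _ _ (by decide)) (hne _ _ (by decide))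
    (hne _ _ (by decide)) (hne _ _ (by decide)) (hne _ _ (by decide)) (hne _ _ (by decide)) hall
  obtain ⟨t, ht1, ht2, ht3⟩ := key (e 2) (e 1) (e 3) (hne _ _ (by decide)) (hne _ _ (by decide))
    (hne _ _ (by decide)) (hne _ _ (by decide)) (hne _ _ (by decide)) (hne _ _ (by decide))
    fun v => by have := hall v; tauto
  have h3 : (s * t) ^ 3 • e 1 = e 1 := by
    simp only [pow_succ, pow_zero, one_mul, mul_smul, hs1, hs2, hs3, ht1, ht2, ht3]
  have := smul_eq_of_pow_smul_eq h3 ((Nat.Prime.coprime_iff_not_dvd Nat.prime_three).2 hG)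
  rw [mul_smul, ht2, hs3] at this
  exact hne 2 1 (by decide) this

variable {V : Type*} [AddCommGroup V] [MulAction G V]

/-- A subgroup invariant under the point stabilizer is a block for an affine action that contains
all translations. -/
lemma isBlock_of_stabilizer_invariant [Finite V]
    (htr : ∀ v : V, ∃ g : G, ∀ x : V, g • x = v + x) (H : AddSubgroup V)
    (hH : ∀ g ∈ stabilizer G (0 : V), ∀ x ∈ H, g • x ∈ H) : IsBlock G (H : Set V) := by
  rw [isBlock_iff_smul_eq_of_nonempty]
  rintro g ⟨b, ⟨a, ha, hab⟩, hb⟩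
  replace hab : g • a = b := hab
  obtain ⟨t, ht⟩ := htr (-(g • (0 : V)))
  have hlin : ∀ x : V, (t * g) • x = g • x - g • (0 : V) := fun x => by
    rw [mul_smul, ht]; abel
  have hstab : t * g ∈ stabilizer G (0 : V) := by
    rw [mem_stabilizer_iff, hlin, sub_self]
  have h0 : g • (0 : V) ∈ H := by
    have := hH _ hstab a ha
    rw [hlin, hab] at this
    simpa using sub_mem hb this
  refine Set.eq_of_subset_of_ncard_le ?_ ?_
  · rintro _ ⟨x, hx, rfl⟩
    have := add_mem (hH _ hstab x hx) h0
    rwa [hlin, sub_add_cancel] at this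
  · rw [Set.ncard_smul_set]

lemma smul_add_of_mem_stabilizer (haff : ∀ g : G, IsAffine fun x : V => g • x) {g : G}
    (hg : g ∈ stabilizer G (0 : V)) (x y : V) : g • (x + y) = g • x + g • y := by
  have h := haff g x 0 y
  simpa [mem_stabilizer_iff.1 hg] using h

/-- In an affine primitive action of a group of order prime to `3` on eight points, a point
stabilizer is transitive on the remaining points. -/
lemma exists_stabilizer_smul_eq_of_card_eq_eight [Finite G] [IsPreprimitive G V]
    (h8 : Nat.card V = 8) (h2 : ∀ x : V, 2 • x = 0) (hG : ¬ 3 ∣ Nat.card G)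
    (haff : ∀ g : G, IsAffine fun x : V => g • x)
    (htr : ∀ v : V, ∃ g : G, ∀ x : V, g • x = v + x) {v w : V} (hv : v ≠ 0) (hw : w ≠ 0) :
    ∃ g ∈ stabilizer G (0 : V), g • v = w := by
  have : Finite V := Nat.finite_of_card_ne_zero (by omega)
  have : Fintype V := Fintype.ofFinite V
  let : Module (ZMod 2) V := AddCommGroup.zmodModule h2
  let S := stabilizer G (0 : V)
  have hlow : ∀ x : V, x ≠ 0 → 4 ≤ (orbit S x).ncard := by
    intro x hx
    have hxO : x ∈ AddSubgroup.closure (orbit S x) :=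
      AddSubgroup.subset_closure (mem_orbit_self x)
    have hblock := isBlock_of_stabilizer_invariant htr (AddSubgroup.closure (orbit S x)) <| by
      intro g hg y hy
      induction hy using AddSubgroup.closure_induction with
      | mem y hy => exact AddSubgroup.subset_closure (mem_orbit_of_mem_orbit (⟨g, hg⟩ : S) hy)
      | zero => rw [mem_stabilizer_iff.1 hg]; exact zero_mem _
      | add y z _ _ hy hz => rw [smul_add_of_mem_stabilizer haff hg]; exact add_mem hy hz
      | neg y _ hy =>
        have : y + -y = 0 := add_neg_cancel y
        have h : g • y + g • (-y) = 0 := by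
          rw [← smul_add_of_mem_stabilizer haff hg, this, mem_stabilizer_iff.1 hg]
        rw [← neg_eq_of_add_eq_zero_right h]
        exact neg_mem hy
    have htop : ∀ y, y ∈ AddSubgroup.closure (orbit S x) := by
      rcases hblock.subsingleton_or_eq_univ with h | h
      · exact absurd (h hxO (zero_mem _)) hx
      · intro y
        have : y ∈ (AddSubgroup.closure (orbit S x) : Set V) := h ▸ Set.mem_univ y
        exact this
    have hspan : Submodule.span (ZMod 2) (orbit S x) = ⊤ := by
      rw [Submodule.eq_top_iff']
      intro y
      have hle : AddSubgroup.closure (orbit S x) ≤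
          (Submodule.span (ZMod 2) (orbit S x)).toAddSubgroup := by
        rw [AddSubgroup.closure_le]
        exact Submodule.subset_span
      exact hle (htop y)
    have hrank : Module.finrank (ZMod 2) V = 3 := by
      have := Module.natCard_eq_pow_finrank (K := ZMod 2) (V := V)
      rw [h8, Nat.card_zmod] at this
      exact (Nat.pow_right_injective le_rfl (this.symm.trans (by norm_num : 8 = 2 ^ 3)))
    have h3 : 3 ≤ (orbit S x).ncard := by
      classical
      have := finrank_span_le_card (R := ZMod 2) (orbit S x)
      rwa [hspan, finrank_top, hrank, ← Set.ncard_eq_toFinset_card'] at this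
    have hdvd : (orbit S x).ncard ∣ Nat.card G := by
      refine dvd_trans ?_ (Subgroup.card_subgroup_dvd_card S)
      rw [← index_stabilizer]
      exact Subgroup.index_dvd_card _
    have hne3 : (orbit S x).ncard ≠ 3 := fun h => hG (h ▸ hdvd)
    omega
  have hzero : ∀ x : V, x ≠ 0 → (0 : V) ∉ orbit S x := by
    rintro x hx ⟨g, hg⟩
    refine hx (smul_left_cancel (g : G) ?_)
    rw [mem_stabilizer_iff.1 g.2]
    exact hg
  by_cases h : w ∈ orbit S v
  · obtain ⟨g, hg⟩ := h
    exact ⟨g, g.2, hg⟩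
  · exfalso
    have hdisj : Disjoint (orbit S v) (orbit S w) :=
      Set.disjoint_left.2 fun y hy hy' => h (orbit_eq_iff.1
        ((orbit_eq_iff.2 hy').symm.trans (orbit_eq_iff.2 hy)))
    have hun := Set.ncard_union_eq hdisj
    have h0 : (0 : V) ∉ orbit S v ∪ orbit S w := by
      rintro (h | h)
      exacts [hzero v hv h, hzero w hw h]
    have := Set.ncard_insert_of_notMem h0
    have hle := Set.ncard_le_card (insert 0 (orbit S v ∪ orbit S w))
    have := hlow v hv
    have := hlow w hw
    omega

/-- A permutation normalizing a group of order seven, with order prime to `3`, centralizes or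
inverts it. -/
lemma conj_eq_self_or_inv_of_card_eq_seven [Finite G] (hG : ¬ 3 ∣ Nat.card G) {N : Subgroup G}
    (hN : N.Normal) (h7 : Nat.card N = 7) (t : G) :
    (∀ n ∈ N, t * n * t⁻¹ = n) ∨ ∀ n ∈ N, t * n * t⁻¹ = n⁻¹ := by
  have : Fact (Nat.Prime 7) := ⟨by norm_num⟩
  have : IsCyclic N := isCyclic_of_prime_card h7
  obtain ⟨s, hs⟩ := IsCyclic.exists_generator (α := N)
  have hord : orderOf (s : G) = 7 := by
    rw [Subgroup.orderOf_coe, orderOf_eq_card_of_forall_mem_zpowers hs, h7]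
  have hgen : ∀ n ∈ N, ∃ k : ℤ, n = (s : G) ^ k := fun n hn => by
    obtain ⟨k, hk⟩ := hs ⟨n, hn⟩
    exact ⟨k, by simpa using (congrArg Subtype.val hk).symm⟩
  obtain ⟨k, hk⟩ := hgen _ (hN.conj_mem s s.2 t)
  have hconj : ∀ j : ℕ, t ^ j * s * (t ^ j)⁻¹ = (s : G) ^ (k ^ j) := by
    intro j
    induction j with
    | zero => simp
    | succ j ih =>
      have : t ^ (j + 1) * s * (t ^ (j + 1))⁻¹ = t * (t ^ j * s * (t ^ j)⁻¹) * t⁻¹ := by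
        rw [pow_succ']; group
      rw [this, ih, ← conj_zpow, hk, ← zpow_mul, pow_succ']
  have heq : ∀ i j : ℤ, (i : ZMod 7) = j → (s : G) ^ i = (s : G) ^ j := fun i j h => by
    rw [zpow_eq_zpow_iff_modEq, hord]
    exact_mod_cast (ZMod.intCast_eq_intCast_iff i j 7).1 h
  have hpow : (k : ZMod 7) ^ Nat.card G = 1 := by
    have h := hconj (Nat.card G)
    rw [pow_card_eq_one', one_mul, inv_one, mul_one] at h
    have h' : (s : G) ^ (1 : ℤ) = (s : G) ^ (k ^ Nat.card G) := by rw [zpow_one]; exact h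
    rw [zpow_eq_zpow_iff_modEq, hord] at h'
    have := (ZMod.intCast_eq_intCast_iff 1 (k ^ Nat.card G) 7).2 (by exact_mod_cast h')
    rw [Int.cast_pow, Int.cast_one] at this
    exact this.symm
  have hk0 : (k : ZMod 7) ≠ 0 := by
    intro h
    rw [h, zero_pow Nat.card_pos.ne'] at hpow
    exact zero_ne_one hpow
  have h6 : orderOf (k : ZMod 7) ∣ 2 * 3 := by
    rw [orderOf_dvd_iff_pow_eq_one]
    exact ZMod.pow_card_sub_one_eq_one hk0
  have h2 : (k : ZMod 7) ^ 2 = 1 := by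
    rw [← orderOf_dvd_iff_pow_eq_one]
    refine Nat.Coprime.dvd_of_dvd_mul_right ?_ h6
    rw [Nat.coprime_comm, Nat.Prime.coprime_iff_not_dvd Nat.prime_three]
    exact fun h => hG (h.trans (orderOf_dvd_iff_pow_eq_one.2 hpow))
  rcases mul_self_eq_one_iff.1 ((sq _).symm.trans h2) with h | h
  · left
    intro n hn
    obtain ⟨i, rfl⟩ := hgen n hn
    rw [← conj_zpow, hk, heq k 1 (by simpa using h), zpow_one]
  · right
    intro n hn
    obtain ⟨i, rfl⟩ := hgen n hn
    rw [← conj_zpow, hk, heq k (-1) (by simpa using h), zpow_neg_one, inv_zpow]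

/-- A group of order seven of additive maps, regular on the nonzero vectors, is not inverted by an
additive map fixing a nonzero vector. -/
lemma false_of_inverting {N : Subgroup G} (h7 : Nat.card N = 7) (h2 : ∀ x : V, 2 • x = 0) {u : V}
    {t : G} (htrans : ∀ w : V, w ≠ 0 → ∃ n ∈ N, n • u = w)
    (hfree : ∀ m ∈ N, ∀ n ∈ N, m • u = n • u → m = n)
    (hNadd : ∀ n ∈ N, ∀ x y : V, n • (x + y) = n • x + n • y)
    (htadd : ∀ x y : V, t • (x + y) = t • x + t • y) (htu : t • u = u)
    (hinv : ∀ n ∈ N, t * n * t⁻¹ = n⁻¹) : False := by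
  have hpow : ∀ n ∈ N, n ^ 7 = 1 := fun n hn => by
    have : (⟨n, hn⟩ : N) ^ 7 = 1 := by rw [← h7]; exact pow_card_eq_one'
    exact congrArg Subtype.val this
  have htn : ∀ n ∈ N, t • n • u = n⁻¹ • u := fun n hn => by
    rw [← hinv n hn, mul_smul, mul_smul, inv_smul_eq_iff.2 htu.symm]
  have hsq : ∀ m ∈ N, ∀ n ∈ N, u + m • u = n • u → n * n = m := by
    intro m hm n hn h
    have h1 : u + m⁻¹ • u = n⁻¹ • u := by
      rw [← htn m hm, ← htn n hn, ← h, htadd, htu]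
    have h3 : u + m • u = (m * n⁻¹) • u := by
      rw [mul_smul, ← h1, hNadd m hm, smul_inv_smul, add_comm]
    have := hfree _ hn _ (mul_mem hm (inv_mem hn)) (h.symm.trans h3)
    exact mul_eq_of_eq_mul_inv this
  have hxx : ∀ x : V, x + x = 0 := fun x => by rw [← two_nsmul]; exact h2 x
  have hadd : ∀ m ∈ N, m ≠ 1 → ∃ n ∈ N, u + m • u = n • u := by
    intro m hm hm1
    have hne : u + m • u ≠ 0 := fun h => hm1 <| hfree m hm 1 (one_mem _) <| by
      rw [one_smul]
      exact add_left_cancel (h.trans (hxx u).symm)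
    obtain ⟨n, hn, h⟩ := htrans _ hne
    exact ⟨n, hn, h.symm⟩
  have : Finite N := Nat.finite_of_card_ne_zero (by omega)
  have hnt : Nontrivial N := Finite.one_lt_card_iff_nontrivial.1 (by omega)
  obtain ⟨⟨s, hs⟩, hs1⟩ := exists_ne (1 : N)
  replace hs1 : s ≠ 1 := fun h => hs1 (Subtype.ext h)
  obtain ⟨r, hr, hsr⟩ := hadd s hs hs1
  have hrs := hsq s hs r hr hsr
  have hur : u + r • u = s • u := by rw [← hsr, ← add_assoc, hxx, zero_add]
  have hsr' := hsq r hr s hs hur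
  refine hs1 ?_
  have h3 : s ^ 3 = 1 := by
    have : s ^ 3 * s = s := by
      calc s ^ 3 * s = (s * s) * (s * s) := by simp only [pow_succ, pow_zero, one_mul, mul_assoc]
        _ = s := by rw [hsr', hrs]
    simpa using this
  calc s = s ^ 7 * (s ^ 3)⁻¹ * (s ^ 3)⁻¹ := by group
    _ = 1 := by rw [hpow s hs, h3]; simp

/-- A solvable affine primitive group of order prime to `3` on eight points preserves some
`3`-coloring only trivially. -/
lemma exists_coloring_of_card_eq_eight [Finite G] [Group.IsSolvable G] [FaithfulSMul G V]
    [IsPreprimitive G V] (h8 : Nat.card V = 8) (h2 : ∀ x : V, 2 • x = 0)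
    (hG : ¬ 3 ∣ Nat.card G) (haff : ∀ g : G, IsAffine fun x : V => g • x)
    (htr : ∀ v : V, ∃ g : G, ∀ x : V, g • x = v + x) :
    ∃ f : V → ZMod 3, ∀ g : G, (∀ x, f (g • x) = f x) → ∀ x : V, g • x = x := by
  classical
  have : Finite V := Nat.finite_of_card_ne_zero (by omega)
  let S := stabilizer G (0 : V)
  let X := SubMulAction.ofStabilizer G (0 : V)
  have hXmem : ∀ x : V, x ∈ X ↔ x ≠ 0 := fun x => SubMulAction.mem_ofStabilizer_iff G 0
  have hcardX : Nat.card X = 7 := by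
    rw [SubMulAction.nat_card_ofStabilizer_eq, h8]
  have : IsPretransitive S X := ⟨by
    rintro ⟨x, hx⟩ ⟨y, hy⟩
    obtain ⟨g, hg, hxy⟩ := exists_stabilizer_smul_eq_of_card_eq_eight h8 h2 hG haff htr
      ((hXmem x).1 hx) ((hXmem y).1 hy)
    exact ⟨⟨g, hg⟩, Subtype.ext hxy⟩⟩
  have : IsPreprimitive S X := IsPreprimitive.of_prime_card (by rw [hcardX]; norm_num)
  have : Nontrivial X := Finite.one_lt_card_iff_nontrivial.1 (by omega)
  have : FaithfulSMul S X := ⟨by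
    intro g h hgh
    refine Subtype.ext (FaithfulSMul.eq_of_smul_eq_smul (α := V) fun x => ?_)
    by_cases hx : x = 0
    · rw [hx, mem_stabilizer_iff.1 g.2, mem_stabilizer_iff.1 h.2]
    · exact congrArg Subtype.val (hgh ⟨x, (hXmem x).2 hx⟩)⟩
  obtain ⟨N, q, hN, -, -, -, htrans, hfree⟩ :=
    exists_regular_normal_elementary_abelian (G := S) (Ω := X)
  obtain ⟨⟨u, huX⟩⟩ := (inferInstance : Nonempty X)
  have hu := (hXmem u).1 huX
  have hfree' : ∀ m ∈ N, ∀ n ∈ N, m • u = n • u → m = n := by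
    intro m hm n hn h
    have := hfree (n⁻¹ * m) (mul_mem (inv_mem hn) hm) ⟨u, huX⟩
      (Subtype.ext (show (n⁻¹ * m) • u = u by rw [mul_smul, h, inv_smul_smul]))
    exact (inv_mul_eq_one.1 this).symm
  have htrans' : ∀ w : V, w ≠ 0 → ∃ n ∈ N, n • u = w := by
    intro w hw
    obtain ⟨n, hn⟩ := exists_smul_eq N (⟨u, huX⟩ : X) ⟨w, (hXmem w).2 hw⟩
    exact ⟨n, n.2, congrArg Subtype.val hn⟩
  have h7 : Nat.card N = 7 := by
    rw [← hcardX]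
    refine Nat.card_congr (Equiv.ofBijective (fun n : N => n • (⟨u, huX⟩ : X)) ⟨?_, ?_⟩)
    · intro m n h
      exact Subtype.ext (hfree' m m.2 n n.2 (congrArg Subtype.val h))
    · exact fun x => exists_smul_eq N _ x
  have hSadd : ∀ (n : S) (x y : V), n • (x + y) = n • x + n • y := fun n x y =>
    smul_add_of_mem_stabilizer haff n.2 x y
  have hS3 : ¬ 3 ∣ Nat.card S := fun h => hG (h.trans (Subgroup.card_subgroup_dvd_card S))
  refine ⟨fun x => if x = 0 then 0 else if x = u then 1 else 2, fun g hg => ?_⟩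
  have h12 : (2 : ZMod 3) ≠ 0 ∧ (2 : ZMod 3) ≠ 1 := by decide
  have hg0 : g • (0 : V) = 0 := by
    have := hg 0
    by_contra hne
    by_cases hx : g • (0 : V) = u <;> simp [hne, hx, hu, h12.1] at this
  have hgu : g • u = u := by
    have := hg u
    by_contra hne
    by_cases hx : g • u = 0 <;> simp [hne, hx, hu, h12.2] at this
  let t : S := ⟨g, hg0⟩
  rcases conj_eq_self_or_inv_of_card_eq_seven hS3 hN h7 t with hc | hc
  · intro x
    by_cases hx : x = 0
    · rw [hx, hg0]
    · obtain ⟨n, hn, rfl⟩ := htrans' x hx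
      change t • n • u = n • u
      nth_rewrite 2 [← hc n hn]
      rw [mul_smul, mul_smul, inv_smul_eq_iff.2 (show u = t • u from hgu.symm)]
  · exact (false_of_inverting h7 h2 htrans' hfree' (fun n _ => hSadd n) (hSadd t) hgu hc).elim

end SmallDegree

/-- Some coloring of `Ω` with `p` colors is preserved only by elements acting trivially. -/
def HasRigidColoring (G Ω : Type*) [Group G] [MulAction G Ω] (p : ℕ) : Prop :=
  ∃ f : Ω → ZMod p, ∀ g : G, (∀ x, f (g • x) = f x) → ∀ x : Ω, g • x = x

section RigidColoring

open MulAction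
open scoped Pointwise

variable {G Ω : Type*} [Group G] [MulAction G Ω] {p : ℕ}

lemma hasRigidColoring_of_faithful_isPreprimitive [Finite G] [Finite Ω] [Group.IsSolvable G]
    [FaithfulSMul G Ω] [IsPreprimitive G Ω] (hp : p.Prime) (hpG : ¬ p ∣ Nat.card G) :
    HasRigidColoring G Ω p := by
  rcases subsingleton_or_nontrivial Ω with h | h
  · exact ⟨fun _ => 0, fun g _ x => Subsingleton.elim _ _⟩
  obtain ⟨_, q, hq, hqG, hexp, haff, htr⟩ := exists_addCommGroup_isAffine (G := G) (Ω := Ω)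
  have hpq : p ≠ q := fun h => hpG (h ▸ hqG)
  rcases exists_isRigidOn_top_or_card hp hq hpq hexp with ⟨f, hf⟩ | ⟨rfl, rfl, h4 | h8⟩
  · refine ⟨f, fun g hg x => ?_⟩
    refine hf (toPermHom G Ω g) (haff g) ⟨Nat.card G, hpG, ?_⟩ (fun _ _ => AddSubgroup.mem_top _)
      (fun y _ => hg y) x (AddSubgroup.mem_top x)
    rw [← map_pow, pow_card_eq_one', map_one]
  · exact exists_coloring_of_card_eq_four h4 hpG
  · exact exists_coloring_of_card_eq_eight h8 hexp hpG haff htr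

lemma hasRigidColoring_of_isPreprimitive [Finite G] [Finite Ω] [Group.IsSolvable G]
    [IsPreprimitive G Ω] (hp : p.Prime) (hpG : ¬ p ∣ Nat.card G) : HasRigidColoring G Ω p := by
  let φ := (toPermHom G Ω).rangeRestrict
  have hφ : Function.Surjective φ := (toPermHom G Ω).rangeRestrict_surjective
  have : Group.IsSolvable (toPermHom G Ω).range := Group.isSolvable_of_surjective hφ
  let i : Ω →ₑ[φ] Ω := { toFun := id, map_smul' := fun _ _ => rfl }
  have : IsPreprimitive (toPermHom G Ω).range Ω :=
    IsPreprimitive.of_surjective (f := i) Function.surjective_id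
  obtain ⟨f, hf⟩ := hasRigidColoring_of_faithful_isPreprimitive (Ω := Ω)
    (G := (toPermHom G Ω).range) hp fun h => hpG (h.trans (Subgroup.card_range_dvd _))
  exact ⟨f, fun g hg x => hf (φ g) hg x⟩

/-- Rigid colorings of two complementary invariant sets combine. -/
lemma hasRigidColoring_of_compl {S T : SubMulAction G Ω} (hST : ∀ x, x ∉ S → x ∈ T)
    (hS : HasRigidColoring G S p) (hT : HasRigidColoring G T p) (hdisj : ∀ x ∈ T, x ∉ S) :
    HasRigidColoring G Ω p := by
  classical
  obtain ⟨c, hc⟩ := hS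
  obtain ⟨d, hd⟩ := hT
  refine ⟨fun x => if h : x ∈ S then c ⟨x, h⟩ else d ⟨x, hST x h⟩, fun g hg x => ?_⟩
  by_cases hx : x ∈ S
  · refine congrArg Subtype.val (hc g (fun y => ?_) ⟨x, hx⟩)
    have := hg y
    dsimp only at this
    rwa [dif_pos y.2, dif_pos (S.smul_mem g y.2)] at this
  · refine congrArg Subtype.val (hd g (fun y => ?_) ⟨x, hST x hx⟩)
    have := hg y
    dsimp only at this
    rwa [dif_neg (hdisj y y.2), dif_neg (hdisj _ (T.smul_mem g y.2))] at this

/-- A coloring of a block, rigid for the setwise stabilizer of the block, and a rigid coloring of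
the set of translates of the block combine to a rigid coloring. -/
lemma hasRigidColoring_of_isBlock [Finite G] [IsPretransitive G Ω] (hp : p.Prime)
    (hpG : ¬ p ∣ Nat.card G) {B : Set Ω} (hB : IsBlock G B) (hne : B.Nonempty)
    {c : Ω → ZMod p} (hc : ∀ h ∈ stabilizer G B, (∀ y ∈ B, c (h • y) = c y) → ∀ y ∈ B, h • y = y)
    (hquot : HasRigidColoring G (G ⧸ stabilizer G B) p) : HasRigidColoring G Ω p := by
  have : Fact p.Prime := ⟨hp⟩
  obtain ⟨d, hd⟩ := hquot
  obtain ⟨b, hb⟩ := hne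
  have hBmem : ∀ h ∈ stabilizer G B, ∀ y ∈ B, h • y ∈ B := fun h hh y hy => by
    rw [mem_stabilizer_iff] at hh
    rw [← hh]
    exact Set.smul_mem_smul_set hy
  have hstab : ∀ h : G, ∀ y ∈ B, h • y ∈ B → h ∈ stabilizer G B := fun h y hy hhy =>
    (isBlock_iff_smul_eq_of_nonempty.1 hB) ⟨h • y, Set.smul_mem_smul_set hy, hhy⟩
  choose k hk using fun x => exists_smul_eq G b x
  let π : Ω → G ⧸ stabilizer G B := fun x => (k x : G ⧸ stabilizer G B)
  have hπB : ∀ (r : G) (y : Ω), y ∈ B → π (r • y) = (r : G ⧸ stabilizer G B) := fun r y hy => by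
    refine (QuotientGroup.eq.2 (hstab _ b hb ?_)).symm
    rwa [mul_smul, hk, inv_smul_smul]
  let r : G ⧸ stabilizer G B → G := Quotient.out
  have hr : ∀ γ, (r γ : G ⧸ stabilizer G B) = γ := fun γ => QuotientGroup.out_eq' γ
  have hmem : ∀ x, (r (π x))⁻¹ • x ∈ B := fun x => by
    have h1 : (r (π x))⁻¹ * k x ∈ stabilizer G B := QuotientGroup.eq.1 (hr (π x))
    have := hBmem _ h1 b hb
    rwa [mul_smul, hk] at this
  refine ⟨fun x => c ((r (π x))⁻¹ • x) + d (π x), fun g hg => ?_⟩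
  have hcocycle : ∀ γ, (r (g • γ))⁻¹ * g * r γ ∈ stabilizer G B ∧ ∀ y ∈ B,
      c (((r (g • γ))⁻¹ * g * r γ) • y) = c y + (d γ - d (g • γ)) := by
    intro γ
    constructor
    · rw [mul_assoc, ← QuotientGroup.eq, hr]
      conv_lhs => rw [← hr γ]
      rfl
    · intro y hy
      have h1 : π (r γ • y) = γ := (hπB _ y hy).trans (hr γ)
      have h2 : π (g • r γ • y) = g • γ := by
        rw [← mul_smul, hπB _ y hy]
        conv_rhs => rw [← hr γ]
        rfl
      have h3 := hg (r γ • y)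
      simp only [h1, h2, inv_smul_smul] at h3
      rw [mul_smul, mul_smul]
      linear_combination h3
  have hδ : ∀ γ, d γ - d (g • γ) = 0 := by
    intro γ
    obtain ⟨h1, h2⟩ := hcocycle γ
    generalize (r (g • γ))⁻¹ * g * r γ = h at h1 h2
    have hiter : ∀ n : ℕ, c (h ^ n • b) = c b + n * (d γ - d (g • γ)) := by
      intro n
      induction n with
      | zero => simp
      | succ n ih =>
        rw [pow_succ', mul_smul, h2 _ (hBmem _ (pow_mem h1 n) b hb), ih]
        push_cast
        ring
    have h3 := hiter (Nat.card G)
    rw [pow_card_eq_one', one_smul, left_eq_add, mul_eq_zero, ZMod.natCast_eq_zero_iff] at h3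
    exact h3.resolve_left hpG
  have hfix : ∀ γ : G ⧸ stabilizer G B, g • γ = γ := hd g fun γ => (sub_eq_zero.1 (hδ γ)).symm
  intro x
  obtain ⟨h1, h2⟩ := hcocycle (π x)
  have h3 := hc _ h1 (fun y hy => by rw [h2 y hy, hδ, add_zero]) _ (hmem x)
  rw [mul_smul, mul_smul, smul_inv_smul, hfix] at h3
  exact smul_left_cancel _ h3

lemma hasRigidColoring_of_isSolvable.{u} {p : ℕ} (hp : p.Prime) (n : ℕ) :
    ∀ (G Ω : Type u) [Group G] [MulAction G Ω] [Finite G] [Finite Ω] [Group.IsSolvable G],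
      ¬ p ∣ Nat.card G → Nat.card Ω = n → HasRigidColoring G Ω p := by
  induction n using Nat.strong_induction_on with
  | _ n ih =>
  intro G Ω _ _ _ _ _ hpG hn
  by_cases htrans : IsPretransitive G Ω
  swap
  · have : ∃ x y : Ω, y ∉ orbit G x := by
      by_contra! h
      exact htrans ⟨fun x y => h x y⟩
    obtain ⟨x, y, hxy⟩ := this
    let S : SubMulAction G Ω :=
      { carrier := orbit G x
        smul_mem' := fun g z hz => mem_orbit_of_mem_orbit g hz }
    let T : SubMulAction G Ω :=
      { carrier := (orbit G x)ᶜ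
        smul_mem' := fun g z hz h => hz (by
          simpa using mem_orbit_of_mem_orbit g⁻¹ h) }
    have hS : Nat.card S < n := hn ▸ Finite.card_subtype_lt (p := (· ∈ orbit G x)) hxy
    have hT : Nat.card T < n := hn ▸ Finite.card_subtype_lt (p := (· ∈ (orbit G x)ᶜ))
      (fun h => h (mem_orbit_self x))
    exact hasRigidColoring_of_compl (S := S) (T := T) (fun _ h => h)
      (ih _ hS G S hpG rfl) (ih _ hT G T hpG rfl) (fun _ h => h)
  by_cases hprim : IsPreprimitive G Ω
  · exact hasRigidColoring_of_isPreprimitive hp hpG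
  have : ∃ B : Set Ω, IsBlock G B ∧ ¬ IsTrivialBlock B := by
    by_contra! h
    exact hprim ⟨fun {B} hB => h B hB⟩
  obtain ⟨B, hB, hBtriv⟩ := this
  rw [IsTrivialBlock, not_or, Set.not_subsingleton_iff] at hBtriv
  obtain ⟨hnontriv, hBuniv⟩ := hBtriv
  obtain ⟨y, hy⟩ := (Set.ne_univ_iff_exists_notMem B).1 hBuniv
  let T : SubMulAction (stabilizer G B) Ω :=
    { carrier := B
      smul_mem' := fun h z hz => by
        have := Set.smul_mem_smul_set (a := (h : G)) hz
        rwa [mem_stabilizer_iff.1 h.2] at this }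
  have hT : Nat.card T < n := hn ▸ Finite.card_subtype_lt (p := (· ∈ B)) hy
  have hquot : Nat.card (G ⧸ stabilizer G B) < n := by
    have h1 := hB.ncard_block_mul_ncard_orbit_eq hnontriv.nonempty
    have h2 := index_stabilizer G B
    rw [Subgroup.index] at h2
    have h3 := (Set.one_lt_ncard (Set.toFinite B)).2 hnontriv
    rw [← h2, hn] at h1
    have h4 : 0 < Nat.card (G ⧸ stabilizer G B) := Nat.card_pos
    nlinarith
  obtain ⟨c, hc⟩ := ih _ hT (stabilizer G B) T
    (fun h => hpG (h.trans (Subgroup.card_subgroup_dvd_card _))) rfl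
  classical
  refine hasRigidColoring_of_isBlock hp hpG hB hnontriv.nonempty
    (c := fun y => if h : y ∈ B then c ⟨y, h⟩ else 0) (fun h hh hcol y hy => ?_)
    (ih _ hquot G _ hpG rfl)
  refine congrArg Subtype.val (hc ⟨h, hh⟩ (fun z => ?_) ⟨y, hy⟩)
  have := hcol z z.2
  rwa [dif_pos (show (z : Ω) ∈ B from z.2),
    dif_pos (show h • (z : Ω) ∈ B from T.smul_mem ⟨h, hh⟩ z.2)] at this

end RigidColoring

/-- **Halasi–Podoski, Theorem 2.4.**
Let `G ≤ Sym(Ω)` be a solvable permutation group on a finite set `Ω` and `p` a prime not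
dividing `|G|`.  Then there is a `G`-regular partition of `Ω` into at most `p` parts.
(The partition is encoded by a coloring `f : Ω → Fin p`; its parts are the nonempty fibers of
`f`, and `G`-regularity says that only the identity of `G` stabilizes every fiber setwise.) -/
theorem solvable_permutation_group_regular_partition_into_p_parts
    (Ω : Type*) [Finite Ω]
    (G : Subgroup (Equiv.Perm Ω)) (hsolv : IsSolvable G)
    (p : ℕ) (hp : p.Prime) (hpG : ¬ (p ∣ Nat.card G)) :
    ∃ f : Ω → Fin p, ∀ g ∈ G, (∀ x : Ω, f (g x) = f x) → g = 1 := by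
  have : Group.IsSolvable G := hsolv
  obtain ⟨f, hf⟩ := hasRigidColoring_of_isSolvable hp _ G Ω hpG rfl
  obtain _ | n := p
  · exact absurd hp Nat.not_prime_zero
  exact ⟨f, fun g hg h => Equiv.ext fun x => hf ⟨g, hg⟩ h x⟩
end

section
/- Let G be a solvable permutation group of degree n (G ≤ Sym({1,…,n})), and let p be a prime not dividing the order of G. Consider the action of G on F_p^n permuting coordinates. Then there exists a vector (a_1, a_2, …, a_n) ∈ F_p^n such that the only element of G fixing this vector is the identity. -/
open Equiv MulAction

/-- Permutations of an abelian group that preserve parallelograms; for an elementary abelian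
`q`-group these are exactly the affine bijections over `𝔽_q`. -/
def IsAffinePerm {V : Type*} [AddCommGroup V] (g : Perm V) : Prop :=
  ∀ x y z, g (x + y - z) = g x + g y - g z

/-- `V` has a colouring by `p` colours preserved by no nontrivial affine permutation of order
prime to `p`. -/
def AffineRigid (p : ℕ) (V : Type*) [AddCommGroup V] : Prop :=
  ∃ f : V → ZMod p, ∀ g : Perm V, IsAffinePerm g → (∀ x, f (g x) = f x) →
    (∃ m, p.Coprime m ∧ g ^ m = 1) → g = 1

theorem AffineRigid.of_addEquiv {p : ℕ} {V W : Type*} [AddCommGroup V] [AddCommGroup W]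
    (φ : V ≃+ W) (h : AffineRigid p V) : AffineRigid p W := by
  obtain ⟨f, hf⟩ := h
  refine ⟨f ∘ φ.symm, fun g hg hfg ⟨m, hm, hgm⟩ => ?_⟩
  let ψ := φ.toEquiv.symm.permCongrHom
  have hψ : ∀ x, ψ g x = φ.symm (g (φ x)) := fun x => rfl
  have key : ψ g = 1 := by
    refine hf (ψ g) (fun x y z => ?_) (fun x => ?_) ⟨m, hm, ?_⟩
    · simp only [hψ, map_add, map_sub, hg (φ x)]
    · rw [hψ]
      simpa using hfg (φ x)
    · rw [← map_pow, hgm, map_one]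
  exact ψ.injective (key.trans (map_one ψ).symm)

theorem IsAffinePerm.map_add {V : Type*} [AddCommGroup V] {g : Perm V} (hg : IsAffinePerm g)
    (h0 : g 0 = 0) (x y : V) : g (x + y) = g x + g y := by
  simpa [h0] using hg x y 0

theorem IsAffinePerm.map_nsmul {V : Type*} [AddCommGroup V] {g : Perm V} (hg : IsAffinePerm g)
    (h0 : g 0 = 0) (k : ℕ) (x : V) : g (k • x) = k • g x := by
  induction k with
  | zero => simpa using h0
  | succ k ih => rw [succ_nsmul, succ_nsmul, hg.map_add h0, ih]

/-- A nonzero homomorphism to a group of prime order has small fibres. -/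
theorem card_fiber_mul_le {V : Type*} [AddCommGroup V] [Finite V] {q : ℕ} [Fact q.Prime]
    (ψ : V →+ ZMod q) {w : V} (hw : ψ w ≠ 0) (c : ZMod q) :
    Nat.card {v // ψ v = c} * q ≤ Nat.card V := by
  have hcard : Nat.card ({v // ψ v = c} × ZMod q) = Nat.card {v // ψ v = c} * q := by
    rw [Nat.card_prod, Nat.card_zmod]
  rw [← hcard]
  refine Nat.card_le_card_of_injective (fun x => x.1.1 + x.2.val • w) ?_
  rintro ⟨⟨v, hv⟩, i⟩ ⟨⟨v', hv'⟩, i'⟩ h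
  simp only at h
  have hi := congrArg ψ h
  simp only [_root_.map_add, _root_.map_nsmul, hv, hv', add_right_inj, nsmul_eq_mul,
    ZMod.natCast_val, ZMod.cast_id', id, mul_eq_mul_right_iff, hw, or_false] at hi
  subst hi
  simpa using h

/-- Every colouring of a finite set by `p` colours has a colour used at most `|V| / p` times. -/
theorem exists_card_fiber_mul_le {V : Type*} [Finite V] {p : ℕ} [NeZero p] (f : V → ZMod p) :
    ∃ c, Nat.card {v // f v = c} * p ≤ Nat.card V := by
  by_contra! h
  have h1 : Nat.card V = ∑ c, Nat.card {v // f v = c} := by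
    rw [← Nat.card_congr (Equiv.sigmaFiberEquiv f), Nat.card_sigma]
  have h2 : ∑ c : ZMod p, Nat.card V < ∑ c : ZMod p, Nat.card {v // f v = c} * p :=
    Finset.sum_lt_sum_of_nonempty ⟨0, Finset.mem_univ _⟩ fun c _ => h c
  rw [← Finset.sum_mul, ← h1, Finset.sum_const, Finset.card_univ, ZMod.card, smul_eq_mul,
    mul_comm] at h2
  exact lt_irrefl _ h2

/-- The inductive step: put a rigid colouring with few points of colour `0` on a hyperplane, and
use colour `0` off the hyperplane except at one point. -/
theorem AffineRigid.prod_zmod {p q : ℕ} [Fact p.Prime] [Fact q.Prime] {V : Type*} [AddCommGroup V]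
    [Finite V] (h : AffineRigid p V) (hV : p * q + (p + q) * Nat.card V < p * q * Nat.card V) :
    AffineRigid p (V × ZMod q) := by
  obtain ⟨f₀, hf₀⟩ := h
  obtain ⟨c₀, hc₀⟩ := exists_card_fiber_mul_le f₀
  set f : V → ZMod p := fun v => f₀ v - c₀ with hfdef
  have hz : Nat.card {v // f v = 0} * p ≤ Nat.card V := by
    simpa only [hfdef, sub_eq_zero] using hc₀
  classical
  let F : V × ZMod q → ZMod p := fun x => if x.2 = 0 then f x.1 else if x = (0, 1) then 1 else 0
  have hF0 : ∀ v, F (v, 0) = f v := fun v => by simp [F]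
  have hF1 : F (0, 1) = 1 := by simp [F]
  have hFne : ∀ x, F x ≠ 0 → x.2 ≠ 0 → x = (0, 1) := by
    intro x hx hx2
    by_contra hne
    exact hx (by simp [F, hx2, hne])
  refine ⟨F, fun g hg hFg ⟨m, hm, hgm⟩ => ?_⟩
  have hgW : ∀ v, (g (v, 0)).2 = 0 := by
    let ψ : V →+ ZMod q := AddMonoidHom.mk' (fun v => (g (v, 0)).2 - (g 0).2) (fun a b => by
      have := congrArg Prod.snd (hg (a, 0) (b, 0) 0)
      simp only [Prod.mk_add_mk, add_zero, sub_zero, Prod.snd_add, Prod.snd_sub] at this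
      rw [this]; ring)
    have hψ : ∀ v, ψ v = (g (v, 0)).2 - (g 0).2 := fun v => rfl
    by_contra! hne
    obtain ⟨u, hu⟩ := hne
    have hsmall : Nat.card {v // (g (v, 0)).2 = 0} * q ≤ Nat.card V := by
      by_cases hw : ∃ w, ψ w ≠ 0
      · obtain ⟨w, hw⟩ := hw
        have := card_fiber_mul_le ψ hw (-(g 0).2)
        simpa only [hψ, sub_eq_iff_eq_add, neg_add_cancel] using this
      · push Not at hw
        have : IsEmpty {v // (g (v, 0)).2 = 0} := by
          refine ⟨fun ⟨v, hv⟩ => hu ?_⟩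
          have h1 := hw v
          have h2 := hw u
          rw [hψ, sub_eq_zero] at h1 h2
          rw [h2, ← h1, hv]
        simp
    have hcover :
        Nat.card V ≤ Nat.card {v // f v = 0} + (Nat.card {v // (g (v, 0)).2 = 0} + 1) := by
      have hsub : (Set.univ : Set V) ⊆
          {v | f v = 0} ∪ ({v | (g (v, 0)).2 = 0} ∪ {v | g (v, 0) = (0, 1)}) := by
        intro v _
        by_cases h1 : f v = 0
        · exact Or.inl h1
        by_cases h2 : (g (v, 0)).2 = 0
        · exact Or.inr (Or.inl h2)
        refine Or.inr (Or.inr (hFne _ ?_ h2))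
        rwa [hFg, hF0]
      have hone : {v | g (v, 0) = (0, 1)}.ncard ≤ 1 := by
        refine (Set.ncard_le_one).mpr fun a ha b hb => ?_
        have : g (a, 0) = g (b, 0) := Eq.trans ha (Eq.symm hb)
        simpa using this
      have := (Set.ncard_le_ncard hsub).trans ((Set.ncard_union_le _ _).trans
        (Nat.add_le_add_left ((Set.ncard_union_le _ _).trans (Nat.add_le_add_left hone _)) _))
      rwa [Set.ncard_univ] at this
    have := Nat.mul_le_mul_left (p * q) hcover
    nlinarith
  -- restrict `g` to the hyperplane
  let e : V → V := fun v => (g (v, 0)).1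
  have he : ∀ v, g (v, 0) = (e v, 0) := fun v => Prod.ext rfl (hgW v)
  have hinj : Function.Injective e := fun a b hab => by
    have : g (a, 0) = g (b, 0) := by rw [he, he, hab]
    simpa using this
  let h : Perm V := Equiv.ofBijective e (Finite.injective_iff_bijective.mp hinj)
  have hh : ∀ v, g (v, 0) = (h v, 0) := he
  have hpow : ∀ k : ℕ, ∀ v, (g ^ k) (v, 0) = ((h ^ k) v, 0) := by
    intro k
    induction k with
    | zero => intro v; rfl
    | succ k ih =>
      intro v
      rw [pow_succ', Perm.mul_apply, ih, hh, pow_succ', Perm.mul_apply]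
  have h1 : h = 1 := by
    refine hf₀ h (fun x y z => ?_) (fun x => ?_) ⟨m, hm, ?_⟩
    · have := hg (x, 0) (y, 0) (z, 0)
      simpa [hh] using this
    · have := hFg (x, 0)
      rw [hh, hF0, hF0] at this
      simpa [hfdef] using this
    · ext v
      have := hpow m v
      rw [hgm] at this
      exact (congrArg Prod.fst this).symm
  have hfix : ∀ v, g (v, 0) = (v, 0) := fun v => by rw [hh, h1]; rfl
  have h01 : g (0, 1) = (0, 1) := by
    refine hFne _ ?_ fun h2 => ?_
    · rw [hFg, hF1]; exact one_ne_zero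
    · have h3 : g (0, 1) = g ((g (0, 1)).1, 0) := by
        rw [hfix]; exact Prod.ext rfl h2
      have := congrArg Prod.snd (g.injective h3)
      exact one_ne_zero this
  have h0 : g 0 = 0 := hfix 0
  refine Equiv.ext fun ⟨v, t⟩ => ?_
  have hdec : ((v, t) : V × ZMod q) = (v, 0) + t.val • (0, 1) := by
    simp
  rw [hdec, hg.map_add h0, hg.map_nsmul h0, hfix, h01]
  rfl

theorem affineRigid_zmod {p q : ℕ} (hp : p.Prime) [Fact q.Prime] : AffineRigid p (ZMod q) := by
  classical
  suffices ∃ f : ZMod q → ZMod p, ∀ g : Perm (ZMod q), (∀ x, f (g x) = f x) →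
      (∃ m, p.Coprime m ∧ g ^ m = 1) → g 0 = 0 ∧ g 1 = 1 by
    obtain ⟨f, hf⟩ := this
    refine ⟨f, fun g hg hfg hm => Equiv.ext fun t => ?_⟩
    obtain ⟨h0, h1⟩ := hf g hfg hm
    have ht : t = t.val • 1 := by simp
    rw [ht, hg.map_nsmul h0, h1]
    rfl
  rcases hp.eq_two_or_odd' with rfl | hodd
  · refine ⟨fun x => if x = 0 ∨ x = 1 then 1 else 0, fun g hg ⟨m, hm, hgm⟩ => ?_⟩
    have hmem : ∀ x, x = 0 ∨ x = 1 → g x = 0 ∨ g x = 1 := by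
      intro x hx
      by_contra hne
      simpa [hx, hne] using hg x
    have h0 : g 0 = 0 := by
      refine (hmem 0 (Or.inl rfl)).resolve_right fun h0 => ?_
      have h1 : g 1 = 0 := (hmem 1 (Or.inr rfl)).resolve_right fun h1 =>
        zero_ne_one (g.injective (h0.trans h1.symm))
      obtain ⟨k, rfl⟩ := (Nat.coprime_two_left.mp hm)
      have h2 : ∀ k : ℕ, (g ^ (2 * k)) 0 = 0 := by
        intro k
        induction k with
        | zero => rfl
        | succ k ih =>
          rw [mul_add, mul_one, pow_add, pow_two, Perm.mul_apply, Perm.mul_apply, h0, h1, ih]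
      have h3 : (g ^ (2 * k + 1)) 0 = 1 := by
        rw [pow_succ', Perm.mul_apply, h2, h0]
      rw [hgm] at h3
      exact zero_ne_one h3
    exact ⟨h0, (hmem 1 (Or.inr rfl)).resolve_left fun h1 =>
        zero_ne_one (g.injective (h0.trans h1.symm))⟩
  · have : Fact (2 < p) := ⟨by
      have := hp.two_le
      rcases hodd with ⟨k, rfl⟩
      omega⟩
    have : Fact p.Prime := ⟨hp⟩
    have h12 : (1 : ZMod p) ≠ 2 := by
      intro h
      have : (1 : ZMod p) = 0 := by linear_combination -h
      exact one_ne_zero this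
    have h2 : (2 : ZMod p) ≠ 0 := by
      intro h
      exact ZMod.neg_one_ne_one (n := p) (by linear_combination -h)
    refine ⟨fun x => if x = 0 then 1 else if x = 1 then 2 else 0, fun g hg _ => ⟨?_, ?_⟩⟩
    · have := hg 0
      by_contra hne
      by_cases h1 : g 0 = 1 <;> simp [hne, h1, h12.symm] at this
    · have := hg 1
      by_contra hne
      by_cases h1 : g 1 = 0 <;> simp [hne, h1, h12, h2.symm] at this

/-- A parallelogram in `𝔽₃²` is rigid for permutations of odd order. -/
theorem affineRigid_two_zmod_three : AffineRigid 2 (ZMod 3 × ZMod 3) := by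
  let f : ZMod 3 × ZMod 3 → ZMod 2 := fun x => if x.1 = 2 ∨ x.2 = 2 then 0 else 1
  have key : ∀ a : ZMod 3 × ZMod 3, f a = 1 → ∀ b, f b = 1 → ∀ c, f c = 1 → f (b + c - a) = 1 →
      let G : ZMod 3 × ZMod 3 → ZMod 3 × ZMod 3 :=
        fun x => a + x.1.val • (b - a) + x.2.val • (c - a)
      b ≠ a → c ≠ a → b ≠ c → ∀ x, G (G (G (G x))) = x := by
    decide
  refine ⟨f, fun g hg hfg ⟨m, hm, hgm⟩ => ?_⟩
  have hG : ∀ x, g x = g (0, 0) + x.1.val • (g (1, 0) - g (0, 0)) +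
      x.2.val • (g (0, 1) - g (0, 0)) := by
    let h : Perm (ZMod 3 × ZMod 3) := g.trans (Equiv.subRight (g 0))
    have hh : ∀ x, h x = g x - g 0 := fun x => rfl
    have haff : IsAffinePerm h := fun x y z => by
      rw [hh, hh, hh, hh, hg]; abel
    have h0 : h 0 = 0 := by rw [hh, sub_self]
    rintro ⟨x, y⟩
    have hdec : ((x, y) : ZMod 3 × ZMod 3) = x.val • (1, 0) + y.val • (0, 1) := by simp
    have := haff.map_add h0 (x.val • (1, 0)) (y.val • (0, 1))
    rw [haff.map_nsmul h0, haff.map_nsmul h0, ← hdec, hh, hh, hh, sub_eq_iff_eq_add] at this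
    rw [this, ← Prod.zero_eq_mk]
    abel
  have hne : ∀ x y, x ≠ y → g x ≠ g y := fun x y h => g.injective.ne h
  have h4 : g ^ 4 = 1 := by
    refine Equiv.ext fun x => ?_
    have := key (g (0, 0)) (by rw [hfg]; decide) (g (1, 0)) (by rw [hfg]; decide) (g (0, 1))
      (by rw [hfg]; decide) (by rw [← hg, hfg]; decide) (hne _ _ (by decide))
      (hne _ _ (by decide)) (hne _ _ (by decide)) x
    simp only [← hG] at this
    exact this
  have : Nat.Coprime 4 m := Nat.Coprime.pow_left 2 hm
  have h1 := pow_gcd_eq_one.mpr ⟨h4, hgm⟩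
  rwa [this.gcd_eq_one, pow_one] at h1

theorem affineRigid_five_le_zmod_two {p : ℕ} (hp : 5 ≤ p) : AffineRigid p (ZMod 2 × ZMod 2) := by
  have : NeZero p := ⟨by omega⟩
  have hcard : Fintype.card (ZMod 2 × ZMod 2) ≤ Fintype.card (ZMod p) := by
    simp [ZMod.card]; omega
  obtain ⟨f⟩ := Function.Embedding.nonempty_of_card_le hcard
  exact ⟨f, fun g _ hg _ => Equiv.ext fun x => f.injective (hg x)⟩

/-- A colouring of `𝔽₂⁴` by three colours without affine symmetries. -/
def rigidColoring (x : (ZMod 2 × ZMod 2) × (ZMod 2 × ZMod 2)) : ZMod 3 :=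
  ![1, 1, 1, 0, 2, 0, 1, 2, 2, 2, 2, 0, 2, 0, 0, 0] (Fin.ofNat 16
    (x.1.1.val + 2 * x.1.2.val + 4 * x.2.1.val + 8 * x.2.2.val))

set_option synthInstance.maxSize 100000 in
set_option synthInstance.maxHeartbeats 4000000 in
theorem affineRigid_three_zmod_two :
    AffineRigid 3 ((ZMod 2 × ZMod 2) × (ZMod 2 × ZMod 2)) := by
  let f := rigidColoring
  have key : ∀ a, f a = 1 → ∀ b, f b = 1 ∧ b ≠ a → ∀ c, f c = 1 ∧ c ≠ a ∧ c ≠ b ∧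
      f (b + c - a) = 0 → ∀ d, f d = 2 ∧ f (b + d - a) = 0 ∧ f (c + d - a) = 1 ∧
      f (b + (c + d - a) - a) = 2 → ∀ e, f e = 2 ∧ f (b + e - a) = 2 ∧ f (c + e - a) = 2 ∧
      f (b + (c + e - a) - a) = 0 ∧ f (d + e - a) = 2 ∧ f (b + (d + e - a) - a) = 0 ∧
      f (c + (d + e - a) - a) = 0 ∧ f (b + (c + (d + e - a) - a) - a) = 0 →
      a = 0 ∧ b = ((1, 0), (0, 0)) ∧ c = ((0, 1), (0, 0)) ∧ d = ((0, 0), (1, 0)) ∧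
        e = ((0, 0), (0, 1)) := by
    decide
  refine ⟨f, fun g hg hfg _ => ?_⟩
  have hg' : ∀ x y z, g x + g y - g z = g (x + y - z) := fun x y z => (hg x y z).symm
  have hne : ∀ x y, x ≠ y → g x ≠ g y := fun x y h => g.injective.ne h
  obtain ⟨h0, h1, h2, h3, h4⟩ := key (g 0) (by rw [hfg]; decide)
    (g ((1, 0), (0, 0))) ⟨by rw [hfg]; decide, hne _ _ (by decide)⟩
    (g ((0, 1), (0, 0))) ⟨by rw [hfg]; decide, hne _ _ (by decide), hne _ _ (by decide),
      by simp only [hg', hfg]; decide⟩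
    (g ((0, 0), (1, 0))) (by simp only [hg', hfg]; decide)
    (g ((0, 0), (0, 1))) (by simp only [hg', hfg]; decide)
  refine Equiv.ext fun ⟨⟨x, y⟩, ⟨z, t⟩⟩ => ?_
  have hdec : (((x, y), (z, t)) : (ZMod 2 × ZMod 2) × (ZMod 2 × ZMod 2)) =
      x.val • ((1, 0), (0, 0)) + y.val • ((0, 1), (0, 0)) + z.val • ((0, 0), (1, 0)) +
        t.val • ((0, 0), (0, 1)) := by simp
  rw [hdec]
  simp only [hg.map_add h0, hg.map_nsmul h0, h1, h2, h3, h4]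
  rfl

theorem affineRigid_pi_zmod {p q : ℕ} [Fact p.Prime] [Fact q.Prime] (hpq : p ≠ q) {d : ℕ}
    (hd : 1 ≤ d) (hex : ¬ (p = 3 ∧ q = 2 ∧ (d = 2 ∨ d = 3))) :
    AffineRigid p (Fin d → ZMod q) := by
  have hp : p.Prime := Fact.out
  have hq : q.Prime := Fact.out
  have hp2 := hp.two_le
  have hq2 := hq.two_le
  have hp4 : p ≠ 4 := by rintro rfl; exact absurd hp (by decide)
  have hq4 : q ≠ 4 := by rintro rfl; exact absurd hq (by decide)
  induction d, hd using Nat.le_induction with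
  | base =>
    exact (affineRigid_zmod hp).of_addEquiv
      (LinearEquiv.ofFinrankEq (R := ZMod q) (ZMod q) (Fin 1 → ZMod q) (by simp)).toAddEquiv
  | succ d hd ih =>
    have hstep : (¬ (p = 3 ∧ q = 2 ∧ (d = 2 ∨ d = 3))) →
        p * q + (p + q) * q ^ d < p * q * q ^ d → AffineRigid p (Fin (d + 1) → ZMod q) := by
      intro h1 h2
      have h3 : AffineRigid p ((Fin d → ZMod q) × ZMod q) :=
        (ih h1).prod_zmod (by simpa using h2)
      exact h3.of_addEquiv (LinearEquiv.ofFinrankEq (R := ZMod q) _ _ (by simp)).toAddEquiv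
    have hq1 : q ≤ q ^ d := Nat.le_self_pow (by omega) q
    rcases (show q = 2 ∨ q = 3 ∨ 5 ≤ q by omega) with rfl | rfl | hq5
    · rcases (show p = 3 ∨ 5 ≤ p by omega) with rfl | hp5
      · rcases (show d = 3 ∨ 4 ≤ d by omega) with rfl | hd4
        · exact affineRigid_three_zmod_two.of_addEquiv
            (LinearEquiv.ofFinrankEq (R := ZMod 2) _ _ (by simp)).toAddEquiv
        · have := Nat.pow_le_pow_right (n := 2) (by norm_num) hd4
          exact hstep (by omega) (by omega)
      · rcases (show d = 1 ∨ 2 ≤ d by omega) with rfl | hd2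
        · exact (affineRigid_five_le_zmod_two hp5).of_addEquiv
            (LinearEquiv.ofFinrankEq (R := ZMod 2) _ _ (by simp)).toAddEquiv
        · have := Nat.pow_le_pow_right (n := 2) (by norm_num) hd2
          exact hstep (by omega) (by nlinarith)
    · rcases (show p = 2 ∨ 5 ≤ p by omega) with rfl | hp5
      · rcases (show d = 1 ∨ 2 ≤ d by omega) with rfl | hd2
        · exact affineRigid_two_zmod_three.of_addEquiv
            (LinearEquiv.ofFinrankEq (R := ZMod 3) _ _ (by simp)).toAddEquiv
        · have := Nat.pow_le_pow_right (n := 3) (by norm_num) hd2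
          exact hstep (by omega) (by omega)
      · exact hstep (by omega) (by nlinarith)
    · refine hstep (by omega) ?_
      have h1 : p * q ≤ p * q ^ d := Nat.mul_le_mul_left p hq1
      have h2 : 0 < q ^ d := by positivity
      have h3 : 2 * p + q < p * q := by nlinarith
      nlinarith

open scoped Pointwise IsMulCommutative

/-- Some colouring of `Ω` by `p` colours is preserved only by the elements of `G` that act
trivially on `Ω`. -/
def RigidAction (p : ℕ) (G Ω : Type*) [Group G] [MulAction G Ω] : Prop :=
  ∃ f : Ω → ZMod p, ∀ g : G, (∀ x, f (g • x) = f x) → ∀ x : Ω, g • x = x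

theorem eq_one_of_pow_eq_one_of_not_dvd_card {p : ℕ} (hp : p.Prime) {G : Type*} [Group G]
    (hG : ¬ p ∣ Nat.card G) {g : G} (hg : g ^ p = 1) : g = 1 := by
  have h := pow_gcd_eq_one.mpr ⟨hg, pow_card_eq_one' (x := g)⟩
  rwa [((Nat.Prime.coprime_iff_not_dvd hp).mpr hG).gcd_eq_one, pow_one] at h

theorem smul_eq_of_pow_smul_eq_s9 {p : ℕ} (hp : p.Prime) {G Ω : Type*} [Group G] [MulAction G Ω]
    (hG : ¬ p ∣ Nat.card G) {g : G} {x : Ω} (hg : g ^ p • x = x) : g • x = x := by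
  have h1 : period g x ∣ p := pow_smul_eq_iff_period_dvd.mp hg
  have h2 : period g x ∣ Nat.card G :=
    pow_smul_eq_iff_period_dvd.mp (by rw [pow_card_eq_one', one_smul])
  have h3 := Nat.dvd_gcd h1 h2
  rw [((Nat.Prime.coprime_iff_not_dvd hp).mpr hG).gcd_eq_one] at h3
  simpa using pow_smul_eq_iff_period_dvd.mpr h3

/-- Rigid colourings of an orbit and of its complement combine. -/
theorem RigidAction.of_orbit {p : ℕ} {G Ω : Type*} [Group G] [MulAction G Ω] (a : Ω)
    (C : SubMulAction G Ω) (hC : ∀ x, x ∈ C ↔ x ∉ orbit G a)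
    (h₁ : RigidAction p G (orbit G a)) (h₂ : RigidAction p G C) : RigidAction p G Ω := by
  classical
  obtain ⟨f₁, hf₁⟩ := h₁
  obtain ⟨f₂, hf₂⟩ := h₂
  refine ⟨fun x => if h : x ∈ orbit G a then f₁ ⟨x, h⟩ else f₂ ⟨x, (hC x).mpr h⟩,
    fun g hg x => ?_⟩
  by_cases hx : x ∈ orbit G a
  · refine congrArg Subtype.val (hf₁ g (fun y => ?_) ⟨x, hx⟩)
    have := hg y
    beta_reduce at this
    rwa [dif_pos y.2, dif_pos (show g • (y : Ω) ∈ orbit G a from (g • y).2)] at this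
  · refine congrArg Subtype.val (hf₂ g (fun y => ?_) ⟨x, (hC x).mpr hx⟩)
    have := hg y
    beta_reduce at this
    rwa [dif_neg ((hC _).mp y.2),
      dif_neg (show g • (y : Ω) ∉ orbit G a from (hC _).mp (g • y).2)] at this

/-- Rigid colourings of a block and of the set of its translates combine: since `p` does not
divide `|G|`, the translates `f + c` of a rigid colouring `f` are pairwise inequivalent. -/
theorem RigidAction.of_block {p : ℕ} (hp : p.Prime) {G Ω : Type*} [Group G]
    [MulAction G Ω] [IsPretransitive G Ω] (hG : ¬ p ∣ Nat.card G) {B : Set Ω} (hB : IsBlock G B)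
    (hne : B.Nonempty) (h₁ : RigidAction p (stabilizer G B) B)
    (h₂ : RigidAction p G (orbit G B)) : RigidAction p G Ω := by
  classical
  obtain ⟨b, hb⟩ := hne
  obtain ⟨f₀, hf₀⟩ := h₂
  have h₁' : ∃ f : Ω → ZMod p, ∀ h : G, h • B = B → (∀ x ∈ B, f (h • x) = f x) →
      ∀ x ∈ B, h • x = x := by
    obtain ⟨f, hf⟩ := h₁
    refine ⟨fun x => if hx : x ∈ B then f ⟨x, hx⟩ else 0, fun h hh hfh x hx => ?_⟩
    have hmem : ∀ y ∈ B, h • y ∈ B := fun y hy => hh ▸ Set.smul_mem_smul_set hy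
    refine congrArg Subtype.val (hf ⟨h, hh⟩ (fun y => ?_) ⟨x, hx⟩)
    have := hfh y y.2
    beta_reduce at this
    rwa [dif_pos y.2, dif_pos (hmem y y.2)] at this
  obtain ⟨f, hf⟩ := h₁'
  have hcov : ∀ x : Ω, ∃ β : orbit G B, x ∈ (β : Set Ω) := fun x => by
    obtain ⟨g, rfl⟩ := exists_smul_eq G b x
    exact ⟨⟨g • B, mem_orbit B g⟩, Set.smul_mem_smul_set hb⟩
  choose β hβ using hcov
  have hβu : ∀ x, ∀ γ : orbit G B, x ∈ (γ : Set Ω) → β x = γ := by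
    intro x γ hx
    have hx' := hβ x
    obtain ⟨_, g, rfl⟩ := γ
    generalize β x = δ at hx'
    obtain ⟨_, g', rfl⟩ := δ
    exact Subtype.ext (hB.smul_eq_smul_of_nonempty ⟨x, hx', hx⟩)
  have hrep : ∀ γ : orbit G B, ∃ g : G, g • B = γ := fun γ => γ.2
  choose rep hrep using hrep
  refine ⟨fun x => f ((rep (β x))⁻¹ • x) + f₀ (β x), fun g hg => ?_⟩
  have key : ∀ γ : orbit G B, (∀ x ∈ B, ((rep (g • γ))⁻¹ * g * rep γ) • x = x) ∧
      f₀ (g • γ) = f₀ γ := by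
    intro γ
    set h := (rep (g • γ))⁻¹ * g * rep γ with hdef
    have hhB : h • B = B := by
      rw [hdef, mul_smul, mul_smul, hrep, inv_smul_eq_iff, hrep]
      rfl
    have hstep : ∀ x ∈ B, f (h • x) = f x + (f₀ γ - f₀ (g • γ)) := by
      intro x hx
      have hx1 : rep γ • x ∈ (γ : Set Ω) := hrep γ ▸ Set.smul_mem_smul_set hx
      have hx2 : g • rep γ • x ∈ ((g • γ : orbit G B) : Set Ω) := Set.smul_mem_smul_set hx1
      have := hg (rep γ • x)
      simp only [hβu _ _ hx1, hβu _ _ hx2, inv_smul_smul] at this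
      rw [hdef, mul_smul, mul_smul]
      linear_combination this
    have hmem : ∀ y ∈ B, h • y ∈ B := fun y hy => hhB ▸ Set.smul_mem_smul_set hy
    have hiter : ∀ k : ℕ, ∀ x ∈ B, h ^ k • x ∈ B ∧
        f (h ^ k • x) = f x + k * (f₀ γ - f₀ (g • γ)) := by
      intro k x hx
      induction k with
      | zero => simpa using hx
      | succ k ih =>
        rw [pow_succ', mul_smul]
        refine ⟨hmem _ ih.1, ?_⟩
        rw [hstep _ ih.1, ih.2]
        push_cast
        ring
    have hhx : ∀ x ∈ B, h • x = x := by
      intro x hx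
      refine smul_eq_of_pow_smul_eq_s9 hp hG (hf (h ^ p) ?_ (fun y hy => ?_) x hx)
      · exact (stabilizer G B).pow_mem hhB p
      · simpa using (hiter p y hy).2
    refine ⟨hhx, ?_⟩
    have := hstep b hb
    rw [hhx b hb] at this
    linear_combination this
  have hblock := hf₀ g fun γ => (key γ).2
  intro x
  have h1 : (rep (β x))⁻¹ • x ∈ B := by
    rw [← Set.mem_smul_set_iff_inv_smul_mem, hrep]
    exact hβ x
  have h2 := (key (β x)).1 _ h1
  rw [hblock, mul_smul, mul_smul, smul_inv_smul, smul_left_cancel_iff] at h2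
  exact h2

theorem exists_elementaryAbelian_normal (G : Type*) [Group G] [Finite G] [Group.IsSolvable G]
    [Nontrivial G] : ∃ q : ℕ, q.Prime ∧ ∃ N : Subgroup G, N.Normal ∧ IsMulCommutative N ∧
      N ≠ ⊥ ∧ ∀ x ∈ N, x ^ q = 1 := by
  classical
  obtain ⟨A, hA, hAne, hcomm⟩ : ∃ A : Subgroup G, A.Normal ∧ A ≠ ⊥ ∧
      ∀ x ∈ A, ∀ y ∈ A, x * y = y * x := by
    have hsol : ∃ n, derivedSeries G n = ⊥ := Group.IsSolvable.solvable
    obtain ⟨n, hn⟩ : ∃ n, Nat.find hsol = n + 1 := Nat.exists_eq_succ_of_ne_zero fun h0 => by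
      have := Nat.find_spec hsol
      rw [h0, derivedSeries_zero] at this
      exact top_ne_bot this
    refine ⟨derivedSeries G n, inferInstance, Nat.find_min hsol (by omega), fun x hx y hy => ?_⟩
    have h := Nat.find_spec hsol
    rw [hn, derivedSeries_succ, Subgroup.commutator_eq_bot_iff_le_centralizer] at h
    exact (Subgroup.mem_centralizer_iff.mp (h hx) y hy).symm
  have hcard : Nat.card A ≠ 1 := fun h => hAne (Subgroup.card_eq_one.mp h)
  refine ⟨(Nat.card A).minFac, Nat.minFac_prime hcard, ?_⟩
  set q := (Nat.card A).minFac
  have : Fact q.Prime := ⟨Nat.minFac_prime hcard⟩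
  let N : Subgroup G :=
    { carrier := {x | x ∈ A ∧ x ^ q = 1}
      one_mem' := ⟨A.one_mem, one_pow q⟩
      mul_mem' := fun {x y} hx hy => ⟨A.mul_mem hx.1 hy.1, by
        rw [(show Commute x y from hcomm x hx.1 y hy.1).mul_pow, hx.2, hy.2, one_mul]⟩
      inv_mem' := fun {x} hx => ⟨A.inv_mem hx.1, by rw [inv_pow, hx.2, inv_one]⟩ }
  refine ⟨N, ⟨fun x hx g => ⟨hA.conj_mem x hx.1 g, ?_⟩⟩,
    ⟨⟨fun x y => Subtype.ext (hcomm x x.2.1 y y.2.1)⟩⟩, fun hbot => ?_, fun x hx => hx.2⟩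
  · rw [conj_pow, hx.2, mul_one, mul_inv_cancel]
  · obtain ⟨x, hx⟩ := exists_prime_orderOf_dvd_card' q (Nat.minFac_dvd (Nat.card A))
    have hxN : (x : G) ∈ N := ⟨x.2, by
      rw [← Subgroup.coe_pow, ← hx, pow_orderOf_eq_one, Subgroup.coe_one]⟩
    rw [hbot, Subgroup.mem_bot, OneMemClass.coe_eq_one] at hxN
    rw [hxN, orderOf_one] at hx
    exact (Fact.out : q.Prime).one_lt.ne hx

theorem eq_one_of_smul_eq_of_isMulCommutative {G Ω : Type*} [Group G] [MulAction G Ω]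
    [FaithfulSMul G Ω] {N : Subgroup G} [IsMulCommutative N] [IsPretransitive N Ω] {n : N} {x : Ω}
    (h : n • x = x) : n = 1 := by
  have h1 : ∀ y : Ω, (n : G) • y = (1 : G) • y := fun y => by
    obtain ⟨k, rfl⟩ := exists_smul_eq N x y
    change n • k • x = (1 : G) • k • x
    rw [one_smul, ← mul_smul, mul_comm n k, mul_smul, h]
  exact Subtype.ext (eq_of_smul_eq_smul h1)

theorem bijective_smul_of_isMulCommutative {G Ω : Type*} [Group G] [MulAction G Ω]
    [FaithfulSMul G Ω] (N : Subgroup G) [IsMulCommutative N] [IsPretransitive N Ω] (ω : Ω) :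
    Function.Bijective fun n : N => n • ω := by
  refine ⟨fun a b hab => ?_, fun x => exists_smul_eq N ω x⟩
  have : (b⁻¹ * a) • ω = ω := by
    rw [mul_smul, inv_smul_eq_iff]
    exact hab
  exact (inv_mul_eq_one.mp (eq_one_of_smul_eq_of_isMulCommutative this)).symm

/-- A group with a regular abelian normal subgroup acts by affine permutations. -/
theorem RigidAction.of_affineRigid {p : ℕ} (hp : p.Prime) {G Ω : Type*} [Group G] [MulAction G Ω]
    [FaithfulSMul G Ω] (hG : ¬ p ∣ Nat.card G) {N : Subgroup G} [N.Normal] [IsMulCommutative N]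
    [IsPretransitive N Ω] (ω : Ω) (h : AffineRigid p (Additive N)) : RigidAction p G Ω := by
  obtain ⟨f, hf⟩ := h
  let φ : Additive N ≃ Ω :=
    Additive.toMul.trans (Equiv.ofBijective _ (bijective_smul_of_isMulCommutative N ω))
  have hφ : ∀ n, φ n = (n.toMul : G) • ω := fun n => rfl
  refine ⟨f ∘ φ.symm, fun g hg => ?_⟩
  let σ : Perm (Additive N) := φ.symm.permCongrHom (toPermHom G Ω g)
  have hσ : ∀ n, φ (σ n) = g • φ n := fun n => φ.apply_symm_apply _
  let C : Additive N →+ Additive N := MonoidHom.toAdditive (MulAut.conjNormal g).toMonoidHom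
  have hC : ∀ n, ((C n).toMul : G) = g * n.toMul * g⁻¹ := fun n => MulAut.conjNormal_apply g _
  have hσC : ∀ n, σ n = C n + σ 0 := fun n => by
    apply φ.injective
    have h0 := hσ 0
    rw [hσ, hφ, hφ, toMul_add, Subgroup.coe_mul, mul_smul, ← hφ (σ 0), h0, hφ, hC]
    simp [mul_smul]
  have h1 : σ = 1 := by
    refine hf σ (fun x y z => ?_) (fun x => ?_)
      ⟨Nat.card G, (Nat.Prime.coprime_iff_not_dvd hp).mpr hG, ?_⟩
    · rw [hσC (x + y - z), hσC x, hσC y, hσC z, map_sub, map_add]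
      abel
    · have := hg (φ x)
      rw [← hσ] at this
      simpa using this
    · rw [← map_pow, ← map_pow, pow_card_eq_one', map_one, map_one]
  intro x
  have := hσ (φ.symm x)
  rw [h1] at this
  simpa using this.symm

/-- A group fixing a point of an `8`-element set and normalising a `7`-cycle on the remaining points
has a rigid colouring: colour the fixed point, a line of the Fano plane and its complement. -/
theorem rigidAction_three_of_pow_seven {G Ω : Type*} [Group G] [Finite Ω] [MulAction G Ω]
    [FaithfulSMul G Ω] (hG : ¬ 3 ∣ Nat.card G) (hΩ : Nat.card Ω = 8) {ω : Ω} {σ : G}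
    (hσ7 : σ ^ 7 = 1) (hσ1 : σ ≠ 1) (hσω : σ • ω = ω)
    (hσ : ∀ g : G, g • ω = ω → Commute (g * σ * g⁻¹) σ) : RigidAction 3 G Ω := by
  classical
  obtain ⟨e, he⟩ : ∃ e : Ω, σ • e ≠ e := by
    by_contra! h
    exact hσ1 (eq_of_smul_eq_smul fun x : Ω => by rw [h, one_smul])
  let P : ZMod 7 → Ω := fun i => σ ^ i.val • e
  have hPnat : ∀ a : ℕ, σ ^ a • e = P a := fun a => by
    simp only [P, ZMod.val_natCast]
    rw [pow_eq_pow_mod a hσ7]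
  have hPadd : ∀ i k : ZMod 7, σ ^ i.val • P k = P (i + k) := fun i k => by
    simp only [P]
    rw [← mul_smul, ← pow_add, hPnat]
    simp [P]
  have hP0 : P 0 = e := by simp [P]
  have hPinj : Function.Injective P := by
    intro i k hik
    by_contra hne
    have h1 : P (i - k) = e := by
      have := hPadd k (i - k)
      rw [add_sub_cancel, hik] at this
      exact smul_left_cancel _ this
    have h2 : period σ e ∣ (i - k).val := pow_smul_eq_iff_period_dvd.mp h1
    have h3 : period σ e ∣ 7 := pow_smul_eq_iff_period_dvd.mp (by rw [hσ7, one_smul])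
    rcases (Nat.dvd_prime (by norm_num)).mp h3 with h | h
    · exact he (by simpa using pow_smul_eq_iff_period_dvd.mpr (h.dvd : period σ e ∣ 1))
    · rw [h] at h2
      have h4 := Nat.eq_zero_of_dvd_of_lt h2 (ZMod.val_lt _)
      exact hne (sub_eq_zero.mp ((ZMod.val_eq_zero _).mp h4))
  have hσpow : ∀ a : ℕ, σ ^ a • ω = ω := fun a => (stabilizer G ω).pow_mem hσω a
  have hPω : ∀ i, P i ≠ ω := fun i hi => by
    have h1 : e = ω := smul_left_cancel (σ ^ i.val) (hi.trans (hσpow _).symm)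
    exact he (h1 ▸ hσω)
  have hcov : ∀ x, x = ω ∨ ∃ i, x = P i := by
    let Q : Option (ZMod 7) → Ω := fun o => o.elim ω P
    have hQ : Function.Injective Q := by
      rintro (_ | i) (_ | k) h
      · rfl
      · exact absurd h.symm (hPω k)
      · exact absurd h (hPω i)
      · exact congrArg some (hPinj h)
    have := Fintype.ofFinite Ω
    have hQs : Function.Bijective Q :=
      (Fintype.bijective_iff_injective_and_card Q).mpr ⟨hQ, by
        rw [← Nat.card_eq_fintype_card (α := Ω), hΩ]; simp [ZMod.card]⟩
    intro x
    obtain ⟨_ | i, rfl⟩ := hQs.2 x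
    · exact .inl rfl
    · exact .inr ⟨i, rfl⟩
  refine ⟨fun x => if x = ω then 1 else if x = P 0 ∨ x = P 1 ∨ x = P 3 then 2 else 0,
    fun g hg => ?_⟩
  have hgω : g • ω = ω := by
    by_contra hne
    have := hg ω
    simp only [hne, if_false, if_true] at this
    split_ifs at this <;> exact absurd this (by decide)
  have hgP : ∀ i, g • P i ≠ ω := fun i hi => hPω i (smul_left_cancel g (hi.trans hgω.symm))
  obtain ⟨c, hc⟩ := (hcov (g • P 0)).resolve_left (hgP 0)
  obtain ⟨j, hj⟩ : ∃ j : ZMod 7, ∀ x : Ω, (g * σ * g⁻¹) • x = σ ^ j.val • x := by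
    have hτω : (g * σ * g⁻¹) • ω = ω := by
      have : g⁻¹ • ω = ω := inv_smul_eq_iff.mpr hgω.symm
      rw [mul_smul, mul_smul, this, hσω, hgω]
    obtain ⟨j, hj⟩ := (hcov ((g * σ * g⁻¹) • e)).resolve_left fun h => hPω 0
      (hP0.trans (smul_left_cancel (g * σ * g⁻¹) (h.trans hτω.symm)))
    refine ⟨j, fun x => ?_⟩
    rcases hcov x with rfl | ⟨i, rfl⟩
    · rw [hτω, hσpow]
    · rw [hPadd, add_comm, ← hPadd, ← hj, ← mul_smul, ← mul_smul,
        ((hσ g hgω).pow_right i.val).eq, mul_smul]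
  have hconj : ∀ (a : ℕ) (x : Ω), (g * σ * g⁻¹) ^ a • x = σ ^ (j.val * a) • x := by
    intro a
    induction a with
    | zero => simp
    | succ a ih =>
      intro x
      rw [pow_succ, mul_smul, hj, ih, ← mul_smul, ← pow_add, mul_add_one]
  have hact : ∀ i, g • P i = P (j * i + c) := by
    intro i
    have h1 : g • P i = (g * σ * g⁻¹) ^ i.val • g • P 0 := by
      rw [conj_pow, hP0, mul_smul, inv_smul_smul, mul_smul]
    rw [h1, hconj, hc, ← mul_smul, ← pow_add, hPnat]
    simp
  have hset : ∀ i, (i = 0 ∨ i = 1 ∨ i = 3) →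
      (j * i + c = 0 ∨ j * i + c = 1 ∨ j * i + c = 3) := by
    intro i hi
    have := hg (P i)
    simp only [hact, hPω, hPinj.eq_iff, if_false, hi, if_true] at this
    by_contra hne
    rw [if_neg hne] at this
    exact absurd this (by decide)
  have hj0 : j ≠ 0 := by
    rintro rfl
    have := hPinj (smul_left_cancel g ((hact 0).trans ((by simp : P (0 * 0 + c) = _).trans
      (hact 1).symm)))
    exact absurd this (by decide)
  have hcube : ∀ i, j * (j * (j * i + c) + c) + c = i := by
    have h0 := hset 0 (by decide)
    have h1 := hset 1 (by decide)
    have h3 := hset 3 (by decide)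
    clear hset hact hconj hj hc
    revert j c
    decide
  have hg3 : g ^ 3 = 1 := eq_of_smul_eq_smul fun x : Ω => by
    rw [one_smul, pow_succ, pow_two, mul_smul, mul_smul]
    rcases hcov x with rfl | ⟨i, rfl⟩
    · rw [hgω, hgω, hgω]
    · rw [hact, hact, hact, hcube]
  intro x
  rw [eq_one_of_pow_eq_one_of_not_dvd_card Nat.prime_three hG hg3, one_smul]

/-- Primitive groups of degree `4` or `8` of order prime to `3`. -/
theorem rigidAction_three_of_card {G Ω : Type*} [Group G] [Finite G] [Group.IsSolvable G]
    [Finite Ω] [MulAction G Ω] [FaithfulSMul G Ω] [IsPreprimitive G Ω] (hG : ¬ 3 ∣ Nat.card G)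
    (hΩ : Nat.card Ω = 4 ∨ Nat.card Ω = 8) {N : Subgroup G} [N.Normal] [IsMulCommutative N]
    [IsPretransitive N Ω] : RigidAction 3 G Ω := by
  classical
  have : Nontrivial Ω := Finite.one_lt_card_iff_nontrivial.mp (by omega)
  obtain ⟨ω⟩ : Nonempty Ω := inferInstance
  by_cases hH : Nontrivial (stabilizer G ω)
  swap
  · rw [Subgroup.nontrivial_iff_ne_bot, not_not] at hH
    refine ⟨fun x => if x = ω then 1 else 0, fun g hg x => ?_⟩
    have h1 : g ∈ stabilizer G ω := by
      by_contra hne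
      rw [mem_stabilizer_iff] at hne
      simpa [hne] using hg ω
    rw [hH, Subgroup.mem_bot] at h1
    rw [h1, one_smul]
  obtain ⟨r, hr, M₀, hM₀, hM₀c, hM₀ne, hM₀r⟩ :=
    exists_elementaryAbelian_normal (stabilizer G ω)
  let M : Subgroup G := M₀.map (stabilizer G ω).subtype
  have hMω : ∀ m ∈ M, m • ω = ω := by
    rintro _ ⟨m, -, rfl⟩
    exact m.2
  have hMconj : ∀ t ∈ stabilizer G ω, ∀ m ∈ M, t * m * t⁻¹ ∈ M := by
    rintro t ht _ ⟨m, hm, rfl⟩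
    exact ⟨⟨t, ht⟩ * m * ⟨t, ht⟩⁻¹, hM₀.conj_mem m hm _, rfl⟩
  have hMcomm : ∀ a ∈ M, ∀ b ∈ M, a * b = b * a := by
    rintro _ ⟨a, ha, rfl⟩ _ ⟨b, hb, rfl⟩
    have := mul_comm (⟨a, ha⟩ : M₀) ⟨b, hb⟩
    exact congrArg (fun x : M₀ => ((x : stabilizer G ω) : G)) this
  have hMr : ∀ m ∈ M, m ^ r = 1 := by
    rintro _ ⟨m, hm, rfl⟩
    rw [← map_pow, hM₀r m hm, map_one]
  obtain ⟨σ, hσM, hσ1⟩ : ∃ σ ∈ M, σ ≠ 1 := by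
    obtain ⟨m, hm1⟩ := Subgroup.ne_bot_iff_exists_ne_one.mp hM₀ne
    refine ⟨_, ⟨m, m.2, rfl⟩, fun h => hm1 ?_⟩
    exact Subtype.ext (Subtype.ext h)
  have hMnot : ¬ M.Normal := fun hMn => by
    have hpre : IsPretransitive M Ω := by
      refine IsQuasiPreprimitive.isPretransitive_of_normal (G := G) fun h => hσ1 ?_
      refine eq_of_smul_eq_smul fun x : Ω => ?_
      have hx : x ∈ fixedPoints M Ω := h ▸ Set.mem_univ x
      rw [one_smul]
      exact hx ⟨σ, hσM⟩
    obtain ⟨x, hx⟩ := exists_ne ω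
    obtain ⟨m, hm⟩ := exists_smul_eq M ω x
    exact hx (hm.symm.trans (hMω m m.2))
  have hnorm : Subgroup.normalizer (M : Set G) = stabilizer G ω := by
    have hle : stabilizer G ω ≤ Subgroup.normalizer (M : Set G) := fun t ht => by
      refine Subgroup.mem_normalizer_iff.mpr fun m => ⟨hMconj t ht m, fun hm => ?_⟩
      have := hMconj t⁻¹ (inv_mem ht) _ hm
      simpa [mul_assoc] using this
    refine ((IsPreprimitive.isCoatom_stabilizer_of_isPreprimitive G ω).le_iff.mp hle).resolve_left
      fun h => hMnot (Subgroup.normalizer_eq_top_iff.mp h)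
  have hfix : ∀ x, x ∈ fixedPoints M Ω → x = ω := by
    intro x hx
    obtain ⟨n, rfl⟩ := exists_smul_eq N ω x
    have hcomm : ∀ m ∈ M, m * n * m⁻¹ = n := by
      intro m hm
      let n' : N := ⟨m * n * m⁻¹, Subgroup.Normal.conj_mem inferInstance _ n.2 m⟩
      have : n' • ω = n • ω := by
        change (m * n * m⁻¹) • ω = n • ω
        rw [mul_smul, hMω _ (inv_mem hm), mul_smul]
        exact hx ⟨m, hm⟩
      exact congrArg Subtype.val ((bijective_smul_of_isMulCommutative N ω).1 this)
    have hn : (n : G) ∈ stabilizer G ω := by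
      rw [← hnorm]
      refine Subgroup.mem_normalizer_iff.mpr fun m => ⟨fun hm => ?_, fun hm => ?_⟩
      · have h1 : (n : G) * m * (n : G)⁻¹ = m := by
          rw [mul_inv_eq_iff_eq_mul]
          exact (mul_inv_eq_iff_eq_mul.mp (hcomm m hm)).symm
        rwa [h1]
      · have h1 := mul_inv_eq_iff_eq_mul.mp (hcomm _ hm)
        have h2 : (n : G) * m * (n : G)⁻¹ = m := by
          have : (n : G) * m = n * (n * m * (n : G)⁻¹) := by
            rw [← h1]; group
          exact (mul_left_cancel this).symm
        rwa [h2] at hm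
    exact hn
  have : Fact r.Prime := ⟨hr⟩
  have hMp : IsPGroup r M := fun m => ⟨1, Subtype.ext (by simpa using hMr m m.2)⟩
  have hcard := hMp.card_modEq_card_fixedPoints Ω
  have hfix1 : Nat.card (fixedPoints M Ω) = 1 := by
    have : fixedPoints M Ω = {ω} := Set.eq_singleton_iff_unique_mem.mpr
      ⟨fun m => hMω m m.2, hfix⟩
    rw [this]
    simp
  rw [hfix1] at hcard
  have hr3 : r ≠ 3 := by
    rintro rfl
    exact hσ1 (eq_one_of_pow_eq_one_of_not_dvd_card hr hG (hMr σ hσM))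
  have hΩ8 : r = 7 ∧ Nat.card Ω = 8 := by
    have hdvd := (Nat.modEq_iff_dvd' (by omega)).mp hcard.symm
    rcases hΩ with h | h <;> rw [h] at hdvd
    · exact absurd ((Nat.prime_dvd_prime_iff_eq hr Nat.prime_three).mp hdvd) hr3
    · exact ⟨(Nat.prime_dvd_prime_iff_eq hr (by norm_num)).mp hdvd, h⟩
  obtain ⟨rfl, hΩ8⟩ := hΩ8
  exact rigidAction_three_of_pow_seven hG hΩ8 (hMr σ hσM) hσ1 (hMω σ hσM)
    fun g hg => hMcomm _ (hMconj g hg σ hσM) _ hσM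

theorem exists_addEquiv_pi_zmod {q : ℕ} [Fact q.Prime] {V : Type*} [AddCommGroup V] [Finite V]
    [Nontrivial V] (h : ∀ x : V, q • x = 0) :
    ∃ d : ℕ, 1 ≤ d ∧ Nat.card V = q ^ d ∧ Nonempty (V ≃+ (Fin d → ZMod q)) := by
  obtain ⟨_⟩ : Nonempty (Module (ZMod q) V) := ⟨AddCommGroup.zmodModule h⟩
  have hcard : Nat.card V = q ^ Module.finrank (ZMod q) V := by
    rw [Module.natCard_eq_pow_finrank (K := ZMod q), Nat.card_zmod]
  refine ⟨Module.finrank (ZMod q) V, Nat.one_le_iff_ne_zero.mpr fun h0 => ?_, hcard,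
    ⟨(LinearEquiv.ofFinrankEq (R := ZMod q) _ _ (by simp)).toAddEquiv⟩⟩
  rw [h0, pow_zero] at hcard
  exact (Finite.one_lt_card (α := V)).ne hcard.symm

/-- The primitive faithful case. -/
theorem rigidAction_of_isPreprimitive {p : ℕ} (hp : p.Prime) {G Ω : Type*} [Group G] [Finite G]
    [Group.IsSolvable G] [Finite Ω] [MulAction G Ω] [FaithfulSMul G Ω] [IsPreprimitive G Ω]
    (hG : ¬ p ∣ Nat.card G) : RigidAction p G Ω := by
  rcases subsingleton_or_nontrivial G with hsub | hnon
  · exact ⟨fun _ => 0, fun g _ x => by rw [Subsingleton.elim g 1, one_smul]⟩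
  obtain ⟨q, hq, N, hN, hNc, hNne, hNq⟩ := exists_elementaryAbelian_normal G
  obtain ⟨n, hn1⟩ := Subgroup.ne_bot_iff_exists_ne_one.mp hNne
  have hpre : IsPretransitive N Ω := by
    refine IsQuasiPreprimitive.isPretransitive_of_normal (G := G) fun h => hn1 (Subtype.ext ?_)
    refine eq_of_smul_eq_smul fun x : Ω => ?_
    have hx : x ∈ fixedPoints N Ω := h ▸ Set.mem_univ x
    rw [OneMemClass.coe_one, one_smul]
    exact hx n
  have : Fact p.Prime := ⟨hp⟩
  have : Fact q.Prime := ⟨hq⟩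
  have hpq : p ≠ q := by
    rintro rfl
    exact hn1 (Subtype.ext (eq_one_of_pow_eq_one_of_not_dvd_card hp hG (hNq n n.2)))
  obtain ⟨ω⟩ : Nonempty Ω := by
    by_contra hemp
    rw [not_nonempty_iff] at hemp
    obtain ⟨g, hg⟩ := exists_ne (1 : G)
    exact hg (eq_of_smul_eq_smul fun x : Ω => hemp.elim x)
  have : Nontrivial (Additive N) := ⟨Additive.ofMul n, 0, hn1⟩
  obtain ⟨d, hd, hcard, ⟨φ⟩⟩ := exists_addEquiv_pi_zmod (V := Additive N) fun x =>
    congrArg Additive.ofMul (Subtype.ext (hNq x.toMul x.toMul.2) : x.toMul ^ q = 1)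
  by_cases hex : p = 3 ∧ q = 2 ∧ (d = 2 ∨ d = 3)
  · obtain ⟨rfl, rfl, hd⟩ := hex
    refine rigidAction_three_of_card hG ?_ (N := N)
    rw [← Nat.card_congr (Equiv.ofBijective _ (bijective_smul_of_isMulCommutative N ω)),
      ← Nat.card_congr (Additive.toMul (α := N)), hcard]
    rcases hd with rfl | rfl <;> norm_num
  · exact RigidAction.of_affineRigid hp hG ω (N := N)
      (AffineRigid.of_addEquiv φ.symm (affineRigid_pi_zmod hpq hd hex))

/-- Every action of a finite solvable group of order prime to `p` has a rigid colouring. -/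
theorem rigidAction_of_isSolvable {p : ℕ} (hp : p.Prime) (k : ℕ) {G Ω : Type} [Group G] [Finite G]
    [Group.IsSolvable G] [Finite Ω] [MulAction G Ω] (hG : ¬ p ∣ Nat.card G)
    (hk : Nat.card Ω = k) : RigidAction p G Ω := by
  induction k using Nat.strong_induction_on generalizing G Ω with
  | _ k ih =>
  subst hk
  rcases isEmpty_or_nonempty Ω with hemp | ⟨⟨a⟩⟩
  · exact ⟨fun _ => 0, fun _ _ x => hemp.elim x⟩
  by_cases htrans : IsPretransitive G Ω
  swap
  · let C : SubMulAction G Ω :=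
      { carrier := (orbit G a)ᶜ
        smul_mem' := fun g x hx h => hx (by
          simpa using mem_orbit_of_mem_orbit g⁻¹ h) }
    have hC : ∀ x, x ∈ C ↔ x ∉ orbit G a := fun x => Iff.rfl
    obtain ⟨b, hb⟩ : ∃ b, b ∉ orbit G a := by
      by_contra! h
      exact htrans ((isPretransitive_iff_orbit_eq_univ a).mpr (Set.eq_univ_of_forall h))
    refine RigidAction.of_orbit a C hC (ih _ ?_ hG rfl) (ih _ ?_ hG rfl)
    · exact Finite.card_subtype_lt hb
    · exact Finite.card_subtype_lt (p := (· ∈ C)) fun h => (hC a).mp h (mem_orbit_self a)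
  by_cases hprim : IsPreprimitive G Ω
  swap
  · obtain ⟨B, hB, hBt⟩ : ∃ B : Set Ω, IsBlock G B ∧ ¬ IsTrivialBlock B := by
      by_contra! h
      exact hprim { isTrivialBlock_of_isBlock := fun {B} hB => h B hB }
    rw [IsTrivialBlock, not_or, Set.not_subsingleton_iff] at hBt
    have hprod := hB.ncard_block_mul_ncard_orbit_eq hBt.1.nonempty
    have hBlt : B.ncard < Nat.card Ω := by
      rw [← Set.ncard_univ]
      exact Set.ncard_lt_ncard (Set.ssubset_univ_iff.mpr hBt.2)
    have hB1 : 1 < B.ncard := (Set.one_lt_ncard_iff_nontrivial).mpr hBt.1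
    refine RigidAction.of_block hp hG hB hBt.1.nonempty (ih _ ?_ ?_ rfl) (ih _ ?_ hG rfl)
    · exact hBlt
    · exact fun h => hG (h.trans (Subgroup.card_subgroup_dvd_card _))
    · change (orbit G B).ncard < _
      nlinarith
  let I := (toPermHom G Ω).range
  have hI : ¬ p ∣ Nat.card I := fun h => hG (h.trans (Subgroup.card_range_dvd _))
  have hprimI : IsPreprimitive I Ω := by
    let φ : Ω →ₑ[(toPermHom G Ω).rangeRestrict] Ω := { toFun := id, map_smul' := fun _ _ => rfl }
    exact IsPreprimitive.of_surjective (f := φ) Function.surjective_id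
  have : Group.IsSolvable I :=
    Group.isSolvable_of_surjective (toPermHom G Ω).rangeRestrict_surjective
  obtain ⟨f, hf⟩ := rigidAction_of_isPreprimitive hp (Ω := Ω) hI
  exact ⟨f, fun g hg => hf ⟨toPermHom G Ω g, g, rfl⟩ hg⟩

/-- **Halasi–Podoski, Theorem 2.5.**
Let `G ≤ Sym({1,…,n})` be a solvable permutation group of degree `n` and `p` a prime not
dividing `|G|`.  Considering the action of `G` on `𝔽_p^n` permuting coordinates
(`g • a = a ∘ g⁻¹`), there is a vector `a ∈ 𝔽_p^n` fixed only by the identity of `G`. -/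
theorem solvable_permutation_group_regular_vector
    (n : ℕ) (p : ℕ) (hp : p.Prime)
    (G : Subgroup (Equiv.Perm (Fin n))) (hsolv : IsSolvable G)
    (hpG : ¬ (p ∣ Nat.card G)) :
    ∃ a : Fin n → ZMod p, ∀ g ∈ G, (∀ i : Fin n, a (g⁻¹ i) = a i) → g = 1 := by
  have : Group.IsSolvable G := hsolv
  obtain ⟨a, ha⟩ := rigidAction_of_isSolvable hp _ (G := G) (Ω := Fin n) hpG rfl
  refine ⟨a, fun g hg h => Equiv.ext (ha ⟨g, hg⟩ fun x => ?_)⟩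
  have := h (g x)
  rw [← Perm.mul_apply, inv_mul_cancel, Perm.one_apply] at this
  exact this.symm
end
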